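/- There exists a strong SO₃-equivariant deformation retraction from Hom_N(P²) to SO₃; that is, a jointly continuous map ρ : Hom_N(P²) × [0,1] → Hom_N(P²) such that ρ(f,0) = f for all f ∈ Hom_N(P²), for every f the homeomorphism ρ(f,1) is induced by some Q ∈ SO₃, ρ(Q̄,t) = Q̄ for every map Q̄ induced by Q ∈ SO₃ and every t ∈ [0,1], and ρ(Q̄ ∘ f, t) = Q̄ ∘ ρ(f,t) for every Q ∈ SO₃, f ∈ Hom_N(P²), and t ∈ [0,1]. -/

import Mathlib

open Metric unitInterval MeasureTheory

noncomputable section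

/-- The Euclidean 3-space. -/
abbrev E3 : Type := EuclideanSpace ℝ (Fin 3)

/-- The unit 2-sphere in `ℝ³`. -/
abbrev Sph : Type := Metric.sphere (0 : E3) 1

/-- The antipodal equivalence relation `x ~ -x` on the sphere. -/
instance antipodalSetoid : Setoid Sph where
  r x y := (x : E3) = (y : E3) ∨ (x : E3) = -(y : E3)
  iseqv := by
    refine ⟨fun x => Or.inl rfl, ?_, ?_⟩
    · rintro x y (h | h)
      · exact Or.inl h.symm
      · exact Or.inr (by rw [h, neg_neg])
    · rintro x y z (h1 | h1) (h2 | h2)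
      · exact Or.inl (h1.trans h2)
      · exact Or.inr (h1.trans h2)
      · exact Or.inr (by rw [h1, h2])
      · exact Or.inl (by rw [h1, h2, neg_neg])

/-- The real projective plane, as the quotient of the sphere by the antipodal relation,
with the quotient topology. -/
abbrev P2 : Type := Quotient antipodalSetoid

instance : MeasurableSpace P2 := borel P2

/-- The quotient map `π : S² → P²`. -/
def π : Sph → P2 := Quotient.mk antipodalSetoid

/-- The surface measure on the sphere: the 2-dimensional Hausdorff measure. -/
def μSph : Measure Sph := Measure.hausdorffMeasure 2

/-- The pushforward measure `π_* μ` on the projective plane. -/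
def μP2 : Measure P2 := Measure.map π μSph

/-- The group of nullity-preserving self-homeomorphisms of the projective plane, as a subspace
of `C(P², P²)` with the compact-open topology. -/
abbrev HomNP2 : Type :=
  {f : C(P2, P2) // IsHomeomorph f ∧ ∀ A : Set P2, μP2 A = 0 ↔ μP2 (f '' A) = 0}

/-- `g` is the self-homeomorphism of `P²` induced by the (orthogonal) matrix `Q`,
i.e. `g ∘ π = π ∘ Q` where `π` is the quotient map. -/
def InducedBy (g : HomNP2) (Q : Matrix (Fin 3) (Fin 3) ℝ) : Prop :=
  ∀ x y : Sph, (y : E3) = Q.mulVec (x : E3) → g.1 (π x) = π y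

/-- Composition in `Hom_N(P²)`: composing two nullity-preserving homeomorphisms. -/
def compH (g f : HomNP2) : HomNP2 :=
  ⟨g.1.comp f.1, by rw [ContinuousMap.coe_comp]; exact g.2.1.comp f.2.1, by
    intro A
    rw [f.2.2 A, g.2.2 (f.1 '' A), ContinuousMap.coe_comp, Set.image_comp]⟩

open InnerProductSpace
open Complex (add_re mul_re mul_im ofReal_re ofReal_im I_re I_im norm_le_abs_re_add_abs_im normSq_apply re_ofReal_mul slitPlane exp_log slitPlane_ne_zero exp_add exp_sub exp_pi_mul_I log_exp exp_ne_zero log_im abs_re_le_norm sub_im norm_exp_ofReal_mul_I continuous_re continuous_im sub_re abs_im_le_norm add_im imLm norm_real reCLM zero_re zero_im norm_I)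
open Real (circleAverage circleAverage_smul circleAverage_mono pi two_pi_pos cosh_pos log_div log_mul log_le_log pi_pos norm_eq_abs pi_gt_three rpow_pos_of_pos cosh_sq sin_sq_add_cos_sq)

def SubM (v : ℂ → ℝ) (Ω : Set ℂ) : Prop :=
  ∀ z ∈ Ω, ∃ r0 > 0, ∀ r, 0 < r → r < r0 → v z ≤ circleAverage v z r

lemma Cont.ci {v : ℂ → ℝ} (hv : Continuous v) (c : ℂ) (r : ℝ) : CircleIntegrable v c r :=
  hv.continuousOn.circleIntegrable'

lemma SubM.mono {v : ℂ → ℝ} {Ω Ω' : Set ℂ} (h : SubM v Ω) (hs : Ω' ⊆ Ω) : SubM v Ω' :=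
  fun z hz => h z (hs hz)

lemma SubM.add {u v : ℂ → ℝ} {Ω : Set ℂ} (hu : SubM u Ω) (hv : SubM v Ω) (cu : Continuous u)
    (cv : Continuous v) : SubM (fun z => u z + v z) Ω := by
  intro z hz
  obtain ⟨a, ha, h1⟩ := hu z hz
  obtain ⟨b, hb, h2⟩ := hv z hz
  refine ⟨min a b, lt_min ha hb, fun r hr hr' => ?_⟩
  have := Real.circleAverage_add (Cont.ci cu z r) (Cont.ci cv z r)
  have e : (fun z => u z + v z) = u + v := rfl
  rw [e, this]
  exact add_le_add (h1 r hr (hr'.trans_le (min_le_left _ _))) (h2 r hr (hr'.trans_le (min_le_right _ _)))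

lemma SubM.const_mul {u : ℂ → ℝ} {Ω : Set ℂ} (hu : SubM u Ω) {k : ℝ} (hk : 0 ≤ k) :
    SubM (fun z => k * u z) Ω := by
  intro z hz
  obtain ⟨a, ha, h1⟩ := hu z hz
  refine ⟨a, ha, fun r hr hr' => ?_⟩
  have := circleAverage_smul (a := k) (f := u) (c := z) (R := r)
  have e : (fun z => k * u z) = k • u := rfl
  rw [e, this]
  exact mul_le_mul_of_nonneg_left (h1 r hr hr') hk

lemma SubM.const (k : ℝ) (Ω : Set ℂ) : SubM (fun _ => k) Ω := fun z _ =>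
  ⟨1, one_pos, fun r _ _ => by rw [Real.circleAverage_const]⟩

lemma SubM.max {u v : ℂ → ℝ} {Ω : Set ℂ} (hu : SubM u Ω) (hv : SubM v Ω) (cu : Continuous u)
    (cv : Continuous v) : SubM (fun z => max (u z) (v z)) Ω := by
  intro z hz
  obtain ⟨a, ha, h1⟩ := hu z hz
  obtain ⟨b, hb, h2⟩ := hv z hz
  refine ⟨min a b, lt_min ha hb, fun r hr hr' => ?_⟩
  have cm : Continuous fun z => Max.max (u z) (v z) := cu.max cv
  apply max_le
  · exact (h1 r hr (hr'.trans_le (min_le_left _ _))).trans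
      (circleAverage_mono (Cont.ci cu z r) (Cont.ci cm z r) fun x _ => le_max_left _ _)
  · exact (h2 r hr (hr'.trans_le (min_le_right _ _))).trans
      (circleAverage_mono (Cont.ci cv z r) (Cont.ci cm z r) fun x _ => le_max_right _ _)

open InnerProductSpace in
lemma HarmonicOnNhd.subM {u : ℂ → ℝ} {Ω : Set ℂ} (ho : IsOpen Ω) (h : HarmonicOnNhd u Ω) :
    SubM u Ω := by
  intro z hz
  obtain ⟨e, he, hs⟩ := Metric.isOpen_iff.1 ho z hz
  refine ⟨e, he, fun r hr hr' => ?_⟩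
  rw [InnerProductSpace.HarmonicOnNhd.circleAverage_eq]
  rw [abs_of_pos hr]
  exact h.mono ((closedBall_subset_ball hr').trans hs)

lemma avg_eq_max {v : ℂ → ℝ} (hv : Continuous v) {z : ℂ} {r M : ℝ}
    (hle : ∀ x ∈ sphere z |r|, v x ≤ M) (h : M ≤ circleAverage v z r) (x : ℂ)
    (hx : x ∈ sphere z |r|) : v x = M := by
  by_contra hne
  have hlt : v x < M := lt_of_le_of_ne (hle x hx) hne
  obtain ⟨θ, hθ, rfl⟩ : ∃ θ ∈ Set.Ioc 0 (2 * pi), circleMap z r θ = x := by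
    rw [← image_circleMap_Ioc] at hx; exact hx
  have : circleAverage v z r < M := by
    have key : ∫ θ in (0:ℝ)..2 * pi, v (circleMap z r θ) < ∫ θ in (0:ℝ)..2 * pi, M := by
      apply intervalIntegral.integral_lt_integral_of_continuousOn_of_le_of_exists_lt
        two_pi_pos
      · exact (hv.comp (continuous_circleMap z r)).continuousOn
      · exact continuousOn_const
      · intro t _; exact hle _ (circleMap_mem_sphere' z r t)
      · exact ⟨θ, ⟨hθ.1.le, hθ.2⟩, hlt⟩
    rw [Real.circleAverage_def]
    calc (2 * pi)⁻¹ • ∫ θ in (0:ℝ)..2 * pi, v (circleMap z r θ)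
        < (2 * pi)⁻¹ • ∫ θ in (0:ℝ)..2 * pi, M := by
          apply mul_lt_mul_of_pos_left key (inv_pos.2 two_pi_pos)
      _ = M := by simp; field_simp
  linarith

theorem maxP_bdd {Ω : Set ℂ} (ho : IsOpen Ω) (hb : Bornology.IsBounded Ω) {v : ℂ → ℝ}
    (cv : Continuous v) (hs : SubM v Ω) (hf : ∀ z ∈ frontier Ω, v z ≤ 0) :
    ∀ z ∈ Ω, v z ≤ 0 := by
  intro z0 hz0
  by_contra! hpos
  have hK : IsCompact (closure Ω) := hb.isCompact_closure
  obtain ⟨zm, hzm, hmax⟩ := hK.exists_isMaxOn ⟨z0, subset_closure hz0⟩ cv.continuousOn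
  have hM : 0 < v zm := hpos.trans_le (hmax (subset_closure hz0))
  have hS : IsCompact (closure Ω ∩ {z | v z = v zm}) :=
    hK.inter_right (isClosed_eq cv continuous_const)
  obtain ⟨z1, hz1, hmax1⟩ := hS.exists_isMaxOn ⟨zm, hzm, rfl⟩ continuous_re.continuousOn
  have hz1Ω : z1 ∈ Ω := by
    by_contra hn
    have := hf z1 (by rw [frontier, ho.interior_eq]; exact ⟨hz1.1, hn⟩)
    have h2 : v z1 = v zm := hz1.2
    linarith
  obtain ⟨r0, hr0, hsub⟩ := hs z1 hz1Ω
  obtain ⟨e, he, hball⟩ := Metric.isOpen_iff.1 ho z1 hz1Ω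
  have hr : 0 < min r0 e / 2 := half_pos (lt_min hr0 he)
  have hrr0 : min r0 e / 2 < r0 := by linarith [min_le_left r0 e]
  have hre : min r0 e / 2 < e := by linarith [min_le_right r0 e]
  set r := min r0 e / 2
  have hsph : ∀ x ∈ sphere z1 |r|, x ∈ closure Ω := fun x hx => subset_closure (hball (by
    rw [abs_of_pos hr, mem_sphere] at hx; rw [mem_ball, hx]; exact hre))
  have hmem : z1 + r ∈ sphere z1 |r| := by simp
  have := avg_eq_max cv (fun x hx => hmax (hsph x hx)) (hz1.2 ▸ hsub r hr hrr0) _ hmem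
  have h3 := hmax1 ⟨hsph _ hmem, this⟩
  simp at h3
  linarith

theorem maxP {Ω : Set ℂ} (ho : IsOpen Ω) {R : ℝ} (hb : ∀ z ∈ Ω, |z.im| ≤ R) {v : ℂ → ℝ}
    (cv : Continuous v) (hs : SubM v Ω) (hf : ∀ z ∈ frontier Ω, v z ≤ 0) {C : ℝ}
    (hC : ∀ z, |z.im| ≤ R → v z ≤ C * (1 + |z.re|)) :
    ∀ z ∈ Ω, v z ≤ 0 := by
  intro z0 hz0
  have hR : 0 ≤ R := (abs_nonneg _).trans (hb z0 hz0)
  set κ : ℝ := (1 + R)⁻¹ with hκ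
  have hκ0 : 0 < κ := by positivity
  set ψ : ℂ → ℝ := fun z => (Complex.cosh (κ * z)).re with hψ
  have hψe : ∀ z, ψ z = Real.cosh (κ * z.re) * Real.cos (κ * z.im) := by
    intro z
    have : (κ * z : ℂ) = ((κ * z.re : ℝ) : ℂ) + ((κ * z.im : ℝ) : ℂ) * Complex.I := by
      apply Complex.ext <;> simp
    rw [hψ]; simp only
    rw [this, Complex.cosh_add, Complex.cosh_mul_I, Complex.sinh_mul_I,
      ← Complex.ofReal_cosh, ← Complex.ofReal_cos, ← Complex.ofReal_sinh, ← Complex.ofReal_sin]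
    simp only [add_re, mul_re, mul_im, ofReal_re, ofReal_im,
      I_re, I_im]
    ring
  have cψ : Continuous ψ := by
    rw [hψ]; exact continuous_re.comp (Complex.continuous_cosh.comp (by fun_prop))
  have hcos : ∀ z : ℂ, |z.im| ≤ R → 1/2 ≤ Real.cos (κ * z.im) := by
    intro z hz
    have h1 : |κ * z.im| ≤ 1 := by
      rw [abs_mul, abs_of_pos hκ0, hκ, inv_mul_le_iff₀ (by positivity)]; linarith
    have := Real.one_sub_sq_div_two_le_cos (x := κ * z.im)
    have h2 : (κ * z.im)^2 ≤ 1 := by rw [← sq_abs]; nlinarith [abs_nonneg (κ * z.im)]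
    linarith
  have hcosh : ∀ x : ℝ, (κ * |x|)^2 / 4 ≤ Real.cosh (κ * x) := by
    intro x
    rw [← Real.cosh_abs, abs_mul, abs_of_pos hκ0]
    have := Real.quadratic_le_exp_of_nonneg (x := κ * |x|) (by positivity)
    have h3 := Real.add_one_le_exp (-(κ * |x|))
    rw [Real.cosh_eq]
    linarith
  have key : ∀ ε > 0, v z0 - ε * ψ z0 ≤ 0 := by
    intro ε hε
    have hd : 0 < ε * κ ^ 2 / 8 := by positivity
    set L : ℝ := max (|z0.re| + 1) (2 * |C| / (ε * κ ^ 2 / 8)) with hL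
    have hL1 : |z0.re| + 1 ≤ L := le_max_left _ _
    have hL0 : 1 ≤ L := by linarith [abs_nonneg z0.re]
    have hL2 : 2 * |C| ≤ L * (ε * κ ^ 2 / 8) := (div_le_iff₀ hd).1 (le_max_right _ _)
    have ho' : IsOpen (Ω ∩ {z : ℂ | |z.re| < L}) :=
      ho.inter (isOpen_lt (by fun_prop) continuous_const)
    have himcl : closure Ω ⊆ {z : ℂ | |z.im| ≤ R} :=
      closure_minimal (fun z hz => hb z hz) (isClosed_le (by fun_prop) continuous_const)
    have hsψ : SubM (fun z => -ε * ψ z) Ω := by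
      have h1 : InnerProductSpace.HarmonicOnNhd ψ Ω := fun z _ => by
        have : AnalyticAt ℂ (fun z : ℂ => Complex.cosh (κ * z)) z := by
          have : Differentiable ℂ (fun z : ℂ => Complex.cosh (κ * z)) := by fun_prop
          exact this.analyticAt z
        exact this.harmonicAt_re
      have h2 := h1.neg
      have h3 := (HarmonicOnNhd.subM ho h2).const_mul hε.le
      simpa using h3
    have := maxP_bdd ho' (v := fun z => v z + -ε * ψ z) (by
        refine (isBounded_iff_forall_norm_le).2 ⟨L + R, fun z hz => ?_⟩
        have h1 := norm_le_abs_re_add_abs_im z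
        have h2 : |z.re| < L := hz.2
        linarith [hb z hz.1]) (by fun_prop)
      ((hs.add hsψ cv (by fun_prop)).mono Set.inter_subset_left) (by
        intro z hz
        have hzc : z ∈ closure Ω := closure_mono Set.inter_subset_left hz.1
        have him : |z.im| ≤ R := himcl hzc
        have hc := hcos z him
        have hψ0 : 0 ≤ ψ z := by
          rw [hψe]; exact mul_nonneg (cosh_pos _).le (by linarith)
        by_cases hzΩ : z ∈ Ω
        · have hre : L ≤ |z.re| := by
            by_contra! hlt
            apply hz.2
            rw [ho'.interior_eq]; exact ⟨hzΩ, hlt⟩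
          have h1 := hC z him
          have h2 : ε * ((κ * |z.re|)^2 / 4 * (1/2)) ≤ ε * ψ z := by
            rw [hψe]
            apply mul_le_mul_of_nonneg_left _ hε.le
            exact mul_le_mul (hcosh _) hc (by norm_num) (cosh_pos _).le
          have h3 : C * (1 + |z.re|) ≤ 2 * |C| * |z.re| := by
            nlinarith [le_abs_self C, abs_nonneg C]
          have h4 : 2 * |C| * |z.re| ≤ L * (ε * κ ^ 2 / 8) * |z.re| :=
            mul_le_mul_of_nonneg_right hL2 (abs_nonneg _)
          have h5 : L * (ε * κ ^ 2 / 8) * |z.re| ≤ |z.re| * (ε * κ ^ 2 / 8) * |z.re| := by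
            gcongr
          nlinarith
        · have := hf z (by rw [frontier, ho.interior_eq]; exact ⟨hzc, hzΩ⟩)
          nlinarith) z0 ⟨hz0, by show |z0.re| < L; linarith⟩
    linarith
  by_contra! hpos
  have := key (v z0 / (2 * (|ψ z0| + 1))) (by positivity)
  have h2 : v z0 / (2 * (|ψ z0| + 1)) * ψ z0 ≤ v z0 / 2 := by
    rw [div_mul_eq_mul_div, div_le_div_iff₀ (by positivity) (by positivity)]
    nlinarith [le_abs_self (ψ z0)]
  linarith

def PI (c : ℂ) (R : ℝ) (g : ℂ → ℝ) (z : ℂ) : ℝ := circleAverage (poissonKernel c z • g) c R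

open Classical in
def pmod (c : ℂ) (R : ℝ) (g : ℂ → ℝ) (z : ℂ) : ℝ := if z ∈ ball c R then PI c R g z else g z

lemma pk_ci {c z : ℂ} {R : ℝ} (hz : z ∈ ball c R) {g : ℂ → ℝ} (hg : ContinuousOn g (sphere c |R|)) :
    CircleIntegrable (poissonKernel c z • g) c R := by
  apply ContinuousOn.circleIntegrable'
  rw [poissonKernel_eq_re_herglotzRieszKernel]
  exact (continuous_re.comp_continuousOn (continuousOn_herglotzRieszKernel_sphere hz)).smul hg

lemma pk_nonneg {c z w : ℂ} {R : ℝ} (hz : z ∈ ball c R) (hw : w ∈ sphere c |R|) :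
    0 ≤ poissonKernel c z w := by
  rw [poissonKernel_def]
  have h1 : ‖z - c‖ < R := mem_ball_iff_norm.1 hz
  have h2 : ‖w - c‖ = |R| := mem_sphere_iff_norm.1 hw
  have : 0 ≤ ‖w - c‖ ^ 2 - ‖z - c‖ ^ 2 := by
    rw [h2, sq_abs]; nlinarith [norm_nonneg (z - c)]
  positivity

lemma PI_mono {c z : ℂ} {R : ℝ} (hz : z ∈ ball c R) {f g : ℂ → ℝ} (hf : ContinuousOn f (sphere c |R|))
    (hg : ContinuousOn g (sphere c |R|)) (h : ∀ w ∈ sphere c |R|, f w ≤ g w) : PI c R f z ≤ PI c R g z :=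
  circleAverage_mono (pk_ci hz hf) (pk_ci hz hg) fun w hw => by
    simp only [Pi.smul_apply', smul_eq_mul]
    exact mul_le_mul_of_nonneg_left (h w hw) (pk_nonneg hz hw)

lemma PI_harm {c z : ℂ} {R : ℝ} (hz : z ∈ ball c R) {f : ℂ → ℝ}
    (hf : HarmonicOnNhd f (closedBall c R)) : PI c R f z = f z :=
  InnerProductSpace.HarmonicOnNhd.circleAverage_poissonKernel_smul hf hz

lemma PI_add {c z : ℂ} {R : ℝ} (hz : z ∈ ball c R) {f g : ℂ → ℝ} (hf : ContinuousOn f (sphere c |R|))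
    (hg : ContinuousOn g (sphere c |R|)) : PI c R (fun w => f w + g w) z = PI c R f z + PI c R g z := by
  rw [PI, PI, PI, ← Real.circleAverage_add (pk_ci hz hf) (pk_ci hz hg)]
  congr 1; ext w; simp [mul_add]

lemma PI_neg {c z : ℂ} {R : ℝ} {f : ℂ → ℝ} :
    PI c R (fun w => -f w) z = -PI c R f z := by
  have := circleAverage_smul (a := (-1:ℝ)) (f := poissonKernel c z • f) (c := c) (R := R)
  rw [PI, PI]
  rw [show -(circleAverage (poissonKernel c z • f) c R) =
    (-1:ℝ) • circleAverage (poissonKernel c z • f) c R by simp, ← this]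
  congr 1; ext w; simp

lemma PI_harmonic {c : ℂ} {R : ℝ} {g : ℂ → ℝ} (hg : ContinuousOn g (sphere c |R|)) :
    HarmonicOnNhd (PI c R g) (ball c R) := by
  set G : ℂ → ℝ := fun w => g (w + c)
  have cG : ContinuousOn G (sphere 0 |R|) :=
    hg.comp (by fun_prop) (fun w hw => by simpa using hw)
  set H : ℂ → ℂ := fun w => circleAverage (fun ζ ↦ herglotzRieszKernel 0 w ζ • (G ζ : ℂ)) 0 R
  have hH : AnalyticOnNhd ℂ H (ball 0 R) := analyticOnNhd_circleAverage_herglotzRieszKernel_smul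
    (Complex.continuous_ofReal.comp_continuousOn cG).circleIntegrable'
  intro z hz
  have hz0 : z - c ∈ ball 0 R := by simpa [dist_eq_norm] using hz
  have h1 : AnalyticAt ℂ (fun z => H (z - c)) z := by
    have : AnalyticAt ℂ (fun z => z - c) z := by fun_prop
    exact (hH _ hz0).comp_of_eq this rfl
  have h2 := h1.harmonicAt_re
  refine (harmonicAt_congr_nhds ?_).1 h2
  filter_upwards [isOpen_ball.mem_nhds hz] with w hw
  have hw0 : w - c ∈ ball 0 R := by simpa [dist_eq_norm] using hw
  have := re_circleAverage_herglotzRieszKernel_smul cG.circleIntegrable' hw0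
  show (H (w - c)).re = _
  rw [this, PI, ← poissonKernel_eq_re_herglotzRieszKernel, ← Real.circleAverage_map_add_const (c := c)]
  congr 1; ext ζ
  simp [G, poissonKernel_def]

lemma pmod_cont {c : ℂ} {R : ℝ} (hR : 0 < R) {g : ℂ → ℝ} (hg : Continuous g) :
    Continuous (pmod c R g) := by
  rw [continuous_iff_continuousAt]
  intro ζ
  by_cases h1 : ζ ∈ ball c R
  · have := (PI_harmonic hg.continuousOn ζ h1).1.continuousAt
    refine this.congr ?_
    filter_upwards [isOpen_ball.mem_nhds h1] with w hw
    simp [pmod, hw]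
  by_cases h2 : ζ ∈ closedBall c R
  swap
  · refine hg.continuousAt.congr ?_
    filter_upwards [isClosed_closedBall.isOpen_compl.mem_nhds h2] with w hw
    rw [pmod, if_neg]
    exact fun h => hw (ball_subset_closedBall h)
  have hζ : ‖ζ - c‖ = R := by
    rw [mem_closedBall_iff_norm] at h2; rw [mem_ball_iff_norm] at h1; linarith
  rw [Metric.continuousAt_iff]
  intro ε hε
  have e0 : pmod c R g ζ = g ζ := by simp [pmod, h1]
  rw [e0]
  obtain ⟨δ, hδ, hgδ⟩ := Metric.continuousAt_iff.1 hg.continuousAt (ε/2) (half_pos hε)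
  obtain ⟨M, hM⟩ : ∃ M, ∀ w ∈ sphere c R, |g w - g ζ| ≤ M := by
    obtain ⟨M, hM⟩ := (isCompact_sphere c R).exists_bound_of_continuousOn
      (f := fun w => g w - g ζ) (by fun_prop)
    exact ⟨M, hM⟩
  set K := |M| / δ ^ 2
  have hK : 0 ≤ K := by positivity
  set A : ℂ → ℝ := fun w => ε / 2 + K * (2 * R ^ 2) + (((-2 * K : ℝ) : ℂ) * (starRingEnd ℂ (ζ - c)) * (w - c)).re
  have cA : Continuous A := by fun_prop
  have hA : ∀ s, HarmonicOnNhd A s := fun s w _ => by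
    have : AnalyticAt ℂ (fun w => ((ε / 2 + K * (2 * R ^ 2) : ℝ) : ℂ) + ((-2 * K : ℝ) : ℂ) * (starRingEnd ℂ (ζ - c)) * (w - c)) w := by
      fun_prop
    have := this.harmonicAt_re
    simpa only [A, add_re, ofReal_re] using this
  have key : ∀ w ∈ sphere c |R|, |g w - g ζ| ≤ A w := by
    intro w hw
    rw [abs_of_pos hR] at hw
    have hwR : ‖w - c‖ = R := mem_sphere_iff_norm.1 hw
    have hAe : A w = ε / 2 + K * ‖w - ζ‖ ^ 2 := by
      have e1 : ‖w - ζ‖ ^ 2 = ‖w - c‖ ^ 2 + ‖ζ - c‖ ^ 2 - 2 * ((starRingEnd ℂ (ζ - c)) * (w - c)).re := by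
        simp only [← Complex.normSq_eq_norm_sq, normSq_apply]
        simp; ring
      rw [e1, hwR, hζ]
      simp only [A]
      rw [mul_assoc, re_ofReal_mul]; ring
    rw [hAe]
    by_cases hd : dist w ζ < δ
    · have := (hgδ hd).le
      rw [Real.dist_eq] at this
      have : 0 ≤ K * ‖w - ζ‖^2 := by positivity
      linarith
    · have h3 : δ ≤ ‖w - ζ‖ := by rw [← dist_eq_norm]; linarith
      have h4 : δ ^ 2 ≤ ‖w - ζ‖ ^ 2 := by gcongr
      have h5 : |M| ≤ K * ‖w - ζ‖ ^ 2 := by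
        calc |M| = K * δ ^ 2 := by simp only [K]; field_simp
          _ ≤ _ := by gcongr
      linarith [hM w hw, le_abs_self M]
  have hAζ : A ζ = ε / 2 := by
    have e1 : ((starRingEnd ℂ (ζ - c)) * (ζ - c)).re = R ^ 2 := by
      rw [← hζ, ← Complex.normSq_eq_norm_sq, normSq_apply]; simp; ring
    simp only [A]
    rw [mul_assoc, re_ofReal_mul, e1]; ring
  obtain ⟨δ', hδ', hA'⟩ := Metric.continuousAt_iff.1 (cA.continuousAt (x := ζ)) (ε/2) (half_pos hε)
  refine ⟨min δ δ', lt_min hδ hδ', fun {z} hz => ?_⟩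
  by_cases hzb : z ∈ ball c R
  · rw [pmod, if_pos hzb, Real.dist_eq]
    have hconst : PI c R (fun _ => g ζ) z = g ζ := PI_harm hzb (fun w _ => harmonicAt_const _)
    have hAz : A z < ε := by
      have := hA' (hz.trans_le (min_le_right _ _))
      rw [hAζ, Real.dist_eq, abs_lt] at this
      linarith
    have u1 := PI_mono hzb hg.continuousOn (g := fun w => g ζ + A w) (by fun_prop)
      (fun w hw => by linarith [(abs_le.1 (key w hw)).2])
    have u2 := PI_mono hzb (f := fun w => g ζ + -A w) (by fun_prop) hg.continuousOn
      (fun w hw => by linarith [(abs_le.1 (key w hw)).1])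
    rw [PI_add hzb continuousOn_const cA.continuousOn, PI_harm hzb (hA _), hconst] at u1
    rw [PI_add (g := fun w => -A w) hzb continuousOn_const cA.neg.continuousOn, PI_neg, PI_harm hzb (hA _), hconst] at u2
    rw [abs_lt]; constructor <;> linarith
  · rw [pmod, if_neg hzb]
    have := hgδ (hz.trans_le (min_le_left _ _))
    linarith

lemma pmod_harm {c : ℂ} {R : ℝ} {g : ℂ → ℝ} (hg : Continuous g) :
    HarmonicOnNhd (pmod c R g) (ball c R) := by
  intro z hz
  refine (harmonicAt_congr_nhds ?_).1 (PI_harmonic hg.continuousOn z hz)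
  filter_upwards [isOpen_ball.mem_nhds hz] with w hw
  simp [pmod, hw]

lemma pmod_ge {c : ℂ} {R : ℝ} (hR : 0 < R) {g : ℂ → ℝ} (hg : Continuous g)
    (hs : SubM g (ball c R)) (z : ℂ) : g z ≤ pmod c R g z := by
  by_cases hz : z ∈ ball c R
  swap
  · simp [pmod, hz]
  have := maxP_bdd isOpen_ball isBounded_ball (v := fun z => g z + -pmod c R g z)
    (hg.add (pmod_cont hR hg).neg)
    (hs.add (HarmonicOnNhd.subM isOpen_ball (pmod_harm hg).neg) hg (pmod_cont hR hg).neg)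
    (fun w hw => by
      have : w ∉ ball c R := by rw [frontier, isOpen_ball.interior_eq] at hw; exact hw.2
      simp [pmod, this]) z hz
  simpa using this

lemma PI_center {c : ℂ} {R : ℝ} (hR : 0 < R) {g : ℂ → ℝ} : PI c R g c = circleAverage g c R := by
  rw [PI]
  apply Real.circleAverage_congr_sphere
  intro w hw
  have : ‖w - c‖ = |R| := mem_sphere_iff_norm.1 hw
  simp [poissonKernel_def, this, hR.ne']

lemma harnack_PI {c z : ℂ} {R : ℝ} (hz : z ∈ ball c R) {g : ℂ → ℝ} (hg : ContinuousOn g (sphere c |R|))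
    (h0 : ∀ w ∈ sphere c |R|, 0 ≤ g w) :
    PI c R g z ≤ (R + ‖z - c‖) / (R - ‖z - c‖) * PI c R g c ∧
    (R - ‖z - c‖) / (R + ‖z - c‖) * PI c R g c ≤ PI c R g z := by
  have hR : 0 < R := pos_of_mem_ball hz
  rw [PI_center hR]
  constructor
  · have := circleAverage_smul (a := (R + ‖z - c‖) / (R - ‖z - c‖)) (f := g) (c := c) (R := R)
    rw [smul_eq_mul] at this
    rw [← this]
    refine circleAverage_mono (pk_ci hz hg) (ContinuousOn.circleIntegrable' (hg.const_smul _)) ?_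
    intro w hw
    simp only [Pi.smul_apply', smul_eq_mul, Pi.smul_apply]
    refine mul_le_mul_of_nonneg_right ?_ (h0 w hw)
    rw [poissonKernel_eq_re_herglotzRieszKernel]
    rw [abs_of_pos hR] at hw
    exact re_herglotzRieszKernel_le hw hz
  · have := circleAverage_smul (a := (R - ‖z - c‖) / (R + ‖z - c‖)) (f := g) (c := c) (R := R)
    rw [smul_eq_mul] at this
    rw [← this]
    refine circleAverage_mono (ContinuousOn.circleIntegrable' (hg.const_smul _)) (pk_ci hz hg) ?_
    intro w hw
    simp only [Pi.smul_apply', smul_eq_mul, Pi.smul_apply]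
    refine mul_le_mul_of_nonneg_right ?_ (h0 w hw)
    rw [poissonKernel_eq_re_herglotzRieszKernel]
    rw [abs_of_pos hR] at hw
    exact le_re_herglotzRieszKernel hw hz

lemma harnack {c z : ℂ} {R : ℝ} (hz : z ∈ ball c R) {u : ℂ → ℝ} (hu : HarmonicOnNhd u (closedBall c R))
    (h0 : ∀ w ∈ closedBall c R, 0 ≤ u w) :
    u z ≤ (R + ‖z - c‖) / (R - ‖z - c‖) * u c ∧
    (R - ‖z - c‖) / (R + ‖z - c‖) * u c ≤ u z := by
  have hR : 0 < R := pos_of_mem_ball hz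
  have := harnack_PI hz (g := u) (fun w hw => (hu w (by
    rw [abs_of_pos hR] at hw; exact sphere_subset_closedBall hw)).1.continuousAt.continuousWithinAt)
    (fun w hw => h0 w (by rw [abs_of_pos hR] at hw; exact sphere_subset_closedBall hw))
  rwa [PI_harm hz hu, PI_harm (mem_ball_self hR) hu] at this

theorem harm_of_unif {c : ℂ} {ρ : ℝ} {U : ℂ → ℝ}
    (h : ∀ ε > 0, ∃ P : ℂ → ℝ, HarmonicOnNhd P (closedBall c ρ) ∧ ∀ z ∈ closedBall c ρ, |P z - U z| ≤ ε) :
    HarmonicOnNhd U (ball c ρ) := by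
  rcases le_or_gt ρ 0 with h0 | hρ
  · rw [ball_eq_empty.2 h0]; intro z hz; simp at hz
  have cU : ContinuousOn U (closedBall c ρ) := by
    refine continuousOn_of_uniform_approx_of_continuousOn (fun u hu => ?_)
    obtain ⟨ε, hε, hεu⟩ := Metric.mem_uniformity_dist.1 hu
    obtain ⟨P, hP, hPU⟩ := h (ε/2) (half_pos hε)
    refine ⟨P, fun z hz => (hP z hz).1.continuousAt.continuousWithinAt, fun z hz => hεu ?_⟩
    rw [Real.dist_eq, abs_sub_comm]
    linarith [hPU z hz]
  have hsub : sphere c |ρ| ⊆ closedBall c ρ := by rw [abs_of_pos hρ]; exact sphere_subset_closedBall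
  have key : ∀ z ∈ ball c ρ, PI c ρ U z = U z := by
    intro z hz
    by_contra hne
    have hpos : 0 < |PI c ρ U z - U z| := abs_pos.2 (sub_ne_zero.2 hne)
    obtain ⟨P, hP, hPU⟩ := h (|PI c ρ U z - U z| / 3) (by positivity)
    set ε := |PI c ρ U z - U z| / 3 with hε
    have cP : ContinuousOn P (sphere c |ρ|) :=
      fun z hz => (hP z (hsub hz)).1.continuousAt.continuousWithinAt
    have hconst : ∀ k : ℝ, PI c ρ (fun _ => k) z = k := fun k => PI_harm hz (fun w _ => harmonicAt_const _)
    have u1 := PI_mono hz (cU.mono hsub) (g := fun w => P w + ε) (by fun_prop)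
      (fun w hw => by linarith [(abs_le.1 (hPU w (hsub hw))).1])
    have u2 := PI_mono hz (f := fun w => P w + -ε) (by fun_prop) (cU.mono hsub)
      (fun w hw => by linarith [(abs_le.1 (hPU w (hsub hw))).2])
    rw [PI_add hz cP continuousOn_const, PI_harm hz hP, hconst] at u1 u2
    have h3 := abs_le.1 (hPU z (ball_subset_closedBall hz))
    have h4 : |PI c ρ U z - U z| ≤ 2 * ε := by rw [abs_le]; constructor <;> linarith
    rw [hε] at h4; linarith
  intro z hz
  refine (harmonicAt_congr_nhds ?_).1 (PI_harmonic (cU.mono hsub) z hz)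
  filter_upwards [isOpen_ball.mem_nhds hz] with w hw
  exact key w hw

structure PF (A : Set ℂ) (g : ℂ → ℝ) (M : ℝ) (v : ℂ → ℝ) : Prop where
  c : Continuous v
  s : SubM v A
  b : ∀ z, z ∉ A → v z ≤ g z
  m : ∀ z, |v z| ≤ M

lemma PF.max {A : Set ℂ} {g : ℂ → ℝ} {M : ℝ} {u v : ℂ → ℝ} (hu : PF A g M u) (hv : PF A g M v) :
    PF A g M (fun z => max (u z) (v z)) :=
  ⟨hu.c.max hv.c, hu.s.max hv.s hu.c hv.c, fun z hz => max_le (hu.b z hz) (hv.b z hz),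
    fun z => abs_max_le_max_abs_abs.trans (max_le (hu.m z) (hv.m z))⟩

lemma PF.pmod {A : Set ℂ} {g : ℂ → ℝ} {M : ℝ} {v : ℂ → ℝ} (hv : PF A g M v) {c : ℂ} {r : ℝ}
    (hr : 0 < r) (hA : closedBall c r ⊆ A) : PF A g M (pmod c r v) := by
  have hs := hv.s.mono (ball_subset_closedBall.trans hA)
  have hge := pmod_ge hr hv.c hs
  have hc := pmod_cont (c := c) hr hv.c
  have hout : ∀ z, z ∉ ball c r → _root_.pmod c r v z = v z := fun z hz => by simp [_root_.pmod, hz]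
  refine ⟨hc, fun z hz => ?_, fun z hz => ?_, fun z => abs_le.2 ⟨?_, ?_⟩⟩
  · by_cases hzb : z ∈ ball c r
    · exact HarmonicOnNhd.subM isOpen_ball (pmod_harm hv.c) z hzb
    · obtain ⟨r0, hr0, h⟩ := hv.s z hz
      refine ⟨r0, hr0, fun ρ h1 h2 => ?_⟩
      rw [hout z hzb]
      exact (h ρ h1 h2).trans (circleAverage_mono (Cont.ci hv.c _ _) (Cont.ci hc _ _)
        fun x _ => hge x)
  · rw [hout z (fun h => hz (hA (ball_subset_closedBall h)))]; exact hv.b z hz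
  · exact (abs_le.1 (hv.m z)).1.trans (hge z)
  · by_cases hzb : z ∈ ball c r
    · rw [_root_.pmod, if_pos hzb]
      have := PI_mono hzb hv.c.continuousOn (g := fun _ => M) continuousOn_const
        (fun w _ => (abs_le.1 (hv.m w)).2)
      rwa [PI_harm hzb (fun w _ => harmonicAt_const _)] at this
    · rw [hout z hzb]; exact (abs_le.1 (hv.m z)).2

open Classical in
def perron (A : Set ℂ) (g : ℂ → ℝ) (M : ℝ) (z : ℂ) : ℝ :=
  if z ∈ A then sSup {x | ∃ v, PF A g M v ∧ v z = x} else g z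

lemma perron_ge {A : Set ℂ} {g : ℂ → ℝ} {M : ℝ} {v : ℂ → ℝ} (hv : PF A g M v) (z : ℂ) :
    v z ≤ perron A g M z := by
  by_cases hz : z ∈ A
  · rw [perron, if_pos hz]
    exact le_csSup ⟨M, by rintro x ⟨w, hw, rfl⟩; exact (abs_le.1 (hw.m z)).2⟩ ⟨v, hv, rfl⟩
  · rw [perron, if_neg hz]; exact hv.b z hz

lemma PF.const {A : Set ℂ} {g : ℂ → ℝ} {M : ℝ} (hM : 0 ≤ M) (hg : ∀ z, |g z| ≤ M) :
    PF A g M (fun _ => -M) :=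
  ⟨continuous_const, SubM.const _ _, fun z _ => (abs_le.1 (hg z)).1, fun z => by
    rw [abs_neg, abs_of_nonneg hM]⟩

lemma perron_le {A : Set ℂ} {g : ℂ → ℝ} {M : ℝ} (hM : 0 ≤ M) (hg : ∀ z, |g z| ≤ M) {z : ℂ}
    (hz : z ∈ A) {k : ℝ}
    (h : ∀ v, PF A g M v → v z ≤ k) : perron A g M z ≤ k := by
  rw [perron, if_pos hz]
  exact csSup_le ⟨_, _, PF.const hM hg, rfl⟩ (by rintro x ⟨w, hw, rfl⟩; exact h w hw)

theorem perron_harm {A : Set ℂ} (hA : IsOpen A) {g : ℂ → ℝ} {M : ℝ} (hM : 0 ≤ M)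
    (hg : ∀ z, |g z| ≤ M) :
    HarmonicOnNhd (perron A g M) A := by
  intro c hc
  obtain ⟨e, he, hb⟩ := Metric.isOpen_iff.1 hA c hc
  set r := e / 2
  have hr : 0 < r := half_pos he
  have hrA : closedBall c r ⊆ A := (closedBall_subset_ball (half_lt_self he)).trans hb
  refine harm_of_unif (c := c) (ρ := r / 2) (fun ε hε => ?_) c (mem_ball_self (half_pos hr))
  obtain ⟨v, hv, hvc⟩ : ∃ v, PF A g M v ∧ perron A g M c - ε / 3 < v c := by
    by_contra! hcon
    have := perron_le hM hg hc hcon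
    linarith
  refine ⟨pmod c r v, (pmod_harm hv.c).mono (closedBall_subset_ball (half_lt_self hr)),
    fun z hz => ?_⟩
  have hzb : z ∈ ball c r := closedBall_subset_ball (half_lt_self hr) hz
  have h1 := perron_ge (hv.pmod hr hrA) z
  rw [abs_sub_comm, abs_of_nonneg (by linarith)]
  suffices perron A g M z ≤ pmod c r v z + ε by linarith
  refine perron_le hM hg (hrA (ball_subset_closedBall hzb)) (fun w hw => ?_)
  have hm := hw.max hv
  have hmge := pmod_ge hr hm.c (hm.s.mono (ball_subset_closedBall.trans hrA)) z
  have hsplit : ∀ x ∈ ball c r, pmod c r (fun z => max (w z) (v z)) x - pmod c r v x =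
      PI c r (fun z => max (w z) (v z) + -v z) x := by
    intro x hx
    rw [PI_add (g := fun z => -v z) hx hm.c.continuousOn hv.c.neg.continuousOn, PI_neg]
    simp [pmod, hx, sub_eq_add_neg]
  have hH := (harnack_PI hzb (g := fun z => max (w z) (v z) + -v z)
    (hm.c.add hv.c.neg).continuousOn (fun x _ => by linarith [le_max_right (w x) (v x)])).1
  rw [← hsplit z hzb, ← hsplit c (mem_ball_self hr)] at hH
  have h2 := perron_ge (hm.pmod hr hrA) c
  have h3 := pmod_ge hr hv.c (hv.s.mono (ball_subset_closedBall.trans hrA)) c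
  have h4 : (r + ‖z - c‖) / (r - ‖z - c‖) ≤ 3 := by
    have : ‖z - c‖ ≤ r / 2 := mem_closedBall_iff_norm.1 hz
    rw [div_le_iff₀ (by linarith)]; linarith
  have h5 := pmod_ge (c := c) hr hv.c (hv.s.mono (ball_subset_closedBall.trans hrA)) c
  have h6 : 0 ≤ pmod c r (fun z => max (w z) (v z)) c - pmod c r v c := by
    rw [hsplit c (mem_ball_self hr)]
    have := PI_mono (c := c) (z := c) (mem_ball_self hr) (f := fun _ => (0:ℝ)) continuousOn_const
      (g := fun z => max (w z) (v z) + -v z) (hm.c.add hv.c.neg).continuousOn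
      (fun x _ => by linarith [le_max_right (w x) (v x)])
    rwa [PI_harm (mem_ball_self hr) (fun w _ => harmonicAt_const _)] at this
  have h7 := mul_le_mul_of_nonneg_right h4 h6
  have h8 := le_max_left (w z) (v z)
  linarith

lemma sum_logs (N : ℕ) (hN : 0 < N) :
    ∑ k ∈ Finset.range N, Real.log (2 * N / k) ≤ N * (Real.log 2 + 1) := by
  have h0 : ∀ n ≤ N, ∑ k ∈ Finset.range (n+1), Real.log (2 * N / k) =
      n * Real.log (2 * N) - Real.log (n.factorial) := by
    intro n
    induction n with
    | zero => intro _; simp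
    | succ n ih =>
      intro hn
      rw [Finset.sum_range_succ, ih (by omega), Nat.factorial_succ, log_div (by positivity)
        (by positivity)]
      push_cast
      rw [log_mul (x := (n:ℝ) + 1) (by positivity) (by positivity)]
      ring
  have hN' : (0:ℝ) < N := by exact_mod_cast hN
  have h1 : ∑ k ∈ Finset.range N, Real.log (2 * N / k) ≤ ∑ k ∈ Finset.range (N+1), Real.log (2 * N / k) := by
    rw [Finset.sum_range_succ]
    have : 0 ≤ Real.log (2 * N / N) := Real.log_nonneg (by rw [le_div_iff₀ hN']; linarith)
    linarith
  refine h1.trans ?_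
  rw [h0 N le_rfl, log_mul (by norm_num) hN'.ne']
  have := Real.pow_div_factorial_le_exp (N:ℝ) hN'.le N
  have h2 := log_le_log (by positivity) this
  rw [Real.log_exp, log_div (by positivity) (by positivity), Real.log_pow] at h2
  linarith

lemma sum_refl (f : ℕ → ℝ) (N m : ℕ) (hm : m < N) (h0 : ∀ k < N, 0 ≤ f k) (f0 : f 0 = 0) :
    ∑ j ∈ Finset.range N, f ((j:ℤ) - m).natAbs ≤ 2 * ∑ k ∈ Finset.range N, f k := by
  obtain ⟨l, rfl⟩ : ∃ l, N = (m + 1) + l := ⟨N - (m+1), by omega⟩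
  rw [Finset.sum_range_add]
  have e1 : ∑ j ∈ Finset.range (m+1), f ((j:ℤ) - m).natAbs = ∑ k ∈ Finset.range (m+1), f k := by
    rw [← Finset.sum_range_reflect f]
    apply Finset.sum_congr rfl
    intro j hj
    congr 1
    have := Finset.mem_range.1 hj
    omega
  have e2 : ∑ x ∈ Finset.range l, f (((m + 1 + x : ℕ):ℤ) - m).natAbs = ∑ k ∈ Finset.range l, f (k + 1) := by
    apply Finset.sum_congr rfl
    intro j hj
    congr 1
    omega
  have e3 : ∑ k ∈ Finset.range l, f (k + 1) = ∑ k ∈ Finset.range (l+1), f k := by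
    rw [Finset.sum_range_succ' , f0, add_zero]
  rw [e1, e2, e3, two_mul]
  apply add_le_add <;>
  · apply Finset.sum_le_sum_of_subset_of_nonneg
    · intro x; simp; omega
    · intro i hi _; exact h0 i (Finset.mem_range.1 hi)

lemma pot_bound (N : ℕ) (hN : 0 < N) (η : ℝ) (hη : 0 < η) (hNη : -Real.log η ≤ N) (x : ℝ) (d : ℕ → ℝ)
    (h1 : ∀ j < N, |x - j / N| ≤ d j) (h2 : ∀ j < N, η ≤ d j) :
    ∑ j ∈ Finset.range N, - Real.log (d j) ≤ 5 * N := by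
  have hN' : (0:ℝ) < N := by exact_mod_cast hN
  obtain ⟨m, hm, hmin⟩ := Finset.exists_min_image (Finset.range N) (fun j => |x - (j:ℝ) / N|)
    ⟨0, Finset.mem_range.2 hN⟩
  have hm' := Finset.mem_range.1 hm
  set f : ℕ → ℝ := fun k => Real.log (2 * N / k)
  have hf0 : ∀ k < N, 0 ≤ f k := by
    intro k hk
    rcases Nat.eq_zero_or_pos k with rfl | hk0
    · simp [f]
    · have : (0:ℝ) < k := by exact_mod_cast hk0
      have h3 : (k:ℝ) ≤ N := by exact_mod_cast hk.le
      exact Real.log_nonneg (by rw [le_div_iff₀ this]; linarith)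
  have key : ∀ j ∈ Finset.range N, - Real.log (d j) ≤ f ((j:ℤ) - m).natAbs + if j = m then (N:ℝ) else 0 := by
    intro j hj
    have hj' := Finset.mem_range.1 hj
    by_cases hjm : j = m
    · subst hjm
      simp only [sub_self, Int.natAbs_zero, if_true]
      have := log_le_log hη (h2 j hj')
      simp [f]; linarith
    · rw [if_neg hjm, add_zero]
      have hk : ((((j:ℤ) - m).natAbs : ℕ) : ℝ) = |(j:ℝ) - m| := by
        rw [Nat.cast_natAbs]; push_cast; rfl
      have hpos : 0 < |(j:ℝ) - m| := abs_pos.2 (sub_ne_zero.2 (by exact_mod_cast hjm))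
      have h3 : |(j:ℝ) - m| / (2 * N) ≤ d j := by
        refine le_trans ?_ (h1 j hj')
        have := hmin j hj
        have h4 : |(j:ℝ) - m| / N ≤ |x - j / N| + |x - m / N| := by
          rw [← abs_of_pos hN', ← abs_div, abs_of_pos hN']
          have : ((j:ℝ) - m) / N = (x - m / N) - (x - j/N) := by ring
          rw [this, add_comm]; exact abs_sub _ _
        have h5 : |(j:ℝ) - m| / (2 * N) = (|(j:ℝ) - m| / N) / 2 := by ring
        rw [h5]; linarith
      have h6 := log_le_log (by positivity) h3
      simp only [f]
      rw [hk, log_div (by positivity) hpos.ne']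
      rw [log_div hpos.ne' (by positivity)] at h6
      linarith
  refine (Finset.sum_le_sum key).trans ?_
  rw [Finset.sum_add_distrib, Finset.sum_ite_eq' , if_pos hm]
  have h7 := sum_refl f N m hm' hf0 (by simp [f])
  have h8 := sum_logs N hN
  have h9 := Real.log_two_lt_d9
  have h10 : (N:ℝ) * (Real.log 2 + 1) ≤ N * 2 := by gcongr; linarith
  simp only [f] at h7 ⊢
  linarith

lemma SubM.congr {u v : ℂ → ℝ} {Ω : Set ℂ} (ho : IsOpen Ω) (hu : SubM u Ω)
    (h : ∀ z ∈ Ω, u z = v z) : SubM v Ω := by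
  intro z hz
  obtain ⟨a, ha, h1⟩ := hu z hz
  obtain ⟨e, he, hb⟩ := Metric.isOpen_iff.1 ho z hz
  refine ⟨min a e, lt_min ha he, fun r hr hr' => ?_⟩
  rw [← h z hz, ← Real.circleAverage_congr_sphere (f₁ := u)]
  · exact h1 r hr (hr'.trans_le (min_le_left _ _))
  · intro x hx
    apply h x (hb _)
    rw [abs_of_pos hr] at hx
    exact (mem_sphere.1 hx).trans_lt (hr'.trans_le (min_le_right _ _))

lemma SubM.sum {ι : Type*} (s : Finset ι) {u : ι → ℂ → ℝ} {Ω : Set ℂ} (hu : ∀ i ∈ s, SubM (u i) Ω)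
    (hc : ∀ i ∈ s, Continuous (u i)) : SubM (fun z => ∑ i ∈ s, u i z) Ω := by
  classical
  induction s using Finset.induction_on with
  | empty => simpa using SubM.const 0 Ω
  | insert a s ha ih =>
    simp only [Finset.sum_insert ha]
    exact SubM.add (hu a (Finset.mem_insert_self _ _))
      (ih (fun i hi => hu i (Finset.mem_insert_of_mem hi)) (fun i hi => hc i (Finset.mem_insert_of_mem hi)))
      (hc a (Finset.mem_insert_self _ _))
      (continuous_finsetSum _ (fun i hi => hc i (Finset.mem_insert_of_mem hi)))

def Reach (A : Set ℂ) (ζ : ℂ) (δ : ℝ) : Prop :=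
  ∃ η > 0, ∀ s, δ ≤ s → s ≤ 2 * δ → ∃ w, ‖w - ζ‖ = s ∧ ∀ z ∈ A, η ≤ ‖z - w‖

theorem barrier {R ε : ℝ} (hR : 0 < R) (hε : 0 < ε) : ∃ δ > 0, ∀ (A : Set ℂ) (ζ : ℂ), IsOpen A →
    Reach A ζ δ → ∃ b : ℂ → ℝ, Continuous b ∧ SubM (fun z => - b z) A ∧ (∀ z, 0 ≤ b z) ∧
      (∀ z, R ≤ ‖z - ζ‖ → 1 ≤ b z) ∧ ∀ z ∈ A, ‖z - ζ‖ ≤ δ → b z ≤ ε := by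
  set c0 : ℝ := max 5 ((5 + Real.log 4) / ε) with hc0
  have hc5 : 5 ≤ c0 := le_max_left _ _
  have hcpos : 0 < c0 := by linarith
  set K : ℝ := 2 + Real.exp (c0 - 5) with hK
  have hKpos : 0 < K := by positivity
  refine ⟨R / K, by positivity, fun A ζ hA hreach => ?_⟩
  set δ := R / K with hδ
  have hδpos : 0 < δ := by positivity
  have hRδ : R = K * δ := by rw [hδ]; field_simp
  obtain ⟨η, hη, hw⟩ := hreach
  obtain ⟨N, hN⟩ := exists_nat_gt (max 0 (-Real.log (min (η / δ) 1)))
  set η' := min (η / δ) 1 with hη'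
  have hη'pos : 0 < η' := lt_min (by positivity) one_pos
  have hN0 : (0:ℝ) < N := (le_max_left _ _).trans_lt hN
  have hNlog : -Real.log η' ≤ N := ((le_max_right _ _).trans_lt hN).le
  have hNn : 0 < N := by exact_mod_cast hN0
  have hwj : ∀ j : ℕ, ∃ w, j < N → ‖w - ζ‖ = δ * (1 + j / N) ∧ ∀ z ∈ A, η ≤ ‖z - w‖ := by
    intro j
    by_cases hj : j < N
    · have : (j:ℝ) / N ≤ 1 := by rw [div_le_one hN0]; exact_mod_cast hj.le
      have h0 : 0 ≤ (j:ℝ) / N := by positivity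
      obtain ⟨w, h⟩ := hw (δ * (1 + j / N)) (by nlinarith) (by nlinarith)
      exact ⟨w, fun _ => h⟩
    · exact ⟨0, fun h => absurd h hj⟩
  choose w hw using hwj
  set D : ℕ → ℂ → ℝ := fun j z => max (‖z - w j‖ / δ) η' with hD
  have hDc : ∀ j, Continuous (D j) := fun j => by fun_prop
  have hDpos : ∀ j z, 0 < D j z := fun j z => hη'pos.trans_le (le_max_right _ _)
  have hLc : ∀ j, Continuous (fun z => -Real.log (D j z)) := fun j =>
    ((hDc j).log (fun z => (hDpos j z).ne')).neg
  set p : ℂ → ℝ := fun z => (N:ℝ)⁻¹ * ∑ j ∈ Finset.range N, -Real.log (D j z) with hp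
  have hpc : Continuous p := continuous_const.mul (continuous_finsetSum _ (fun j _ => hLc j))
  have hLs : ∀ j ∈ Finset.range N, SubM (fun z => -Real.log (D j z)) A := by
    intro j hj
    have hj := Finset.mem_range.1 hj
    have hne : ∀ z ∈ A, z - w j ≠ 0 := fun z hz h => by
      have := (hw j hj).2 z hz; rw [h, norm_zero] at this; linarith
    have h1 : HarmonicOnNhd (fun z => Real.log ‖z - w j‖) A := fun z hz =>
      AnalyticAt.harmonicAt_log_norm (f := fun z => z - w j) (by fun_prop) (hne z hz)
    refine SubM.congr hA (SubM.add (HarmonicOnNhd.subM (u := fun z => -Real.log (max ‖z - w j‖ (δ * η'))) hA ?_)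
      (SubM.const (Real.log δ) A) ?_ continuous_const) ?_
    · intro z hz
      refine (harmonicAt_congr_nhds ?_).1 (h1.neg z hz)
      filter_upwards [hA.mem_nhds hz] with y hy
      have : δ * η' ≤ ‖y - w j‖ := by
        refine le_trans ?_ ((hw j hj).2 y hy)
        calc δ * η' ≤ δ * (η / δ) := by gcongr; exact min_le_left _ _
          _ = η := by field_simp
      simp only [max_eq_left this, Pi.neg_apply]
    · refine Continuous.neg (Continuous.log (by fun_prop) fun z => ?_)
      exact ((mul_pos hδpos hη'pos).trans_le (le_max_right _ _)).ne'
    · intro z hz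
      have e : max ‖z - w j‖ (δ * η') = D j z * δ := by
        simp only [hD]
        rw [max_mul_of_nonneg _ _ hδpos.le, div_mul_cancel₀ _ hδpos.ne', mul_comm δ]
      rw [e, log_mul (hDpos j z).ne' hδpos.ne']; ring
  have hps : SubM p A := (SubM.sum _ hLs (fun j _ => hLc j)).const_mul (by positivity)
  have hp5 : ∀ z ∈ A, p z ≤ 5 := by
    intro z hz
    have := pot_bound N hNn η' hη'pos hNlog (‖z - ζ‖ / δ - 1) (fun j => D j z) (fun j hj => ?_)
      (fun j _ => le_max_right _ _)
    · simp only [hp]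
      rw [inv_mul_le_iff₀ hN0]; linarith
    · refine le_trans ?_ (le_max_left _ _)
      have h1 := abs_norm_sub_norm_le (z - ζ) (w j - ζ)
      rw [(hw j hj).1] at h1
      have e : ‖z - ζ‖ / δ - 1 - j / N = (‖z - ζ‖ - δ * (1 + j / N)) / δ := by field_simp; ring
      rw [e, abs_div, abs_of_pos hδpos]
      gcongr
      simpa using h1
  have hplow : ∀ z, ‖z - ζ‖ ≤ δ → -Real.log 4 ≤ p z := by
    intro z hz
    simp only [hp]
    rw [le_inv_mul_iff₀ hN0]
    have : ∑ j ∈ Finset.range N, -Real.log 4 ≤ ∑ j ∈ Finset.range N, -Real.log (D j z) := by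
      refine Finset.sum_le_sum fun j hj => neg_le_neg ?_
      have hj := Finset.mem_range.1 hj
      refine log_le_log (hDpos j z) (max_le ?_ ((min_le_right _ _).trans (by norm_num)))
      rw [div_le_iff₀ hδpos]
      have h1 : ‖z - w j‖ ≤ ‖z - ζ‖ + ‖w j - ζ‖ := by
        have := norm_sub_le (z - ζ) (w j - ζ); simpa using this
      rw [(hw j hj).1] at h1
      have : (j:ℝ) / N ≤ 1 := by rw [div_le_one hN0]; exact_mod_cast hj.le
      nlinarith
    simpa using this
  have hpfar : ∀ z, R ≤ ‖z - ζ‖ → p z ≤ -(c0 - 5) := by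
    intro z hz
    simp only [hp]
    rw [inv_mul_le_iff₀ hN0]
    have : ∑ j ∈ Finset.range N, -Real.log (D j z) ≤ ∑ j ∈ Finset.range N, -(c0 - 5) := by
      refine Finset.sum_le_sum fun j hj => neg_le_neg ?_
      have hj := Finset.mem_range.1 hj
      rw [Real.le_log_iff_exp_le (hDpos j z)]
      refine le_trans ?_ (le_max_left _ _)
      rw [le_div_iff₀ hδpos]
      have h1 : ‖z - ζ‖ - ‖w j - ζ‖ ≤ ‖z - w j‖ := by
        have := norm_sub_norm_le (z - ζ) (w j - ζ); simpa using this
      rw [(hw j hj).1] at h1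
      have : (j:ℝ) / N ≤ 1 := by rw [div_le_one hN0]; exact_mod_cast hj.le
      rw [hRδ, hK] at hz
      nlinarith
    rw [Finset.sum_const, Finset.card_range, nsmul_eq_mul] at this
    exact this
  refine ⟨fun z => max ((5 - p z) / c0) 0, by fun_prop, ?_, fun z => le_max_right _ _, ?_, ?_⟩
  · refine SubM.congr hA ((hps.add (SubM.const (-5) A) hpc continuous_const).const_mul
      (k := c0⁻¹) (by positivity)) fun z hz => ?_
    have h5 := hp5 z hz
    have : 0 ≤ (5 - p z) / c0 := div_nonneg (by linarith) hcpos.le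
    simp only [max_eq_left this]
    field_simp; ring
  · intro z hz
    refine le_trans ?_ (le_max_left _ _)
    rw [le_div_iff₀ hcpos]; linarith [hpfar z hz]
  · intro z hz hzδ
    refine max_le ?_ hε.le
    rw [div_le_iff₀ hcpos]
    have h1 := hplow z hzδ
    have h2 : (5 + Real.log 4) / ε ≤ c0 := le_max_right _ _
    rw [div_le_iff₀ hε] at h2
    linarith

lemma pc_frontier {X : Type*} [TopologicalSpace X] {S A : Set X} (hc : IsPreconnected S) {z w : X}
    (hzS : z ∈ S) (hwS : w ∈ S) (hz : z ∈ A)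
    (hw : w ∉ A) : ∃ ζ ∈ S, ζ ∈ frontier A := by
  by_contra! hcon
  have hz' : z ∈ interior A := by
    by_contra h; exact hcon z hzS ⟨subset_closure hz, h⟩
  have hw' : w ∈ (closure A)ᶜ := fun h => hcon w hwS ⟨h, fun h => hw (interior_subset h)⟩
  obtain ⟨x, -, h1, h2⟩ := hc _ _ isOpen_interior isClosed_closure.isOpen_compl (fun x hx => by
    by_contra h
    rw [Set.mem_union, not_or] at h
    exact hcon x hx ⟨not_not.1 h.2, h.1⟩) ⟨z, hzS, hz'⟩ ⟨w, hwS, hw'⟩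
  exact h2 (subset_closure (interior_subset h1))

lemma exists_frontier {A : Set ℂ} {z w : ℂ} (hz : z ∈ A) (hw : w ∉ A) :
    ∃ ζ ∈ frontier A, ‖z - ζ‖ ≤ ‖z - w‖ := by
  have hc : IsPreconnected (segment ℝ z w) := (convex_segment z w).isPreconnected
  obtain ⟨ζ, hζ, hf⟩ := pc_frontier hc (left_mem_segment ℝ z w) (right_mem_segment ℝ z w) hz hw
  refine ⟨ζ, hf, ?_⟩
  obtain ⟨a, b, ha, hb, hab, rfl⟩ := hζ
  have : z - (a • z + b • w) = b • (z - w) := by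
    have : a = 1 - b := by linarith
    subst this; simp only [Complex.real_smul]; push_cast; ring
  rw [this, norm_smul, Real.norm_of_nonneg hb]
  exact mul_le_of_le_one_left (norm_nonneg _) (by linarith)

structure Reg (A : Set ℂ) : Prop where
  o : IsOpen A
  st : ∃ R : ℝ, ∀ z ∈ A, |z.im| ≤ R
  re : ∀ ζ ∈ frontier A, ∀ δ > 0, Reach A ζ δ

lemma Reg.nf {A : Set ℂ} (h : Reg A) {ζ : ℂ} (hζ : ζ ∈ frontier A) : ζ ∉ A := by
  rw [h.o.frontier_eq] at hζ; exact hζ.2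

theorem maxPA {A : Set ℂ} (h : Reg A) {v : ℂ → ℝ} (cv : Continuous v) (hs : SubM v A) {C : ℝ}
    (hf : ∀ z ∈ frontier A, v z ≤ 0) (hC : ∀ z, v z ≤ C) : ∀ z ∈ A, v z ≤ 0 := by
  obtain ⟨R, hR⟩ := h.st
  refine maxP h.o hR cv hs hf (C := |C|) fun z _ => (hC z).trans ((le_abs_self C).trans ?_)
  nlinarith [abs_nonneg C, abs_nonneg z.re]

theorem estU {ε R M : ℝ} (hε : 0 < ε) (hR : 0 < R) (hM : 0 ≤ M) : ∃ δ > 0, ∀ (A : Set ℂ), Reg A →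
    ∀ g : ℂ → ℝ, (∀ z, |g z| ≤ M) → (∀ z z', ‖z - z'‖ ≤ R → |g z - g z'| ≤ ε) →
    ∀ z ∈ A, ∀ w, w ∉ A → ‖z - w‖ ≤ δ → |perron A g M z - g z| ≤ 3 * ε := by
  obtain ⟨δ, hδ, hb⟩ := barrier hR (ε := ε / (2 * M + 1)) (by positivity)
  refine ⟨min δ R, lt_min hδ hR, fun A hA g hgM hg z hz w hw hzw => ?_⟩
  obtain ⟨ζ, hζ, hd⟩ := exists_frontier hz hw
  have hzζ := hd.trans hzw
  obtain ⟨b, bc, bs, b0, b1, bA⟩ := hb A ζ hA.o (hA.re ζ hζ δ hδ)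
  have hbz := bA z hz (hzζ.trans (min_le_left _ _))
  have hgz := hg z ζ (hzζ.trans (min_le_right _ _))
  have hMb : 2 * M * b z ≤ ε := by
    calc 2 * M * b z ≤ (2 * M + 1) * (ε / (2 * M + 1)) :=
          mul_le_mul (by linarith) hbz (b0 z) (by linarith)
      _ = ε := by field_simp
  have hfar : ∀ y, |g y - g ζ| ≤ ε + 2 * M * b y := by
    intro y
    rcases le_total ‖y - ζ‖ R with h | h
    · have := hg y ζ h; nlinarith [b0 y]
    · have h1 := b1 y h
      have h2 := abs_le.1 (hgM y)
      have h3 := abs_le.1 (hgM ζ)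
      rw [abs_le]; constructor <;> nlinarith
  have hlow : PF A g M (fun y => max ((g ζ - ε) + 2 * M * (- b y)) (-M)) := by
    refine ⟨by fun_prop, ?_, ?_, ?_⟩
    · exact SubM.max ((SubM.const _ A).add (bs.const_mul (by linarith)) continuous_const
        (by fun_prop)) (SubM.const _ A) (by fun_prop) continuous_const
    · intro y _
      have := abs_le.1 (hfar y)
      exact max_le (by linarith) (abs_le.1 (hgM y)).1
    · intro y
      have h3 := abs_le.1 (hgM ζ)
      refine abs_le.2 ⟨le_max_right _ _, max_le ?_ (by linarith)⟩
      have : 0 ≤ 2 * M * b y := mul_nonneg (by linarith) (b0 y)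
      linarith
  have h1 := perron_ge hlow z
  have h1' := (le_max_left _ _).trans h1
  have h2 : perron A g M z ≤ g ζ + ε + 2 * M * b z := by
    refine perron_le hM hgM hz fun v hv => ?_
    have := maxPA hA (v := fun y => v y + (-(g ζ + ε) + 2 * M * (- b y))) (C := M - (g ζ + ε))
      (by have := hv.c; fun_prop)
      (hv.s.add ((SubM.const _ A).add (bs.const_mul (by linarith)) continuous_const
        (by fun_prop)) hv.c (by fun_prop))
      (fun y hy => by
        have := abs_le.1 (hfar y)
        have := hv.b y (hA.nf hy)
        linarith)
      (fun y => by
        have := abs_le.1 (hv.m y)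
        have : 0 ≤ 2 * M * b y := mul_nonneg (by linarith) (b0 y)
        linarith) z hz
    linarith
  have h5 := abs_le.1 hgz
  rw [abs_le]; constructor <;> linarith

lemma perron_abs {A : Set ℂ} {g : ℂ → ℝ} {M : ℝ} (hM : 0 ≤ M) (hg : ∀ z, |g z| ≤ M) (z : ℂ) :
    |perron A g M z| ≤ M := by
  by_cases hz : z ∈ A
  · exact abs_le.2 ⟨perron_ge (PF.const hM hg) z, perron_le hM hg hz fun v hv => (abs_le.1 (hv.m z)).2⟩
  · rw [perron, if_neg hz]; exact hg z

lemma perron_out {A : Set ℂ} {g : ℂ → ℝ} {M : ℝ} {z : ℂ} (hz : z ∉ A) : perron A g M z = g z := by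
  rw [perron, if_neg hz]

theorem perron_cont {A : Set ℂ} (hA : Reg A) {g : ℂ → ℝ} {M : ℝ} (hM : 0 ≤ M)
    (hg : ∀ z, |g z| ≤ M) (hu : UniformContinuous g) : Continuous (perron A g M) := by
  rw [continuous_iff_continuousAt]
  intro z
  by_cases hz : z ∈ A
  · exact (perron_harm hA.o hM hg z hz).1.continuousAt
  · rw [Metric.continuousAt_iff]
    intro ε hε
    obtain ⟨R, hR, hgR⟩ := Metric.uniformContinuous_iff.1 hu (ε / 8) (by positivity)
    obtain ⟨δ, hδ, hU⟩ := estU (ε := ε / 8) (R := R / 2) (M := M) (by positivity) (by positivity) hM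
    have hgR' : ∀ z z', ‖z - z'‖ ≤ R / 2 → |g z - g z'| ≤ ε / 8 := fun z z' h =>
      (hgR (a := z) (b := z') (by rw [dist_eq_norm]; linarith)).le
    refine ⟨min δ (R / 2), by positivity, fun {y} hy => ?_⟩
    rw [dist_eq_norm] at hy
    rw [perron_out hz, Real.dist_eq]
    have h1 := hgR' y z (hy.le.trans (min_le_right _ _))
    by_cases hyA : y ∈ A
    · have := hU A hA g hg hgR' y hyA z hz (hy.le.trans (min_le_left _ _))
      have h2 := abs_sub_le (perron A g M y) (g y) (g z)
      linarith
    · rw [perron_out hyA]; linarith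

lemma const_of_exp {X : Type*} [TopologicalSpace X] {S : Set X} (hS : IsPreconnected S) {f g : X → ℂ}
    (hf : ContinuousOn f S) (hg : ContinuousOn g S) (h : ∀ x ∈ S, Complex.exp (f x) = Complex.exp (g x))
    {x y : X} (hx : x ∈ S) (hy : y ∈ S) : f x - g x = f y - g y := by
  have key : ∀ z ∈ S, ∃ n : ℤ, f z - g z = n * (2 * pi * Complex.I) := fun z hz => by
    obtain ⟨n, hn⟩ := Complex.exp_eq_exp_iff_exists_int.1 (h z hz)
    exact ⟨n, by rw [hn]; ring⟩
  have hd : IsDiscrete (Set.range ((↑) : ℤ → ℝ)) := by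
    rw [isDiscrete_iff_discreteTopology]
    exact Int.isClosedEmbedding_coe_real.toIsEmbedding.toHomeomorph.symm.isEmbedding.discreteTopology
  have := hS.constant_of_mapsTo hd (f := fun z => ((f z - g z) / (2 * pi * Complex.I)).re)
    (continuous_re.comp_continuousOn ((hf.sub hg).div_const _)) (fun z hz => by
      obtain ⟨n, hn⟩ := key z hz
      refine ⟨n, ?_⟩
      simp only [hn]
      rw [mul_div_cancel_right₀ _ Complex.two_pi_I_ne_zero]; simp) hx hy
  obtain ⟨n, hn⟩ := key x hx
  obtain ⟨m, hm⟩ := key y hy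
  simp only [hn, hm, mul_div_cancel_right₀ _ Complex.two_pi_I_ne_zero] at this
  have : n = m := by exact_mod_cast this
  rw [hn, hm, this]

lemma exists_log {N : Set ℂ} (hN : IsPreconnected N) (ho : IsOpen N) {a b : ℂ} (ha : a ∈ N) (hb : b ∈ N) :
    ∃ L : ℂ → ℂ, ContinuousOn L Nᶜ ∧ ∀ z ∈ Nᶜ, Complex.exp (L z) = (z - a) / (z - b) := by
  refine hN.induction₂' (fun a b => ∃ L : ℂ → ℂ, ContinuousOn L Nᶜ ∧ ∀ z ∈ Nᶜ,
    Complex.exp (L z) = (z - a) / (z - b)) ?_ ?_ ha hb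
  · intro a ha
    obtain ⟨e, he, hball⟩ := Metric.isOpen_iff.1 ho a ha
    have key : ∀ b ∈ ball a (e / 2), ∃ L : ℂ → ℂ, ContinuousOn L Nᶜ ∧ ∀ z ∈ Nᶜ,
        Complex.exp (L z) = (z - a) / (z - b) := by
      intro b hb
      have hz : ∀ z ∈ Nᶜ, ‖b - a‖ < ‖z - b‖ := by
        intro z hz
        have h1 : e ≤ ‖z - a‖ := by
          by_contra! h; exact hz (hball (by rwa [mem_ball_iff_norm]))
        have h2 := mem_ball_iff_norm.1 hb
        have h3 : ‖z - a‖ ≤ ‖z - b‖ + ‖b - a‖ := by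
          have := norm_add_le (z - b) (b - a); simpa using this
        linarith
      have hne : ∀ z ∈ Nᶜ, z - b ≠ 0 := fun z h h0 => by
        have := hz z h; rw [h0, norm_zero] at this; linarith [norm_nonneg (b - a)]
      have e1 : ∀ z ∈ Nᶜ, (z - a) / (z - b) = 1 + (b - a) / (z - b) := fun z h => by
        field_simp [hne z h]; ring
      have hs : ∀ z ∈ Nᶜ, (z - a) / (z - b) ∈ slitPlane := fun z h => by
        rw [e1 z h]
        apply Complex.mem_slitPlane_of_norm_lt_one
        rw [norm_div, div_lt_one (norm_pos_iff.2 (hne z h))]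
        exact hz z h
      refine ⟨fun z => Complex.log ((z - a) / (z - b)), ?_, fun z h => ?_⟩
      · refine ContinuousOn.clog ?_ hs
        exact ContinuousOn.div (by fun_prop) (by fun_prop) hne
      · exact exp_log (slitPlane_ne_zero (hs z h))
    filter_upwards [nhdsWithin_le_nhds (Metric.ball_mem_nhds a (half_pos he)), self_mem_nhdsWithin] with b hb hbN
    obtain ⟨L, hL, hL'⟩ := key b hb
    exact ⟨⟨L, hL, hL'⟩, fun z => - L z, hL.neg, fun z hz => by rw [Complex.exp_neg, hL' z hz, inv_div]⟩
  · rintro a b c ha hb hc ⟨L, hL, hL'⟩ ⟨K, hK, hK'⟩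
    refine ⟨fun z => L z + K z, hL.add hK, fun z hz => ?_⟩
    have : z - b ≠ 0 := fun h => hz (by rw [sub_eq_zero.1 h]; exact hb)
    rw [exp_add, hL' z hz, hK' z hz, div_mul_div_cancel₀ this]

lemma log_neg_pos {ρ θ : ℝ} (hρ : 0 < ρ) (h1 : 0 < θ) (h2 : θ ≤ 2 * pi) :
    Complex.log (-(ρ * Complex.exp (θ * Complex.I))) = Real.log ρ + (θ - pi) * Complex.I := by
  have : -(ρ * Complex.exp (θ * Complex.I)) = Complex.exp (Real.log ρ + (θ - pi) * Complex.I) := by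
    rw [exp_add, sub_mul, exp_sub, exp_pi_mul_I, ← Complex.ofReal_exp,
      Real.exp_log hρ]; ring
  rw [this, log_exp] <;> simp <;> linarith

lemma log_neg_neg {ρ θ : ℝ} (hρ : 0 < ρ) (h1 : -(2 * pi) < θ) (h2 : θ ≤ 0) :
    Complex.log (-(ρ * Complex.exp (θ * Complex.I))) = Real.log ρ + (θ + pi) * Complex.I := by
  have : -(ρ * Complex.exp (θ * Complex.I)) = Complex.exp (Real.log ρ + (θ + pi) * Complex.I) := by
    rw [exp_add, add_mul, exp_add, exp_pi_mul_I, ← Complex.ofReal_exp,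
      Real.exp_log hρ]; ring
  rw [this, log_exp] <;> simp <;> linarith

lemma slit_sub {w : ℂ} (hw : -w ∈ slitPlane) {x ρ : ℝ} (hx : 0 ≤ x) (hρ : 0 < ρ) :
    (x : ℂ) - ρ * w ∈ slitPlane := by
  rw [Complex.mem_slitPlane_iff] at hw ⊢
  simp at hw ⊢
  rcases hw with h | h
  · left; nlinarith
  · right; exact ⟨hρ.ne', h⟩

lemma slit_neg {θ : ℝ} (h1 : -(2 * pi) < θ) (h2 : θ < 0) :
    -Complex.exp (θ * Complex.I) ∈ slitPlane := by
  rw [Complex.mem_slitPlane_iff_arg]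
  refine ⟨?_, neg_ne_zero.2 (exp_ne_zero _)⟩
  have := log_neg_neg (ρ := 1) one_pos h1 h2.le
  rw [← log_im]
  simp at this
  rw [this]; simp
  exact h2.ne

lemma re_pos_sub {w : ℂ} (hw : ‖w‖ = 1) {x ρ : ℝ} (hρ : 0 < ρ) (h : ρ < x) :
    0 < ((x : ℂ) - ρ * w).re := by
  have : |w.re| ≤ 1 := hw ▸ abs_re_le_norm w
  simp
  nlinarith [(abs_le.1 this).2]

lemma log_ratio {a b : ℂ} (ha : 0 < a.re) (hb : 0 < b.re) :
    Complex.log (a / b) = Complex.log a - Complex.log b := by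
  have ha0 : a ≠ 0 := fun h => by simp [h] at ha
  have hb0 : b ≠ 0 := fun h => by simp [h] at hb
  have h1 := abs_lt.1 (Complex.abs_arg_lt_pi_div_two_iff.2 (Or.inl ha))
  have h2 := abs_lt.1 (Complex.abs_arg_lt_pi_div_two_iff.2 (Or.inl hb))
  rw [← log_exp (x := Complex.log a - Complex.log b), exp_sub, exp_log ha0,
    exp_log hb0]
  · rw [sub_im, log_im, log_im]; linarith
  · rw [sub_im, log_im, log_im]; linarith

theorem no_saddle {P N : Set ℂ} (hP : IsPreconnected P) (hN : IsPreconnected N) (oP : IsOpen P)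
    (oN : IsOpen N) (hd : Disjoint P N) (h0P : (0:ℂ) ∉ P) (h0N : (0:ℂ) ∉ N) {n : ℕ} (hn : 2 ≤ n)
    {ρ0 : ℝ} (hρ0 : 0 < ρ0)
    (h1 : ∀ ρ : ℝ, 0 < ρ → ρ ≤ ρ0 → (ρ:ℂ) ∈ P)
    (h2 : ∀ ρ : ℝ, 0 < ρ → ρ ≤ ρ0 → (ρ:ℂ) * Complex.exp ((2 * (pi / n) : ℝ) * Complex.I) ∈ P)
    (h3 : ∀ ρ : ℝ, 0 < ρ → ρ ≤ ρ0 → (ρ:ℂ) * Complex.exp (((pi / n) : ℝ) * Complex.I) ∈ N)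
    (h4 : ∀ ρ : ℝ, 0 < ρ → ρ ≤ ρ0 → (ρ:ℂ) * Complex.exp ((-(pi / n) : ℝ) * Complex.I) ∈ N) :
    False := by
  have hpi := pi_pos
  set φ : ℝ := pi / n with hφ
  have hn' : (2:ℝ) ≤ n := by exact_mod_cast hn
  have hφ0 : 0 < φ := by positivity
  have hφ2 : φ ≤ pi / 2 := by rw [hφ]; gcongr
  have hPN : ∀ z ∈ P, z ∈ Nᶜ := fun z hz hz' => hd.le_bot ⟨hz, hz'⟩
  set p2 : ℂ := (ρ0:ℂ) * Complex.exp ((2 * φ : ℝ) * Complex.I) with hp2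
  have hpath : IsPathConnected P :=
    oP.isConnected_iff_isPathConnected.1 ⟨⟨_, h1 ρ0 hρ0 le_rfl⟩, hP⟩
  obtain ⟨γ, hγ⟩ := hpath.joinedIn _ (h1 ρ0 hρ0 le_rfl) _ (h2 ρ0 hρ0 le_rfl)
  set Γ := Set.range γ with hΓ
  have hΓc : IsCompact Γ := isCompact_range γ.continuous
  have hΓp : IsPreconnected Γ := isPreconnected_range γ.continuous
  have hΓP : Γ ⊆ P := by rintro _ ⟨t, rfl⟩; exact hγ t
  have hm1 : (ρ0:ℂ) ∈ Γ := ⟨0, γ.source⟩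
  have hm2 : p2 ∈ Γ := ⟨1, γ.target⟩
  obtain ⟨zm, hzm, hmin⟩ := hΓc.exists_isMinOn ⟨_, hm1⟩ continuous_norm.continuousOn
  set η := ‖zm‖
  have hη : 0 < η := norm_pos_iff.2 fun h => h0P (h ▸ hΓP hzm)
  have hηΓ : ∀ z ∈ Γ, η ≤ ‖z‖ := fun z hz => hmin hz
  have hηρ : η ≤ ρ0 := by simpa [abs_of_pos hρ0] using hηΓ _ hm1
  set ρ := η / 8 with hρd
  have hρ : 0 < ρ := by positivity
  set w1 : ℂ := Complex.exp ((φ : ℝ) * Complex.I) with hw1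
  set w2 : ℂ := Complex.exp ((-φ : ℝ) * Complex.I) with hw2
  set w3 : ℂ := Complex.exp ((-(3 * φ) : ℝ) * Complex.I) with hw3
  set w4 : ℂ := Complex.exp ((2 * φ : ℝ) * Complex.I) with hw4
  have nw1 : ‖w1‖ = 1 := norm_exp_ofReal_mul_I _
  have nw2 : ‖w2‖ = 1 := norm_exp_ofReal_mul_I _
  have nw3 : ‖w3‖ = 1 := norm_exp_ofReal_mul_I _
  have e42 : w4 * w2 = w1 := by
    rw [hw4, hw2, hw1, ← exp_add]; congr 1; push_cast; ring
  have e43 : w4 * w3 = w2 := by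
    rw [hw4, hw2, hw3, ← exp_add]; congr 1; push_cast; ring
  have w40 : w4 ≠ 0 := exp_ne_zero _
  obtain ⟨L, hLc, hL⟩ := exists_log hN oN (h3 ρ hρ (by linarith)) (h4 ρ hρ (by linarith))
  have s1 : -w1 ∈ slitPlane := by
    have : w1 = Complex.exp (((φ - 2 * pi : ℝ)) * Complex.I) := by
      rw [hw1]; push_cast; rw [sub_mul, exp_sub, Complex.exp_two_pi_mul_I, div_one]
    rw [this]; exact slit_neg (by linarith) (by linarith)
  have s2 : -w2 ∈ slitPlane := slit_neg (by linarith) (by linarith)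
  have s3 : -w3 ∈ slitPlane := slit_neg (by linarith) (by linarith)
  have hS : IsPreconnected (Set.Icc (0:ℝ) ρ0) := isPreconnected_Icc
  have m0 : (0:ℝ) ∈ Set.Icc (0:ℝ) ρ0 := ⟨le_rfl, hρ0.le⟩
  have mρ : ρ0 ∈ Set.Icc (0:ℝ) ρ0 := ⟨hρ0.le, le_rfl⟩
  have r1 : ∀ x ∈ Set.Icc (0:ℝ) ρ0, (x:ℂ) ∈ Nᶜ := by
    intro x hx
    rcases hx.1.eq_or_lt with h | h
    · rw [← h]; simpa using h0N
    · exact hPN _ (h1 x h hx.2)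
  have r2 : ∀ x ∈ Set.Icc (0:ℝ) ρ0, (x:ℂ) * w4 ∈ Nᶜ := by
    intro x hx
    rcases hx.1.eq_or_lt with h | h
    · rw [← h]; simpa using h0N
    · exact hPN _ (h2 x h hx.2)
  have c1 := const_of_exp hS (f := fun x : ℝ => L x)
    (g := fun x : ℝ => Complex.log ((x:ℂ) - ρ * w1) - Complex.log ((x:ℂ) - ρ * w2))
    (hLc.comp (by fun_prop) r1)
    (ContinuousOn.sub (ContinuousOn.clog (by fun_prop) fun x hx => slit_sub s1 hx.1 hρ)
      (ContinuousOn.clog (by fun_prop) fun x hx => slit_sub s2 hx.1 hρ))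
    (fun x hx => by
      rw [hL _ (r1 x hx), exp_sub,
        exp_log (slitPlane_ne_zero (slit_sub s1 hx.1 hρ)),
        exp_log (slitPlane_ne_zero (slit_sub s2 hx.1 hρ))]) m0 mρ
  have c2 := const_of_exp hS (f := fun x : ℝ => L (x * w4))
    (g := fun x : ℝ => Complex.log ((x:ℂ) - ρ * w2) - Complex.log ((x:ℂ) - ρ * w3))
    (hLc.comp (by fun_prop) r2)
    (ContinuousOn.sub (ContinuousOn.clog (by fun_prop) fun x hx => slit_sub s2 hx.1 hρ)
      (ContinuousOn.clog (by fun_prop) fun x hx => slit_sub s3 hx.1 hρ))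
    (fun x hx => by
      rw [hL _ (r2 x hx), exp_sub,
        exp_log (slitPlane_ne_zero (slit_sub s2 hx.1 hρ)),
        exp_log (slitPlane_ne_zero (slit_sub s3 hx.1 hρ)), ← e42, ← e43,
        show (x:ℂ) * w4 - ρ * (w4 * (w4 * w3)) = w4 * (x - ρ * (w4 * w3)) by ring,
        show (x:ℂ) * w4 - ρ * (w4 * w3) = w4 * (x - ρ * w3) by ring,
        mul_div_mul_left _ _ w40]) m0 mρ
  have hne : ∀ z ∈ Γ, z - ρ * w2 ≠ 0 ∧ (z - ρ * w1) / (z - ρ * w2) ∈ slitPlane := by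
    intro z hz
    have hz1 := hηΓ z hz
    have hb : ‖(ρ:ℂ) * w2‖ = ρ := by rw [norm_mul, nw2, Complex.norm_of_nonneg hρ.le, mul_one]
    have ha : ‖(ρ:ℂ) * w1‖ = ρ := by rw [norm_mul, nw1, Complex.norm_of_nonneg hρ.le, mul_one]
    have h5 := norm_sub_norm_le z (ρ * w2)
    have h6 := norm_sub_le ((ρ:ℂ) * w2) (ρ * w1)
    rw [hb] at h5 h6
    rw [ha] at h6
    have h7 : 0 < ‖z - ρ * w2‖ := by linarith
    have h8 := norm_pos_iff.1 h7
    refine ⟨h8, ?_⟩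
    have : (z - ρ * w1) / (z - ρ * w2) = 1 + (ρ * w2 - ρ * w1) / (z - ρ * w2) := by
      field_simp; ring
    rw [this]
    apply Complex.mem_slitPlane_of_norm_lt_one
    rw [norm_div, div_lt_one h7]
    linarith
  have c3 := const_of_exp hΓp (f := L)
    (g := fun z => Complex.log ((z - ρ * w1) / (z - ρ * w2)))
    (hLc.mono fun z hz => hPN z (hΓP hz))
    (ContinuousOn.clog (ContinuousOn.div (by fun_prop) (by fun_prop) fun z hz => (hne z hz).1)
      fun z hz => (hne z hz).2)
    (fun z hz => by
      rw [hL z (hPN z (hΓP hz)), exp_log (slitPlane_ne_zero (hne z hz).2)])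
    hm1 hm2
  have hρρ : ρ < ρ0 := by linarith
  have e1 := log_ratio (re_pos_sub nw1 hρ hρρ) (re_pos_sub nw2 hρ hρρ)
  have e2 := log_ratio (re_pos_sub nw2 hρ hρρ) (re_pos_sub nw3 hρ hρρ)
  have e3 : (p2 - ρ * w1) / (p2 - ρ * w2) = (ρ0 - ρ * w2) / (ρ0 - ρ * w3) := by
    rw [hp2, ← e42, ← e43, show (ρ0:ℂ) * w4 - ρ * (w4 * (w4 * w3)) = w4 * (ρ0 - ρ * (w4 * w3)) by ring,
        show (ρ0:ℂ) * w4 - ρ * (w4 * w3) = w4 * (ρ0 - ρ * w3) by ring,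
        mul_div_mul_left _ _ w40]
  simp only [e1, e3, e2] at c3
  simp only [Complex.ofReal_zero, zero_sub, zero_mul] at c1 c2
  have l1 := log_neg_pos (ρ := ρ) (θ := φ) hρ (by linarith) (by linarith)
  have l2 := log_neg_neg (ρ := ρ) (θ := -φ) hρ (by linarith) (by linarith)
  have l3 := log_neg_neg (ρ := ρ) (θ := -(3 * φ)) hρ (by linarith) (by linarith)
  rw [← hw1] at l1
  rw [← hw2] at l2
  rw [← hw3] at l3
  rw [l1, l2] at c1
  rw [l2, l3, ← hp2] at c2
  have hfin : ((2 * pi : ℝ) : ℂ) * Complex.I = 0 := by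
    push_cast at *
    linear_combination c1 - c2 + c3
  simp [Real.pi_ne_zero] at hfin

def clS (R : ℝ) (z : ℂ) : ℂ := ⟨z.re, max (-R) (min R z.im)⟩

lemma clS_cont (R : ℝ) : Continuous (clS R) := by
  have : clS R = fun z => Complex.equivRealProdCLM.symm (z.re, max (-R) (min R z.im)) := by
    funext z; rfl
  rw [this]
  have h1 := continuous_re
  have h2 := continuous_im
  fun_prop

lemma clS_im {R : ℝ} (hR : 0 ≤ R) (z : ℂ) : |(clS R z).im| ≤ R :=
  abs_le.2 ⟨le_max_left _ _, max_le (by linarith) (min_le_left _ _)⟩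

lemma clS_eq {R : ℝ} {z : ℂ} (h : |z.im| ≤ R) : clS R z = z := by
  have := abs_le.1 h
  apply Complex.ext <;> simp [clS, min_eq_right this.2, max_eq_right this.1]

lemma clS_lip (R : ℝ) (z w : ℂ) : ‖clS R z - clS R w‖ ≤ ‖z - w‖ := by
  rw [Complex.norm_eq_sqrt_sq_add_sq, Complex.norm_eq_sqrt_sq_add_sq]
  apply Real.sqrt_le_sqrt
  have h : |max (-R) (min R z.im) - max (-R) (min R w.im)| ≤ |z.im - w.im| := by
    refine (abs_max_sub_max_le_max _ _ _ _).trans ?_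
    refine max_le (by simp) ((abs_min_sub_min_le_max _ _ _ _).trans (max_le (by simp) le_rfl))
  have := sq_le_sq.2 h
  simp only [clS, sub_re, sub_im]
  linarith

def tp : ℂ := ((2 * pi : ℝ) : ℂ)

lemma tp_re : tp.re = 2 * pi := by simp [tp]
lemma tp_im : tp.im = 0 := by simp [tp]

lemma exists_shift (z : ℂ) : ∃ n : ℤ, (z + n * tp).re ∈ Set.Ico 0 (2 * pi) ∧ (z + n * tp).im = z.im := by
  obtain ⟨n, hn, -⟩ := existsUnique_add_zsmul_mem_Ico two_pi_pos z.re 0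
  refine ⟨n, ?_, ?_⟩
  · simpa [tp_re, tp_im] using hn
  · simp [tp_im]

lemma strip_cpt (a b R : ℝ) : IsCompact {z : ℂ | a ≤ z.re ∧ z.re ≤ b ∧ |z.im| ≤ R} := by
  refine Metric.isCompact_of_isClosed_isBounded ?_ ?_
  · exact (isClosed_le continuous_const continuous_re).inter
      ((isClosed_le continuous_re continuous_const).inter
        (isClosed_le (continuous_im.abs) continuous_const))
  · refine (Metric.isBounded_closedBall (x := (0:ℂ)) (r := max |a| |b| + R)).subset ?_
    rintro z ⟨h1, h2, h3⟩
    rw [mem_closedBall_zero_iff]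
    refine (norm_le_abs_re_add_abs_im z).trans (add_le_add ?_ h3)
    exact abs_le_max_abs_abs h1 h2

lemma per_bdd {f : ℂ → ℂ} (hf : Continuous f) (hp : Function.Periodic f tp) (R : ℝ) :
    ∃ C, 0 ≤ C ∧ ∀ z, |z.im| ≤ R → ‖f z‖ ≤ C := by
  obtain ⟨C, hC⟩ := (strip_cpt 0 (2 * pi) R).exists_bound_of_continuousOn hf.continuousOn
  refine ⟨max C 0, le_max_right _ _, fun z hz => ?_⟩
  obtain ⟨n, hn, hi⟩ := exists_shift z
  rw [← hp.int_mul n z]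
  exact (hC _ ⟨hn.1, hn.2.le, by rw [hi]; exact hz⟩).trans (le_max_left _ _)

lemma per_uc {f : ℂ → ℂ} (hf : Continuous f) (hp : Function.Periodic f tp) (R : ℝ) {ε : ℝ}
    (hε : 0 < ε) : ∃ δ > 0, ∀ z w, |z.im| ≤ R → |w.im| ≤ R → ‖z - w‖ ≤ δ → ‖f z - f w‖ ≤ ε := by
  have := (strip_cpt (-1) (2 * pi + 1) R).uniformContinuousOn_of_continuous hf.continuousOn
  obtain ⟨δ, hδ, h⟩ := Metric.uniformContinuousOn_iff.1 this ε hε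
  refine ⟨min (δ / 2) 1, by positivity, fun z w hz hw hzw => ?_⟩
  obtain ⟨n, hn, hi⟩ := exists_shift z
  rw [← hp.int_mul n z, ← hp.int_mul n w, ← dist_eq_norm]
  have hre : |(z - w).re| ≤ 1 := (abs_re_le_norm _).trans (hzw.trans (min_le_right _ _))
  have hre := abs_le.1 hre
  refine (h _ ⟨by linarith [hn.1], by linarith [hn.2], by rw [hi]; exact hz⟩ _ ⟨?_, ?_, ?_⟩ ?_).le
  · have := hn.1; simp at hre this ⊢; linarith
  · have := hn.2; simp at hre this ⊢; linarith
  · simpa [tp_im] using hw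
  · rw [dist_eq_norm]
    have := hzw.trans (min_le_left _ _)
    simp; linarith

def sg (z : ℂ) : ℂ := (starRingEnd ℂ) z + (pi : ℝ)

lemma sg_sg (z : ℂ) : sg (sg z) = z + tp := by simp [sg, tp]; ring
lemma sg_im (z : ℂ) : (sg z).im = -z.im := by simp [sg]
lemma sg_re (z : ℂ) : (sg z).re = z.re + pi := by simp [sg]
lemma sg_cont : Continuous sg := by unfold sg; exact (Complex.continuous_conj).add continuous_const

structure Lift (F : ℂ → ℂ) : Prop where
  hom : IsHomeomorph F
  sg : ∀ z, F (sg z) = sg (F z)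
  up : ∀ T : ℝ, ∃ S : ℝ, ∀ z, S ≤ z.im → T ≤ (F z).im

lemma sg_per {F : ℂ → ℂ} (h : ∀ z, F (sg z) = sg (F z)) :
    Function.Periodic (fun z => F z - z) tp := by
  intro z
  simp only
  rw [← sg_sg, h, h, sg_sg, sg_sg]; ring

lemma Lift.c {F : ℂ → ℂ} (h : Lift F) : Continuous F := h.hom.continuous

lemma Lift.bdd {F : ℂ → ℂ} (h : Lift F) (R : ℝ) : ∃ C, 0 ≤ C ∧ ∀ z, |z.im| ≤ R → ‖F z - z‖ ≤ C :=
  per_bdd (h.c.sub continuous_id) (sg_per h.sg) R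

lemma Lift.up' {F : ℂ → ℂ} (h : Lift F) (T : ℝ) : ∃ S : ℝ, 0 ≤ S ∧ ∀ z, S ≤ |z.im| → T ≤ |(F z).im| := by
  obtain ⟨S, hS⟩ := h.up T
  refine ⟨max S 0, le_max_right _ _, fun z hz => ?_⟩
  rcases le_abs.1 ((le_max_left _ _).trans hz) with h1 | h1
  · exact (hS z h1).trans (le_abs_self _)
  · have := hS (_root_.sg z) (by rw [sg_im]; exact h1)
    rw [h.sg, sg_im] at this
    exact this.trans (neg_le_abs _)

def AF (F : ℂ → ℂ) (τ : ℝ) : Set ℂ := {z | |(F z).im| < τ}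

lemma AF_open {F : ℂ → ℂ} (h : Continuous F) (τ : ℝ) : IsOpen (AF F τ) :=
  isOpen_lt ((continuous_im.comp h).abs) continuous_const

lemma AF_strip {F : ℂ → ℂ} (h : Lift F) (τ : ℝ) : ∃ R : ℝ, 0 ≤ R ∧ ∀ z ∈ AF F τ, |z.im| ≤ R := by
  obtain ⟨S, hS0, hS⟩ := h.up' τ
  refine ⟨S, hS0, fun z hz => ?_⟩
  by_contra! hc
  exact absurd hz (not_lt.2 (hS z hc.le))

lemma AF_reg {F : ℂ → ℂ} (h : Lift F) (τ : ℝ) : Reg (AF F τ) := by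
  refine ⟨AF_open h.c τ, (AF_strip h τ).imp fun R hR => hR.2, fun ζ hζ δ hδ => ?_⟩
  have hζA : ζ ∉ AF F τ := by rw [(AF_open h.c τ).frontier_eq] at hζ; exact hζ.2
  have hcl : closure (AF F τ) ⊆ {z | |(F z).im| ≤ τ} :=
    closure_minimal (fun z hz => (show |(F z).im| < τ from hz).le) (isClosed_le ((continuous_im.comp h.c).abs) continuous_const)
  have hζτ : τ ≤ |(F ζ).im| := not_lt.1 hζA
  obtain ⟨s, hs1, hs⟩ : ∃ s : ℝ, s * s = 1 ∧ |(F ζ).im| = s * (F ζ).im := by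
    rcases abs_choice (F ζ).im with h | h
    · exact ⟨1, by norm_num, by rw [h]; ring⟩
    · exact ⟨-1, by norm_num, by rw [h]; ring⟩
  let e := h.hom.homeomorph F
  have he : ∀ z, e z = F z := fun z => rfl
  let γ : ℝ → ℂ := fun t => e.symm (F ζ + (t * s : ℝ) * Complex.I)
  have hγ : ∀ t, F (γ t) = F ζ + (t * s : ℝ) * Complex.I := fun t => by
    rw [← he]; exact e.apply_symm_apply _
  have hγc : Continuous γ := by
    refine e.symm.continuous.comp ?_; fun_prop
  have hγ0 : γ 0 = ζ := by
    apply h.hom.injective; rw [hγ]; simp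
  have hγim : ∀ t, s * (F (γ t)).im = |(F ζ).im| + t := fun t => by
    rw [hγ, hs]; simp; linear_combination t * hs1
  have habs : ∀ x : ℝ, s * x ≤ |x| := fun x => by
    have : |s| = 1 := by
      have := abs_mul_abs_self s
      rw [hs1] at this; nlinarith [abs_nonneg s]
    calc s * x ≤ |s * x| := le_abs_self _
      _ = |x| := by rw [abs_mul, this, one_mul]
  set K : Set ℂ := {z | z ∈ closedBall ζ (2 * δ) ∧ δ ≤ ‖z - ζ‖ ∧ (F z).re = (F ζ).re ∧
    |(F ζ).im| ≤ s * (F z).im} with hK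
  have hFre := continuous_re.comp h.c
  have hFim := continuous_im.comp h.c
  have hKc : IsCompact K := by
    refine (isCompact_closedBall ζ (2 * δ)).inter_right ?_
    exact (isClosed_le continuous_const (continuous_id.sub continuous_const).norm).inter
      ((isClosed_eq hFre continuous_const).inter (isClosed_le continuous_const (continuous_const.mul hFim)))
  have hKA : K ⊆ (closure (AF F τ))ᶜ := by
    rintro z ⟨h1, h2, h3, h4⟩ hz
    have h5 : |(F z).im| ≤ τ := hcl hz
    have h6 : s * (F z).im = s * (F ζ).im := by
      have := habs (F z).im
      rw [← hs]; linarith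
    have h7 : (F z).im = (F ζ).im := by
      have : s ≠ 0 := fun h => by simp [h] at hs1
      exact mul_left_cancel₀ this h6
    have : z = ζ := h.hom.injective (Complex.ext h3 h7)
    rw [this, sub_self, norm_zero] at h2
    linarith
  obtain ⟨η, hη, hth⟩ := hKc.exists_cthickening_subset_open isClosed_closure.isOpen_compl hKA
  refine ⟨η, hη, fun r hr1 hr2 => ?_⟩
  obtain ⟨t1, ht1, hfar⟩ : ∃ t ≥ 0, 2 * δ ≤ ‖γ t - ζ‖ := by
    by_contra! hcon
    obtain ⟨C, hC⟩ := (isCompact_closedBall ζ (2 * δ)).exists_bound_of_continuousOn h.c.continuousOn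
    have h1 := hC (γ (|C| + 1)) (mem_closedBall_iff_norm.2 (hcon _ (by positivity)).le)
    have h2 := hγim (|C| + 1)
    have h3 := habs (F (γ (|C| + 1))).im
    have h4 := abs_im_le_norm (F (γ (|C| + 1)))
    linarith [le_abs_self C, abs_nonneg (F ζ).im]
  obtain ⟨t, ht, hteq⟩ := intermediate_value_Icc ht1 (f := fun t => ‖γ t - ζ‖) (by fun_prop)
    (show r ∈ Set.Icc _ _ from ⟨by simp [hγ0]; linarith, by linarith⟩)
  refine ⟨γ t, hteq, fun z hz => ?_⟩
  by_contra! hlt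
  have hmem : γ t ∈ K := ⟨mem_closedBall_iff_norm.2 (by simp only at hteq; linarith),
    by simp only at hteq; linarith, by rw [hγ]; simp, by rw [hγim]; linarith [ht.1]⟩
  exact hth (mem_cthickening_of_dist_le z (γ t) η K hmem (by rw [dist_eq_norm]; exact hlt.le))
    (subset_closure hz)

lemma loc_an {u : ℂ → ℝ} {z : ℂ} (h : HarmonicAt u z) :
    ∃ e > 0, ∃ G : ℂ → ℂ, (∀ w ∈ ball z e, AnalyticAt ℂ G w) ∧ ∀ w ∈ ball z e, u w = (G w).re := by
  obtain ⟨e, he, hb⟩ := Metric.eventually_nhds_iff_ball.1 h.eventually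
  obtain ⟨G, hG, h2⟩ := HarmonicOnNhd.exists_analyticOnNhd_ball_re_eq (f := u) (z := z) (R := e) hb
  exact ⟨e, he, G, hG, fun w hw => (h2 hw).symm⟩

lemma harm_sg {u : ℂ → ℝ} {z : ℂ} (h : HarmonicAt u (sg z)) : HarmonicAt (fun w => u (sg w)) z := by
  obtain ⟨e, he, G, hG, hu⟩ := loc_an h
  have hd : ∀ w, dist (sg w) (sg z) = dist w z := fun w => by
    simp only [sg, dist_add_right, Complex.dist_conj_conj]
  let k : ℂ → ℂ := fun w => (starRingEnd ℂ) (G ((starRingEnd ℂ) w + (pi : ℝ)))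
  have hk : DifferentiableOn ℂ k (ball z e) := by
    intro w hw
    have h1 : sg w ∈ ball (sg z) e := by rw [mem_ball, hd]; exact hw
    have h2 : DifferentiableAt ℂ (fun y => G (y + (pi : ℝ))) ((starRingEnd ℂ) w) :=
      DifferentiableAt.comp ((starRingEnd ℂ) w) (g := G) (hG (sg w) h1).differentiableAt (by fun_prop)
    have := h2.conj_conj
    simp only [Complex.conj_conj] at this
    exact this.differentiableWithinAt
  have ha : AnalyticAt ℂ k z := hk.analyticAt (ball_mem_nhds z he)
  refine (harmonicAt_congr_nhds ?_).1 ha.harmonicAt_re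
  filter_upwards [ball_mem_nhds z he] with w hw
  have h1 : sg w ∈ ball (sg z) e := by rw [mem_ball, hd]; exact hw
  rw [hu _ h1]; simp [k, sg]

structure IsH (F : ℂ → ℂ) (τ : ℝ) (h : ℂ → ℂ) : Prop where
  c : Continuous h
  out : ∀ z, z ∉ AF F τ → h z = F z
  hr : HarmonicOnNhd (fun z => (h z).re) (AF F τ)
  hi : HarmonicOnNhd (fun z => (h z).im) (AF F τ)
  bd : ∃ C, ∀ z, ‖h z - F z‖ ≤ C

lemma harm_le {A : Set ℂ} (hA : Reg A) {u v : ℂ → ℝ} (cu : Continuous u) (cv : Continuous v)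
    (hu : HarmonicOnNhd u A) (hv : HarmonicOnNhd v A) {C k : ℝ} (hC : ∀ z, u z - v z ≤ C)
    (hf : ∀ z ∉ A, u z - v z ≤ k) (z : ℂ) : u z - v z ≤ k := by
  by_cases hz : z ∈ A
  · have h1 : SubM (fun z => u z - v z + -k) A :=
      (HarmonicOnNhd.subM hA.o (hu.sub hv)).add (SubM.const (-k) A) (cu.sub cv) continuous_const
    have := maxPA hA (v := fun z => u z - v z + -k) (by fun_prop) h1 (C := C - k)
      (fun w hw => by linarith [hf w (hA.nf hw)]) (fun w => by linarith [hC w]) z hz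
    linarith
  · exact hf z hz

lemma IsH.uniq {F : ℂ → ℂ} {τ : ℝ} (hF : Lift F) {h h' : ℂ → ℂ} (a : IsH F τ h) (b : IsH F τ h') :
    h = h' := by
  have hA := AF_reg hF τ
  obtain ⟨C, hC⟩ := a.bd
  obtain ⟨C', hC'⟩ := b.bd
  have hb : ∀ z, ‖h z - h' z‖ ≤ C + C' := fun z => by
    have := norm_sub_le_norm_sub_add_norm_sub (h z) (F z) (h' z)
    have h1 := hC' z
    rw [norm_sub_rev] at h1
    linarith [hC z]
  have hre := fun z => abs_le.1 ((abs_re_le_norm (h z - h' z)).trans (hb z))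
  have him := fun z => abs_le.1 ((abs_im_le_norm (h z - h' z)).trans (hb z))
  simp only [sub_re, sub_im] at hre him
  have e : ∀ z ∉ AF F τ, h z = h' z := fun z hz => by rw [a.out z hz, b.out z hz]
  have c1 := a.c
  have c2 := b.c
  funext z
  apply Complex.ext
  · have h1 := harm_le hA (continuous_re.comp c1) (continuous_re.comp c2) a.hr b.hr
      (fun z => (hre z).2) (k := 0) (fun z hz => by simp [e z hz]) z
    have h2 := harm_le hA (continuous_re.comp c2) (continuous_re.comp c1) b.hr a.hr
      (C := C + C') (fun z => by simp only [Function.comp_apply]; linarith [(hre z).1]) (k := 0) (fun z hz => by simp [e z hz]) z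
    simp only [Function.comp_apply] at h1 h2
    linarith
  · have h1 := harm_le hA (continuous_im.comp c1) (continuous_im.comp c2) a.hi b.hi
      (fun z => (him z).2) (k := 0) (fun z hz => by simp [e z hz]) z
    have h2 := harm_le hA (continuous_im.comp c2) (continuous_im.comp c1) b.hi a.hi
      (C := C + C') (fun z => by simp only [Function.comp_apply]; linarith [(him z).1]) (k := 0) (fun z hz => by simp [e z hz]) z
    simp only [Function.comp_apply] at h1 h2
    linarith

lemma AF_sg {F : ℂ → ℂ} (hs : ∀ z, F (sg z) = sg (F z)) {τ : ℝ} {z : ℂ} : sg z ∈ AF F τ ↔ z ∈ AF F τ := by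
  simp only [AF, Set.mem_setOf_eq, hs, sg_im, abs_neg]

lemma IsH.sg {F : ℂ → ℂ} {τ : ℝ} (hF : Lift F) {h : ℂ → ℂ} (a : IsH F τ h) (z : ℂ) :
    h (sg z) = sg (h z) := by
  have hk : IsH F τ (fun z => (starRingEnd ℂ) (h (_root_.sg z) - (pi : ℝ))) := by
    refine ⟨?_, ?_, ?_, ?_, ?_⟩
    · exact Complex.continuous_conj.comp ((a.c.comp sg_cont).sub continuous_const)
    · intro z hz
      rw [a.out _ (fun h => hz ((AF_sg hF.sg).1 h)), hF.sg]; simp [_root_.sg]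
    · intro z hz
      have := (harm_sg (a.hr (_root_.sg z) ((AF_sg hF.sg).2 hz))).sub (harmonicAt_const pi)
      refine (harmonicAt_congr_nhds (Filter.Eventually.of_forall fun w => ?_)).1 this
      simp
    · intro z hz
      have := (harm_sg (a.hi (_root_.sg z) ((AF_sg hF.sg).2 hz))).neg
      refine (harmonicAt_congr_nhds (Filter.Eventually.of_forall fun w => ?_)).1 this
      simp
    · obtain ⟨C, hC⟩ := a.bd
      refine ⟨C, fun z => ?_⟩
      have := hC (_root_.sg z)
      rw [hF.sg, ← Complex.norm_conj] at this
      convert this using 2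
      simp [_root_.sg]; ring
  have := congrFun (a.uniq hF hk) z
  rw [this]; simp [_root_.sg]

def gF (F : ℂ → ℂ) (R : ℝ) (z : ℂ) : ℂ := F (clS (R + 1) z) - clS (R + 1) z

def HF (F : ℂ → ℂ) (τ R M : ℝ) (z : ℂ) : ℂ :=
  ⟨perron (AF F τ) (fun z => (gF F R z).re) M z, perron (AF F τ) (fun z => (gF F R z).im) M z⟩
    + (F z - gF F R z)

lemma gF_eq {F : ℂ → ℂ} {R : ℝ} {z : ℂ} (hz : |z.im| ≤ R + 1) : gF F R z = F z - z := by
  rw [gF, clS_eq hz]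

structure Bds (F : ℂ → ℂ) (τ R M : ℝ) : Prop where
  A : ∀ z ∈ AF F τ, |z.im| ≤ R
  R0 : 0 ≤ R
  M0 : 0 ≤ M
  M : ∀ z, |z.im| ≤ R + 1 → ‖F z - z‖ ≤ M

lemma Bds.g {F : ℂ → ℂ} {τ R M : ℝ} (h : Bds F τ R M) (z : ℂ) : ‖gF F R z‖ ≤ M :=
  h.M _ (clS_im (by linarith [h.R0]) z)

lemma Lift.bds {F : ℂ → ℂ} (hF : Lift F) (τ : ℝ) : ∃ R M, Bds F τ R M := by
  obtain ⟨R, hR, h⟩ := AF_strip hF τ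
  obtain ⟨M, hM, h'⟩ := hF.bdd (R + 1)
  exact ⟨R, M, h, hR, hM, h'⟩

lemma gF_uc {F : ℂ → ℂ} (hF : Lift F) (R : ℝ) (hR : 0 ≤ R) {ε : ℝ} (hε : 0 < ε) :
    ∃ δ > 0, ∀ z w, ‖z - w‖ ≤ δ → ‖gF F R z - gF F R w‖ ≤ ε := by
  obtain ⟨δ, hδ, h⟩ := per_uc (hF.c.sub continuous_id) (sg_per hF.sg) (R + 1) hε
  exact ⟨δ, hδ, fun z w hzw => h _ _ (clS_im (by linarith) z) (clS_im (by linarith) w)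
    ((clS_lip _ z w).trans hzw)⟩

lemma HF_eq {F : ℂ → ℂ} {τ R M : ℝ} {z : ℂ} (hz : |z.im| ≤ R + 1) :
    HF F τ R M z = z + ⟨perron (AF F τ) (fun z => (gF F R z).re) M z,
      perron (AF F τ) (fun z => (gF F R z).im) M z⟩ := by
  rw [HF, gF_eq hz]; ring

theorem HF_isH {F : ℂ → ℂ} (hF : Lift F) {τ R M : ℝ} (b : Bds F τ R M) : IsH F τ (HF F τ R M) := by
  have hA := AF_reg hF τ
  have hr : ∀ z, |(gF F R z).re| ≤ M := fun z => (abs_re_le_norm _).trans (b.g z)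
  have hi : ∀ z, |(gF F R z).im| ≤ M := fun z => (abs_im_le_norm _).trans (b.g z)
  have ur : UniformContinuous (fun z => (gF F R z).re) := by
    refine Metric.uniformContinuous_iff.2 fun ε hε => ?_
    obtain ⟨δ, hδ, h⟩ := gF_uc hF R b.R0 (half_pos hε)
    refine ⟨δ, hδ, fun {z w} hzw => ?_⟩
    rw [Real.dist_eq, ← sub_re]
    rw [dist_eq_norm] at hzw
    linarith [(abs_re_le_norm _).trans (h z w hzw.le)]
  have ui : UniformContinuous (fun z => (gF F R z).im) := by
    refine Metric.uniformContinuous_iff.2 fun ε hε => ?_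
    obtain ⟨δ, hδ, h⟩ := gF_uc hF R b.R0 (half_pos hε)
    refine ⟨δ, hδ, fun {z w} hzw => ?_⟩
    rw [Real.dist_eq, ← sub_im]
    rw [dist_eq_norm] at hzw
    linarith [(abs_im_le_norm _).trans (h z w hzw.le)]
  have hst : ∀ z ∈ AF F τ, ∀ᶠ w in nhds z, |w.im| ≤ R + 1 := fun z hz => by
    filter_upwards [hA.o.mem_nhds hz] with w hw
    linarith [b.A w hw]
  refine ⟨?_, ?_, ?_, ?_, ?_⟩
  · have h1 := perron_cont hA b.M0 hr ur
    have h2 := perron_cont hA b.M0 hi ui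
    have h3 : Continuous (gF F R) := (hF.c.comp (clS_cont _)).sub (clS_cont _)
    have h4 : Continuous fun z => Complex.equivRealProdCLM.symm
      (perron (AF F τ) (fun z => (gF F R z).re) M z, perron (AF F τ) (fun z => (gF F R z).im) M z) := by
      fun_prop
    exact h4.add (hF.c.sub h3)
  · intro z hz
    rw [HF, perron_out hz, perron_out hz]; simp
  · intro z hz
    have h1 := (perron_harm hA.o b.M0 hr z hz).add (analyticAt_id (𝕜 := ℂ)).harmonicAt_re
    refine (harmonicAt_congr_nhds ?_).1 h1
    filter_upwards [hst z hz] with w hw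
    rw [HF_eq hw]; simp [add_comm]
  · intro z hz
    have h1 := (perron_harm hA.o b.M0 hi z hz).add (analyticAt_id (𝕜 := ℂ)).harmonicAt_im
    refine (harmonicAt_congr_nhds ?_).1 h1
    filter_upwards [hst z hz] with w hw
    rw [HF_eq hw]; simp [add_comm]
  · refine ⟨3 * M, fun z => ?_⟩
    have h1 := norm_le_abs_re_add_abs_im (⟨perron (AF F τ) (fun z => (gF F R z).re) M z,
      perron (AF F τ) (fun z => (gF F R z).im) M z⟩ : ℂ)
    have h2 := perron_abs (A := AF F τ) b.M0 hr z
    have h3 := perron_abs (A := AF F τ) b.M0 hi z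
    have h4 := b.g z
    rw [HF, show ∀ a b c : ℂ, a + (b - c) - b = a - c from fun a b c => by ring]
    refine (norm_sub_le _ _).trans ?_
    simp only at h1
    linarith

theorem estH {ε r M : ℝ} (hε : 0 < ε) (hr : 0 < r) (hM : 0 ≤ M) : ∃ δ > 0, ∀ (F : ℂ → ℂ) (τ R : ℝ),
    Lift F → Bds F τ R M → (∀ z w, ‖z - w‖ ≤ r → ‖gF F R z - gF F R w‖ ≤ ε) →
    ∀ h, IsH F τ h → ∀ z, ∀ w ∉ AF F τ, ‖z - w‖ ≤ δ → ‖h z - F z‖ ≤ 6 * ε := by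
  obtain ⟨δ, hδ, hU⟩ := estU hε hr hM
  refine ⟨δ, hδ, fun F τ R hF b hg h hh z w hw hzw => ?_⟩
  rw [hh.uniq hF (HF_isH hF b)]
  by_cases hz : z ∈ AF F τ
  · have h1 := hU (AF F τ) (AF_reg hF τ) (fun z => (gF F R z).re)
      (fun z => (abs_re_le_norm _).trans (b.g z))
      (fun z z' hz => by rw [← sub_re]; exact (abs_re_le_norm _).trans (hg _ _ hz)) z hz w hw hzw
    have h2 := hU (AF F τ) (AF_reg hF τ) (fun z => (gF F R z).im)
      (fun z => (abs_im_le_norm _).trans (b.g z))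
      (fun z z' hz => by rw [← sub_im]; exact (abs_im_le_norm _).trans (hg _ _ hz)) z hz w hw hzw
    rw [HF, show ∀ a b c : ℂ, a + (b - c) - b = a - c from fun a b c => by ring]
    refine (norm_le_abs_re_add_abs_im _).trans ?_
    simp only [sub_re, sub_im]
    linarith
  · rw [(HF_isH hF b).out z hz]; simp; positivity

def lv (α β : ℝ) (h : ℂ → ℂ) (z : ℂ) : ℝ := α * (h z).re + β * (h z).im

lemma lv_cont {α β : ℝ} {h : ℂ → ℂ} (hc : Continuous h) : Continuous (lv α β h) := by
  have h1 := continuous_re.comp hc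
  have h2 := continuous_im.comp hc
  exact (continuous_const.mul h1).add (continuous_const.mul h2)

lemma IsH.lv {F h : ℂ → ℂ} {τ : ℝ} (a : IsH F τ h) (α β : ℝ) : HarmonicOnNhd (lv α β h) (AF F τ) := by
  intro z hz
  exact ((a.hr z hz).const_smul (c := α)).add ((a.hi z hz).const_smul (c := β))

lemma lv_sub (α β : ℝ) (h k : ℂ → ℂ) (z : ℂ) : |lv α β h z - lv α β k z| ≤ (|α| + |β|) * ‖h z - k z‖ := by
  have : lv α β h z - lv α β k z = α * (h z - k z).re + β * (h z - k z).im := by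
    simp [lv]; ring
  rw [this, add_mul]
  refine (abs_add_le _ _).trans ?_
  rw [abs_mul, abs_mul]
  have h1 := abs_re_le_norm (h z - k z)
  have h2 := abs_im_le_norm (h z - k z)
  gcongr

lemma IsH.growth {F h : ℂ → ℂ} {τ : ℝ} (hF : Lift F) (a : IsH F τ h) (α β c R : ℝ) :
    ∃ C, ∀ z, |z.im| ≤ R → _root_.lv α β h z - c ≤ C * (1 + |z.re|) := by
  obtain ⟨C1, h1⟩ := a.bd
  obtain ⟨C2, hC2, h2⟩ := hF.bdd R
  refine ⟨(|α| + |β|) * (|C1| + C2 + |R| + 1) + |c|, fun z hz => ?_⟩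
  have h3 := (abs_le.1 (lv_sub α β h (fun _ => 0) z)).2
  have h4 : ‖h z - 0‖ ≤ |C1| + C2 + (|z.re| + R) := by
    have := norm_le_abs_re_add_abs_im z
    calc ‖h z - 0‖ = ‖(h z - F z) + (F z - z) + z‖ := by congr 1; ring
      _ ≤ ‖h z - F z‖ + ‖F z - z‖ + ‖z‖ := norm_add₃_le
      _ ≤ _ := by linarith [h1 z, h2 z hz, le_abs_self C1]
  have h5 : (|α| + |β|) * ‖h z - 0‖ ≤ (|α| + |β|) * ((|C1| + C2 + |R| + 1) * (1 + |z.re|)) := by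
    gcongr
    nlinarith [abs_nonneg C1, abs_nonneg R, le_abs_self R, abs_nonneg z.re]
  have h6 : _root_.lv α β (fun _ => (0:ℂ)) z = 0 := by simp [_root_.lv]
  have : -c ≤ |c| * (1 + |z.re|) := by nlinarith [neg_le_abs c, abs_nonneg c, abs_nonneg z.re]
  linarith

lemma AF_cl {F : ℂ → ℂ} (hF : Lift F) {τ : ℝ} {z : ℂ} (hz : z ∈ closure (AF F τ)) : |(F z).im| ≤ τ :=
  closure_minimal (fun z hz => (show |(F z).im| < τ from hz).le)
    (isClosed_le ((continuous_im.comp hF.c).abs) continuous_const) hz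

lemma IsH.im_le {F h : ℂ → ℂ} {τ : ℝ} (hF : Lift F) (a : IsH F τ h) {β : ℝ} (hβ : |β| ≤ 1)
    {z : ℂ} (hz : z ∈ AF F τ) : β * (h z).im ≤ τ := by
  obtain ⟨R, hR0, hR⟩ := AF_strip hF τ
  obtain ⟨C, hC⟩ := a.growth hF 0 β τ R
  have hA := AF_reg hF τ
  have := maxP hA.o hR (v := fun z => _root_.lv 0 β h z + -τ) ((lv_cont a.c).add continuous_const)
    ((HarmonicOnNhd.subM hA.o (a.lv 0 β)).add (SubM.const _ _) (lv_cont a.c) continuous_const)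
    (fun w hw => by
      have h1 := AF_cl hF (frontier_subset_closure hw)
      simp only [_root_.lv, a.out w (hA.nf hw)]
      have : |β * (F w).im| ≤ 1 * τ := by rw [abs_mul]; gcongr
      linarith [le_abs_self (β * (F w).im)]) (C := C) (fun w hw => by linarith [hC w hw]) z hz
  simp only [_root_.lv] at this
  linarith

theorem rkc_pc {F h : ℂ → ℂ} {τ : ℝ} (hF : Lift F) (hτ : 0 < τ) (a : IsH F τ h) {α β : ℝ}
    (hαβ : α ≠ 0 ∨ β ≠ 0) {z0 : ℂ} (hz0 : z0 ∈ AF F τ) :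
    IsPreconnected {z | lv α β h z0 < lv α β h z} := by
  set c := lv α β h z0 with hc
  set P := {z | c < lv α β h z} with hP
  have oP : IsOpen P := isOpen_lt continuous_const (lv_cont a.c)
  have hA := AF_reg hF τ
  obtain ⟨R, hR0, hR⟩ := AF_strip hF τ
  have key : ∀ z ∈ P, ∃ w ∈ connectedComponentIn P z, w ∉ AF F τ := by
    intro z hz
    by_contra! hcon
    have oC : IsOpen (connectedComponentIn P z) := oP.connectedComponentIn
    obtain ⟨C, hC⟩ := a.growth hF α β c R
    have := maxP oC (R := R) (fun w hw => hR w (hcon w hw)) (v := fun z => lv α β h z + -c)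
      ((lv_cont a.c).add continuous_const)
      (((HarmonicOnNhd.subM hA.o (a.lv α β)).mono hcon).add (SubM.const _ _) (lv_cont a.c) continuous_const)
      (fun w hw => by
        by_contra! hlt
        have hwP : w ∈ P := show c < _ by linarith
        rw [oC.frontier_eq] at hw
        obtain ⟨y, hy1, hy2⟩ := mem_closure_iff.1 hw.1 _ (oP.connectedComponentIn (x := w))
          (mem_connectedComponentIn hwP)
        have e1 := connectedComponentIn_eq hy1
        have e2 := connectedComponentIn_eq hy2
        exact hw.2 (by rw [e2, ← e1]; exact mem_connectedComponentIn hwP))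
      (C := C) (fun w hw => by linarith [hC w hw]) z (mem_connectedComponentIn hz)
    have : c < lv α β h z := hz
    linarith
  let e := hF.hom.homeomorph F
  have he : ∀ w, F (e.symm w) = w := fun w => e.apply_symm_apply w
  have lin : ∀ w, lv α β id w = α * w.re + β * w.im := fun w => rfl
  have cv : ∀ s : ℝ, IsPreconnected {w : ℂ | τ ≤ s * w.im ∧ c < α * w.re + β * w.im} := fun s => by
    refine Convex.isPreconnected fun x hx y hy p q hp hq hpq => ?_
    simp only [Set.mem_ofPred_eq, add_re, add_im, Complex.real_smul, mul_re,
      mul_im, ofReal_re, ofReal_im, zero_mul, sub_zero, add_zero] at hx hy ⊢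
    obtain rfl : p = 1 - q := by linarith
    refine ⟨by nlinarith, ?_⟩
    rcases eq_or_lt_of_le hq with rfl | hq
    · simpa using hx.2
    · nlinarith
  obtain ⟨K, hK, hK1, hK2⟩ : ∃ K : Set ℂ, IsPreconnected K ∧
      (∀ w : ℂ, τ ≤ |w.im| → c < α * w.re + β * w.im → w ∈ K) ∧
      ∀ w ∈ K, c < lv α β h (e.symm w) := by
    have out : ∀ w : ℂ, τ ≤ |w.im| → lv α β h (e.symm w) = α * w.re + β * w.im := fun w hw => by
      simp only [lv]
      rw [a.out _ (by simp only [AF, Set.mem_ofPred_eq, not_lt, he]; exact hw), he]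
    by_cases hα : α = 0
    · have hβ : β ≠ 0 := by simpa [hα] using hαβ
      obtain ⟨s, hs, hsβ⟩ : ∃ s : ℝ, |s| = 1 ∧ s * |β| = β := by
        rcases abs_choice β with h | h
        · exact ⟨1, by simp, by linarith⟩
        · exact ⟨-1, by simp, by rw [h]; ring⟩
      have h1 := a.im_le hF (β := -s) (by simp [hs]) hz0
      have hβ' : 0 < |β| := abs_pos.2 hβ
      have hcc : -(|β| * τ) ≤ c := by
        have h2 := mul_le_mul_of_nonneg_left h1 hβ'.le
        rw [hc, lv, hα]; linear_combination h2 + (h z0).im * hsβ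
      have hss : s * s = 1 := by rw [← abs_mul_abs_self, hs, one_mul]
      refine ⟨_, cv s, fun w h1 h2 => ⟨?_, h2⟩, fun w hw => ?_⟩
      · have h3 : |s * w.im| = |w.im| := by rw [abs_mul, hs, one_mul]
        have h4 : -(|β| * τ) < |β| * (s * w.im) := by
          rw [hα] at h2
          calc _ ≤ c := hcc
            _ < _ := h2
            _ = _ := by nth_rw 1 [← hsβ]; ring
        have h5 : -τ < s * w.im := by
          have : |β| * (-τ) < |β| * (s * w.im) := by linarith
          exact lt_of_mul_lt_mul_left this hβ'.le
        rw [← h3] at h1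
        rcases le_abs.1 h1 with h | h
        · exact h
        · linarith
      · have h3 : |s * w.im| = |w.im| := by rw [abs_mul, hs, one_mul]
        rw [out w (by rw [← h3]; exact hw.1.trans (le_abs_self _))]; exact hw.2
    · obtain ⟨C, hC⟩ := a.bd
      set B := |c| + |β| * τ + (|α| + |β|) * |C| + 1 with hB
      have hx0 : α * (B / α) = B := by field_simp
      set x0 := B / α
      have hy : ∀ y : ℝ, |y| ≤ τ → -(|β| * τ) ≤ β * y := fun y hy => by
        have : |β * y| ≤ |β| * τ := by rw [abs_mul]; gcongr
        linarith [neg_abs_le (β * y)]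
      have hL : IsPreconnected ((fun y : ℝ => (⟨x0, y⟩ : ℂ)) '' Set.Icc (-τ) τ) := by
        refine isPreconnected_Icc.image _ ?_
        have : Continuous fun y : ℝ => Complex.equivRealProdCLM.symm (x0, y) := by fun_prop
        exact this.continuousOn
      have hpos : 0 ≤ (|α| + |β|) * |C| := by positivity
      have m1 : (⟨x0, τ⟩ : ℂ) ∈ {w : ℂ | τ ≤ 1 * w.im ∧ c < α * w.re + β * w.im} := by
        refine ⟨by simp, ?_⟩
        simp only [hx0]; linarith [hy τ (abs_of_pos hτ).le, le_abs_self c]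
      have m2 : (⟨x0, -τ⟩ : ℂ) ∈ {w : ℂ | τ ≤ (-1) * w.im ∧ c < α * w.re + β * w.im} := by
        refine ⟨by simp, ?_⟩
        simp only [hx0]; linarith [hy (-τ) (by rw [abs_neg]; exact (abs_of_pos hτ).le), le_abs_self c]
      have m3 : (⟨x0, τ⟩ : ℂ) ∈ (fun y : ℝ => (⟨x0, y⟩ : ℂ)) '' Set.Icc (-τ) τ := ⟨τ, ⟨by linarith, le_rfl⟩, rfl⟩
      have m4 : (⟨x0, -τ⟩ : ℂ) ∈ (fun y : ℝ => (⟨x0, y⟩ : ℂ)) '' Set.Icc (-τ) τ := ⟨-τ, ⟨le_rfl, by linarith⟩, rfl⟩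
      refine ⟨_, ((cv 1).union _ m1 m3 hL).union _ (Or.inr m4) m2 (cv (-1)), fun w h1 h2 => ?_, fun w hw => ?_⟩
      · rcases le_abs.1 h1 with h | h
        · exact Or.inl (Or.inl ⟨by linarith, h2⟩)
        · exact Or.inr ⟨by linarith, h2⟩
      · rcases hw with (hw | ⟨y, hy', rfl⟩) | hw
        · rw [out w (le_abs.2 (Or.inl (by linarith [hw.1])))]; exact hw.2
        · have h1 := (abs_le.1 (lv_sub α β h F (e.symm ⟨x0, y⟩))).1
          have h2 : lv α β F (e.symm ⟨x0, y⟩) = B + β * y := by simp only [lv, he, hx0]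
          have h3 := hy y (abs_le.2 hy')
          have h4 : (|α| + |β|) * ‖h (e.symm ⟨x0, y⟩) - F (e.symm ⟨x0, y⟩)‖ ≤ (|α| + |β|) * |C| := by
            gcongr; exact (hC _).trans (le_abs_self _)
          linarith [le_abs_self c]
        · rw [out w (le_abs.2 (Or.inr (by linarith [hw.1])))]; exact hw.2
  have hK' : IsPreconnected (e.symm '' K) := hK.image _ e.symm.continuous.continuousOn
  have hKP : e.symm '' K ⊆ P := by rintro _ ⟨w, hw, rfl⟩; exact hK2 w hw
  have hKm : ∀ z ∈ P, z ∉ AF F τ → z ∈ e.symm '' K := fun z hz hzA => by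
    refine ⟨F z, hK1 _ (not_lt.1 hzA) ?_, e.symm_apply_apply z⟩
    have : c < lv α β h z := hz
    rwa [lv, a.out z hzA] at this
  rcases P.eq_empty_or_nonempty with hem | ⟨z1, hz1⟩
  · rw [hem]; exact isPreconnected_empty
  obtain ⟨k0, hk0, hk0A⟩ := key z1 hz1
  have hk0K := hKm k0 (connectedComponentIn_subset _ _ hk0) hk0A
  refine isPreconnected_of_forall k0 fun y hy => ?_
  obtain ⟨k, hk, hkA⟩ := key y hy
  have hkK := hKm k (connectedComponentIn_subset _ _ hk) hkA
  exact ⟨_, Set.union_subset (connectedComponentIn_subset _ _) hKP, Or.inr hk0K,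
    Or.inl (mem_connectedComponentIn hy),
    (isPreconnected_connectedComponentIn (x := y) (F := P)).union k hk hkK hK'⟩

lemma AF_pc {F : ℂ → ℂ} (hF : Lift F) (τ : ℝ) : IsPreconnected (AF F τ) := by
  let e := hF.hom.homeomorph F
  have : AF F τ = e.symm '' {w : ℂ | |w.im| < τ} := by
    rw [e.symm.image_eq_preimage_symm]; rfl
  rw [this]
  refine IsPreconnected.image (Convex.isPreconnected ?_) _ e.symm.continuous.continuousOn
  have : {w : ℂ | |w.im| < τ} = imLm ⁻¹' Set.Ioo (-τ) τ := by
    ext w; simp [abs_lt]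
  rw [this]
  exact (convex_Ioo (-τ) τ).linear_preimage imLm

lemma lv_nc {F h : ℂ → ℂ} {τ : ℝ} (hF : Lift F) (hτ : 0 < τ) (a : IsH F τ h) {α β : ℝ}
    (hαβ : α ≠ 0 ∨ β ≠ 0) {z0 : ℂ} (hz0 : z0 ∈ AF F τ) :
    ¬ ∀ᶠ z in nhds z0, lv α β h z = lv α β h z0 := by
  intro hcon
  set c := lv α β h z0
  have h1 : AnalyticOnNhd ℝ (lv α β h) (AF F τ) := fun z hz => HarmonicAt.analyticAt (a.lv α β z hz)
  have h2 := h1.eqOn_of_preconnected_of_eventuallyEq (g := fun _ => c) analyticOnNhd_const (AF_pc hF τ) hz0 hcon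
  let e := hF.hom.homeomorph F
  have he : ∀ w, F (e.symm w) = w := fun w => e.apply_symm_apply w
  have h3 : ∀ x y : ℝ, |y| ≤ τ → lv α β h (e.symm ⟨x, y⟩) = c := fun x y hy => by
    have cc : Continuous fun y : ℝ => lv α β h (e.symm (Complex.equivRealProdCLM.symm (x, y))) := by
      refine (lv_cont a.c).comp (e.symm.continuous.comp ?_); fun_prop
    have h4 : Set.Ioo (-τ) τ ⊆ {y | lv α β h (e.symm (Complex.equivRealProdCLM.symm (x, y))) = c} :=
      fun y hy => h2 (by simp only [AF, Set.mem_ofPred_eq, he]; exact abs_lt.2 hy)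
    have h5 := closure_minimal h4 (isClosed_eq cc continuous_const)
    rw [closure_Ioo (by linarith)] at h5
    exact h5 (abs_le.1 hy)
  have h6 : ∀ x y : ℝ, |y| = τ → α * x + β * y = c := fun x y hy => by
    rw [← h3 x y hy.le, lv, a.out _ (by simp only [AF, Set.mem_ofPred_eq, he, hy]; simp), he]
  have e1 := h6 0 τ (abs_of_pos hτ)
  have e2 := h6 1 τ (abs_of_pos hτ)
  have e3 := h6 0 (-τ) (by rw [abs_neg]; exact abs_of_pos hτ)
  have hα : α = 0 := by linarith
  have : β * τ = 0 := by linarith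
  rcases mul_eq_zero.1 this with h | h
  · simp [hα, h] at hαβ
  · linarith

theorem rkc {F h : ℂ → ℂ} {τ : ℝ} (hF : Lift F) (hτ : 0 < τ) (a : IsH F τ h) {α β : ℝ}
    (hαβ : α ≠ 0 ∨ β ≠ 0) {z0 : ℂ} (hz0 : z0 ∈ AF F τ) {G : ℂ → ℂ} (hG : AnalyticAt ℂ G z0)
    (hre : ∀ᶠ z in nhds z0, lv α β h z = (G z).re) : deriv G z0 ≠ 0 := by
  intro hd
  set c := lv α β h z0 with hc
  have hG' : AnalyticAt ℂ (fun z => G z - G z0) z0 := hG.sub analyticAt_const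
  obtain ⟨n, g, hg, hg0, hgn⟩ := hG'.exists_eventuallyEq_pow_smul_nonzero_iff.2 fun hcon =>
    lv_nc hF hτ a hαβ hz0 (by
      filter_upwards [hcon, hre] with z h1 h2
      rw [h2, sub_eq_zero.1 h1]; exact hre.self_of_nhds.symm)
  have hn0 : n ≠ 0 := by
    rintro rfl
    have := hgn.self_of_nhds
    simp at this; exact hg0 this.symm
  have hn1 : n ≠ 1 := by
    rintro rfl
    have h1 : HasDerivAt (fun z => (z - z0) ^ 1 • g z) (g z0) z0 := by
      have := ((hasDerivAt_id' z0).sub_const z0).fun_mul hg.differentiableAt.hasDerivAt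
      simpa using this
    have h2 := (hG.differentiableAt.hasDerivAt.sub_const (G z0)).congr_of_eventuallyEq
      (Filter.EventuallyEq.symm hgn)
    rw [hd] at h2
    exact hg0 (h1.unique h2)
  have hn2 : 2 ≤ n := by omega
  obtain ⟨u0, hu0⟩ : ∃ u0 : ℂ, u0 ^ n = (g z0)⁻¹ := by
    obtain ⟨x, hx⟩ := IsAlgClosed.exists_pow_nat_eq (g z0)⁻¹ (n := n) (by omega)
    exact ⟨x, hx⟩
  have hu : u0 ≠ 0 := by
    rintro rfl
    rw [zero_pow hn0] at hu0
    exact inv_ne_zero hg0 hu0.symm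
  have ev : ∀ᶠ z in nhds z0, lv α β h z - c = ((z - z0) ^ n * g z).re ∧ 0 < (u0 ^ n * g z).re := by
    have hcg : ContinuousAt (fun z => (u0 ^ n * g z).re) z0 :=
      continuous_re.continuousAt.comp (continuousAt_const.mul hg.continuousAt)
    have h0 : 0 < (u0 ^ n * g z0).re := by rw [hu0, inv_mul_cancel₀ hg0]; simp
    filter_upwards [hgn, hre, hcg.eventually (lt_mem_nhds h0)] with z h1 h2 h3
    refine ⟨?_, h3⟩
    rw [hc, h2, hre.self_of_nhds, ← sub_re, h1]; rfl
  obtain ⟨ε, hε, hb⟩ := Metric.eventually_nhds_iff_ball.1 ev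
  set ρ0 := ε / (2 * ‖u0‖) with hρ0
  have hun : 0 < ‖u0‖ := norm_pos_iff.2 hu
  have hρ : 0 < ρ0 := by positivity
  have ray : ∀ ρ : ℝ, 0 < ρ → ρ ≤ ρ0 → ∀ θ s : ℝ, Complex.exp ((θ : ℝ) * Complex.I) ^ n = (s : ℝ) →
      ∃ k : ℝ, 0 < k ∧ lv α β h (z0 + u0 * ((ρ : ℂ) * Complex.exp ((θ : ℝ) * Complex.I))) - c = s * k := by
    intro ρ h1 h2 θ s hs
    have hm : z0 + u0 * ((ρ : ℂ) * Complex.exp ((θ : ℝ) * Complex.I)) ∈ ball z0 ε := by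
      rw [mem_ball, dist_eq_norm, add_sub_cancel_left, norm_mul, norm_mul, norm_exp_ofReal_mul_I,
        norm_real, Real.norm_of_nonneg h1.le, mul_one]
      calc ‖u0‖ * ρ ≤ ‖u0‖ * ρ0 := by gcongr
        _ = ε / 2 := by rw [hρ0]; field_simp
        _ < ε := by linarith
    obtain ⟨h3, h4⟩ := hb _ hm
    refine ⟨ρ ^ n * (u0 ^ n * g (z0 + u0 * ((ρ : ℂ) * Complex.exp ((θ : ℝ) * Complex.I)))).re,
      mul_pos (pow_pos h1 n) h4, h3.trans ?_⟩
    · rw [add_sub_cancel_left, mul_pow, mul_pow, hs]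
      rw [show u0 ^ n * ((ρ:ℂ) ^ n * (s:ℂ)) * g (z0 + u0 * ((ρ : ℂ) * Complex.exp ((θ : ℝ) * Complex.I)))
        = ((s * ρ ^ n : ℝ) : ℂ) * (u0 ^ n * g (z0 + u0 * ((ρ : ℂ) * Complex.exp ((θ : ℝ) * Complex.I)))) by
        push_cast; ring, re_ofReal_mul]
      ring
  have hnn : (n : ℂ) ≠ 0 := by exact_mod_cast hn0
  have hex : ∀ m : ℤ, Complex.exp (((m * (pi / n) : ℝ)) * Complex.I) ^ n = (((-1) ^ m : ℝ) : ℂ) := by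
    intro m
    rw [← Complex.exp_nat_mul]
    push_cast
    rw [show (n:ℂ) * (m * (pi / n) * Complex.I) = m * (pi * Complex.I) by field_simp,
      Complex.exp_int_mul, exp_pi_mul_I]
  let φ : ℂ ≃ₜ ℂ := (Homeomorph.mulLeft₀ u0 hu).trans (Homeomorph.addLeft z0)
  have hφ : ∀ x, φ x = z0 + u0 * x := fun x => rfl
  have im : ∀ S, φ ⁻¹' S = φ.symm '' S := fun S => (φ.symm.image_eq_preimage_symm S).symm
  have pcP := rkc_pc hF hτ a hαβ hz0
  have pcN := rkc_pc hF hτ a (α := -α) (β := -β) (by simpa using hαβ) hz0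
  have neg : ∀ z, lv (-α) (-β) h z = - lv α β h z := fun z => by simp [lv]; ring
  simp only [neg, neg_lt_neg_iff] at pcN
  refine no_saddle (P := φ ⁻¹' {z | c < lv α β h z}) (N := φ ⁻¹' {z | lv α β h z < c})
    (by rw [im]; exact pcP.image _ φ.symm.continuous.continuousOn)
    (by rw [im]; exact pcN.image _ φ.symm.continuous.continuousOn)
    ((isOpen_lt continuous_const (lv_cont a.c)).preimage φ.continuous)
    ((isOpen_lt (lv_cont a.c) continuous_const).preimage φ.continuous)
    (Set.disjoint_left.2 fun x h1 h2 => lt_asymm (show c < lv α β h (φ x) from h1) h2)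
    (by simp [hφ, hc]) (by simp [hφ, hc]) hn2 hρ ?_ ?_ ?_ ?_
  · intro ρ h1 h2
    obtain ⟨k, hk, he⟩ := ray ρ h1 h2 _ _ (hex 0)
    simp at he
    simp only [Set.mem_preimage, hφ, Set.mem_ofPred_eq]; linarith
  · intro ρ h1 h2
    obtain ⟨k, hk, he⟩ := ray ρ h1 h2 _ _ (hex 2)
    norm_num at he
    simp only [Set.mem_preimage, hφ, Set.mem_ofPred_eq]; push_cast; linarith
  · intro ρ h1 h2
    obtain ⟨k, hk, he⟩ := ray ρ h1 h2 _ _ (hex 1)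
    norm_num at he
    simp only [Set.mem_preimage, hφ, Set.mem_ofPred_eq]; push_cast; linarith
  · intro ρ h1 h2
    have hx := hex (-1)
    rw [show (((-1 : ℤ) : ℝ)) * (pi / n) = -(pi / n) by push_cast; ring] at hx
    obtain ⟨k, hk, he⟩ := ray ρ h1 h2 _ _ hx
    rw [show (-1 : ℝ) ^ (-1 : ℤ) = -1 by norm_num] at he
    simp only [Set.mem_preimage, hφ, Set.mem_ofPred_eq]; linarith

theorem IsH.strict {F h : ℂ → ℂ} {τ : ℝ} (hF : Lift F) (hτ : 0 < τ) (a : IsH F τ h) {z0 : ℂ}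
    (hz0 : z0 ∈ AF F τ) : ∃ L : ℂ ≃L[ℝ] ℂ, HasStrictFDerivAt h (L : ℂ →L[ℝ] ℂ) z0 := by
  obtain ⟨e1, he1, G1, hG1, h1⟩ := loc_an (a.hr z0 hz0)
  obtain ⟨e2, he2, G2, hG2, h2⟩ := loc_an (a.hi z0 hz0)
  have a1 := hG1 z0 (mem_ball_self he1)
  have a2 := hG2 z0 (mem_ball_self he2)
  have d1 := a1.hasStrictDerivAt.hasStrictFDerivAt.restrictScalars ℝ
  have d2 := a2.hasStrictDerivAt.hasStrictFDerivAt.restrictScalars ℝ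
  have s1 := (reCLM.hasStrictFDerivAt (x := G1 z0)).comp z0 d1
  have s2 := (reCLM.hasStrictFDerivAt (x := G2 z0)).comp z0 d2
  have s3 := (Complex.equivRealProdCLM.symm.hasStrictFDerivAt (x := _)).comp z0 (s1.prodMk s2)
  have ev : (⇑Complex.equivRealProdCLM.symm ∘ fun x => ((reCLM ∘ G1) x, (reCLM ∘ G2) x))
      =ᶠ[nhds z0] h := by
    filter_upwards [ball_mem_nhds z0 he1, ball_mem_nhds z0 he2] with z m1 m2
    apply Complex.ext
    · simpa using (h1 z m1).symm
    · simpa using (h2 z m2).symm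
  have s4 := s3.congr_of_eventuallyEq ev
  set L := (Complex.equivRealProdCLM.symm : ℝ × ℝ →L[ℝ] ℂ).comp
    ((reCLM.comp ((ContinuousLinearMap.toSpanSingleton ℂ (deriv G1 z0)).restrictScalars ℝ)).prod
     (reCLM.comp ((ContinuousLinearMap.toSpanSingleton ℂ (deriv G2 z0)).restrictScalars ℝ))) with hL
  have hLa : ∀ w, L w = ⟨(w * deriv G1 z0).re, (w * deriv G2 z0).re⟩ := fun w => by
    simp [hL, Complex.ext_iff]
  have key : ∀ α β : ℝ, (α:ℂ) * deriv G1 z0 + β * deriv G2 z0 = 0 → α = 0 ∧ β = 0 := by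
    intro α β hab
    by_contra hne
    have hαβ : α ≠ 0 ∨ β ≠ 0 := by tauto
    refine rkc hF hτ a hαβ hz0 (G := fun z => α * G1 z + β * G2 z) (by fun_prop) ?_ ?_
    · filter_upwards [ball_mem_nhds z0 he1, ball_mem_nhds z0 he2] with z m1 m2
      simp [_root_.lv, h1 z m1, h2 z m2]
    · have := (a1.differentiableAt.hasDerivAt.const_mul (α:ℂ)).fun_add
        (a2.differentiableAt.hasDerivAt.const_mul (β:ℂ))
      rw [this.deriv, hab]
  have hinj : Function.Injective L := by
    rw [injective_iff_map_eq_zero]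
    intro w hw
    by_contra hw0
    rw [hLa, Complex.ext_iff] at hw
    simp only [zero_re, zero_im] at hw
    have h3 := key (w * deriv G2 z0).im (-(w * deriv G1 z0).im) (by
      apply mul_left_cancel₀ hw0
      apply Complex.ext
      · simp at hw ⊢; linear_combination (w.re * (deriv G2 z0).im + w.im * (deriv G2 z0).re) * hw.1 - (w.re * (deriv G1 z0).im + w.im * (deriv G1 z0).re) * hw.2
      · simp; ring)
    have h4 : w * deriv G1 z0 = 0 := Complex.ext hw.1 (neg_eq_zero.1 h3.2)
    have h5 := key 1 0 (by simpa [hw0] using h4)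
    exact one_ne_zero h5.1
  have hLe : (((LinearEquiv.ofInjectiveEndo (L : ℂ →ₗ[ℝ] ℂ) hinj).toContinuousLinearEquiv : ℂ ≃L[ℝ] ℂ) :
      ℂ →L[ℝ] ℂ) = L := by ext1; rfl
  refine ⟨(LinearEquiv.ofInjectiveEndo (L : ℂ →ₗ[ℝ] ℂ) hinj).toContinuousLinearEquiv, ?_⟩
  rw [hLe]; exact s4

theorem IsH.mem {F h : ℂ → ℂ} {τ : ℝ} (hF : Lift F) (hτ : 0 < τ) (a : IsH F τ h) {z : ℂ} :
    |(h z).im| < τ ↔ z ∈ AF F τ := by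
  constructor
  · intro hz
    by_contra hA
    rw [a.out z hA] at hz; exact hA hz
  · intro hz
    obtain ⟨L, hL⟩ := a.strict hF hτ hz
    have h1 : h '' AF F τ ∈ nhds (h z) := by
      rw [← hL.map_nhds_eq_of_equiv]; exact Filter.image_mem_map ((AF_open hF.c τ).mem_nhds hz)
    have h2 : h '' AF F τ ⊆ {w | |w.im| ≤ τ} := by
      rintro _ ⟨w, hw, rfl⟩
      have e1 := a.im_le hF (β := 1) (by simp) hw
      have e2 := a.im_le hF (β := -1) (by simp) hw
      rw [one_mul] at e1; rw [neg_one_mul] at e2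
      exact abs_le.2 ⟨neg_le.1 e2, e1⟩
    obtain ⟨ε, hε, hb⟩ := Metric.mem_nhds_iff.1 (Filter.mem_of_superset h1 h2)
    have e1 := hb (show h z + ((ε/2 : ℝ) : ℂ) * Complex.I ∈ ball (h z) ε by
      rw [mem_ball, dist_eq_norm, add_sub_cancel_left]; simp [abs_of_pos hε]; linarith)
    have e2 := hb (show h z - ((ε/2 : ℝ) : ℂ) * Complex.I ∈ ball (h z) ε by
      rw [mem_ball, dist_eq_norm, sub_sub_cancel_left]; simp [abs_of_pos hε]; linarith)
    have e1 := (abs_le.1 (show |_| ≤ τ from e1)).2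
    have e2 := (abs_le.1 (show |_| ≤ τ from e2)).1
    simp at e1 e2
    exact abs_lt.2 ⟨by linarith, by linarith⟩

lemma IsH.proper {F h : ℂ → ℂ} {τ : ℝ} (hF : Lift F) (a : IsH F τ h) : IsProperMap h := by
  rw [isProperMap_iff_tendsto_cocompact]
  refine ⟨a.c, ?_⟩
  have h1 := (hF.hom.homeomorph F).isClosedEmbedding.tendsto_cocompact
  rw [← Metric.cobounded_eq_cocompact] at h1 ⊢
  rw [← tendsto_norm_atTop_iff_cobounded] at h1 ⊢
  obtain ⟨C, hC⟩ := a.bd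
  refine Filter.tendsto_atTop_mono (fun z => ?_) (Filter.tendsto_atTop_add_const_right _ (-C) h1)
  have := norm_sub_norm_le (F z) (h z)
  rw [norm_sub_rev] at this
  have h2 := hC z
  show ‖F z‖ + -C ≤ ‖h z‖
  linarith

theorem IsH.homeo {F h : ℂ → ℂ} {τ : ℝ} (hF : Lift F) (hτ : 0 < τ) (a : IsH F τ h) : IsHomeomorph h := by
  have hp := a.proper hF
  let S : Set ℂ := {w | |w.im| < τ}
  have hS : h ⁻¹' S = AF F τ := by ext z; exact a.mem hF hτ
  have hSo : IsOpen S := isOpen_lt continuous_im.abs continuous_const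
  have hSc : Convex ℝ S := by
    have : S = imLm ⁻¹' Set.Ioo (-τ) τ := by
      ext w; simp [S, abs_lt]
    rw [this]
    exact (convex_Ioo (-τ) τ).linear_preimage imLm
  have loc : IsLocalHomeomorphOn h (h ⁻¹' S) := fun z hz => by
    obtain ⟨L, hL⟩ := a.strict hF hτ ((a.mem hF hτ).1 hz)
    exact ⟨hL.toOpenPartialHomeomorph h, hL.mem_toOpenPartialHomeomorph_source, rfl⟩
  have fin : ∀ x ∈ S, (h ⁻¹' {x}).Finite := by
    intro x hx
    refine (hp.isCompact_preimage isCompact_singleton).finite ?_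
    rw [isDiscrete_iff_forall_mem_exists_isOpen]
    intro z hz
    obtain ⟨φ, hφ, he⟩ := loc z (by rw [Set.mem_preimage, show h z = x from hz]; exact hx)
    refine ⟨φ.source, φ.open_source, ?_⟩
    ext w
    constructor
    · rintro ⟨h1, h2⟩
      refine φ.injOn h1 hφ ?_
      rw [← he, show h w = x from h2, show h z = x from hz]
    · rintro rfl; exact ⟨hφ, hz⟩
  have cov := hp.isClosedMap.isCoveringMapOn_of_isLocalHomeomorphOn fin loc
  have cov' : IsCoveringMap (S.restrictPreimage h) := fun x =>
    ((cov x.1 x.2).restrictPreimage (s := S) x.2).to_isEvenlyCovered_preimage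
  have hS0 : (0:ℂ) ∈ S := by simp [S, hτ]
  haveI : ContractibleSpace S := hSc.contractibleSpace ⟨0, hS0⟩
  haveI : LocallyPathConnectedSpace S := hSo.locallyPathConnectedSpace
  haveI : PreconnectedSpace (h ⁻¹' S) := by
    rw [← isPreconnected_iff_preconnectedSpace, hS]; exact AF_pc hF τ
  have lift : ∀ e0 : h ⁻¹' S, ∃ s : C(S, h ⁻¹' S), s (S.restrictPreimage h e0) = e0 ∧
      S.restrictPreimage h ∘ s = id := fun e0 => by
    obtain ⟨s, ⟨h1, h2⟩, -⟩ := cov'.existsUnique_continuousMap_lifts (ContinuousMap.id S)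
      (S.restrictPreimage h e0) e0 rfl
    exact ⟨s, h1, h2⟩
  have inj : Function.Injective (S.restrictPreimage h) := by
    intro x y hxy
    obtain ⟨s, h1, h2⟩ := lift x
    have : (s ∘ S.restrictPreimage h) = id := cov'.eq_of_comp_eq
      (s.continuous.comp cov'.continuous) continuous_id (by
        rw [← Function.comp_assoc, h2]; rfl) x h1
    have e1 := congrFun this y
    simp only [Function.comp_apply, id] at e1
    rw [← e1, ← hxy, h1]
  rw [isHomeomorph_iff_continuous_isClosedMap_bijective]
  refine ⟨a.c, hp.isClosedMap, ?_, ?_⟩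
  · intro x y hxy
    by_cases hx : h x ∈ S
    · have := @inj ⟨x, hx⟩ ⟨y, by rw [Set.mem_preimage, ← hxy]; exact hx⟩ (Subtype.ext hxy)
      exact congrArg Subtype.val this
    · have hy : h y ∉ S := by rwa [← hxy]
      apply hF.hom.injective
      rw [← a.out x fun hA => hx ((a.mem hF hτ).2 hA), ← a.out y fun hA => hy ((a.mem hF hτ).2 hA), hxy]
  · intro w
    obtain ⟨z, hz⟩ := hF.hom.surjective w
    by_cases hw : w ∈ S
    · obtain ⟨z0, hz0⟩ := hF.hom.surjective 0
      have hz0A : z0 ∈ h ⁻¹' S := by rw [hS]; simp [AF, hz0, hτ]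
      obtain ⟨s, h1, h2⟩ := lift ⟨z0, hz0A⟩
      exact ⟨s ⟨w, hw⟩, congrArg Subtype.val (congrFun h2 ⟨w, hw⟩)⟩
    · refine ⟨z, ?_⟩
      rw [a.out z (fun h => hw (by rw [← hz]; exact h)), hz]

theorem IsH.lift {F h : ℂ → ℂ} {τ : ℝ} (hF : Lift F) (hτ : 0 < τ) (a : IsH F τ h) : Lift h := by
  refine ⟨a.homeo hF hτ, a.sg hF, fun T => ?_⟩
  obtain ⟨S, hS⟩ := hF.up (max T τ)
  refine ⟨S, fun z hz => ?_⟩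
  have h1 := hS z hz
  rw [a.out z fun h => absurd ((le_max_right _ _).trans h1) (not_le.2 (abs_lt.1 h).2)]
  exact (le_max_left _ _).trans h1

structure Fam {X : Type*} [TopologicalSpace X] (F : X → ℂ → ℂ) : Prop where
  L : ∀ x, Lift (F x)
  c : Continuous fun p : X × ℂ => F p.1 p.2
  up : ∀ x (T : ℝ), ∃ S : ℝ, ∀ᶠ y in nhds x, ∀ z, S ≤ z.im → T ≤ (F y z).im

lemma fam_unif {X : Type*} [TopologicalSpace X] {F : X → ℂ → ℂ} (x0 : X)
    (cF : ∀ z, ContinuousAt (fun p : X × ℂ => F p.1 p.2) (x0, z)) (hs : ∀ x z, F x (sg z) = sg (F x z))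
    (R : ℝ) {ε : ℝ} (hε : 0 < ε) :
    ∀ᶠ x in nhds x0, ∀ z, |z.im| ≤ R → ‖F x z - F x0 z‖ ≤ ε := by
  have h := (strip_cpt 0 (2 * pi) R).eventually_forall_of_forall_eventually (x₀ := x0)
    (P := fun x z => ‖F x z - F x0 z‖ < ε) (fun z _ => by
      have h1 : ContinuousAt (fun p : X × ℂ => ‖F p.1 p.2 - F x0 p.2‖) (x0, z) := by
        have h2 : ContinuousAt (fun p : X × ℂ => F x0 p.2) (x0, z) :=
          ContinuousAt.comp (g := fun p : X × ℂ => F p.1 p.2) (f := fun p : X × ℂ => (x0, p.2)) (cF z)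
            (continuousAt_const.prodMk continuousAt_snd)
        exact ((cF z).sub h2).norm
      exact h1.eventually_lt continuousAt_const (by simpa using hε))
  filter_upwards [h] with x hx z hz
  obtain ⟨n, hn, hi⟩ := exists_shift z
  have e : ∀ y, F y (z + n * tp) = F y z + n * tp := fun y => by
    have := (sg_per (hs y)).int_mul n z
    linear_combination this
  have := hx _ ⟨hn.1, hn.2.le, by rw [hi]; exact hz⟩
  rw [e, e, add_sub_add_right_eq_sub] at this
  exact this.le

lemma Fam.unif {X : Type*} [TopologicalSpace X] {F : X → ℂ → ℂ} (hF : Fam F) (x0 : X) (R : ℝ) {ε : ℝ}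
    (hε : 0 < ε) : ∀ᶠ x in nhds x0, ∀ z, |z.im| ≤ R → ‖F x z - F x0 z‖ ≤ ε :=
  fam_unif x0 (fun _ => hF.c.continuousAt) (fun x => (hF.L x).sg) R hε

lemma cmpH {F F0 h h0 : ℂ → ℂ} {τ τ0 R k : ℝ} (hF : Lift F) (hF0 : Lift F0) (a : IsH F τ h)
    (a0 : IsH F0 τ0 h0) (hR : ∀ z ∈ AF F τ, |z.im| ≤ R)
    (hk : ∀ z, |z.im| ≤ R → z ∉ AF F τ ∩ AF F0 τ0 → ‖h z - h0 z‖ ≤ k) (z : ℂ) (hz : |z.im| ≤ R) :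
    ‖h z - h0 z‖ ≤ 2 * k := by
  obtain ⟨C1, h1⟩ := a.bd
  obtain ⟨C2, h2⟩ := a0.bd
  obtain ⟨C3, -, h3⟩ := hF.bdd R
  obtain ⟨C4, -, h4⟩ := hF0.bdd R
  by_cases hW : z ∈ AF F τ ∩ AF F0 τ0
  swap
  · have := hk z hz hW
    linarith [norm_nonneg (h z - h0 z)]
  have hA := AF_reg hF τ
  have hA0 := AF_reg hF0 τ0
  have key : ∀ α β : ℝ, |α| + |β| ≤ 1 → _root_.lv α β h z - _root_.lv α β h0 z ≤ k := by
    intro α β hαβ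
    have oW := hA.o.inter hA0.o
    have cv : Continuous fun z => _root_.lv α β h z - _root_.lv α β h0 z := (lv_cont a.c).sub (lv_cont a0.c)
    have hn : ∀ z, _root_.lv α β h z - _root_.lv α β h0 z ≤ ‖h z - h0 z‖ := fun z => by
      have := (abs_le.1 (lv_sub α β h h0 z)).2
      nlinarith [norm_nonneg (h z - h0 z)]
    have := maxP oW (fun z hz => hR z hz.1)
      (v := fun z => (_root_.lv α β h z - _root_.lv α β h0 z) + -k) (cv.add continuous_const)
      ((HarmonicOnNhd.subM oW (((a.lv α β).mono Set.inter_subset_left).sub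
        ((a0.lv α β).mono Set.inter_subset_right))).add (SubM.const _ _) cv continuous_const)
      (fun w hw => by
        have hwR : |w.im| ≤ R :=
          closure_minimal (s := AF F τ ∩ AF F0 τ0) (t := {z : ℂ | |z.im| ≤ R}) (fun z hz => hR z hz.1)
            (isClosed_le continuous_im.abs continuous_const) (frontier_subset_closure hw)
        have hw' : w ∉ AF F τ ∩ AF F0 τ0 := by rw [oW.frontier_eq] at hw; exact hw.2
        linarith [hn w, hk w hwR hw']) (C := |C1| + |C2| + |C3| + |C4| + |k|) (fun w hw => by
        have : ‖h w - h0 w‖ ≤ C1 + C3 + (C4 + C2) := by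
          calc ‖h w - h0 w‖ = ‖((h w - F w) + (F w - w)) - ((F0 w - w) + (h0 w - F0 w))‖ := by congr 1; ring
            _ ≤ _ := (norm_sub_le _ _).trans (add_le_add
              ((norm_add_le _ _).trans (add_le_add (h1 w) (h3 w hw)))
              ((norm_add_le _ _).trans (add_le_add (h4 w hw) (h2 w))))
        have h5 := hn w
        have := le_abs_self C1; have := le_abs_self C2; have := le_abs_self C3; have := le_abs_self C4
        have := neg_abs_le k
        have : 0 ≤ (|C1| + |C2| + |C3| + |C4| + |k|) * |w.re| := by positivity
        linarith) z hW
    linarith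
  have k1 := key 1 0 (by simp)
  have k2 := key (-1) 0 (by simp)
  have k3 := key 0 1 (by simp)
  have k4 := key 0 (-1) (by simp)
  simp only [_root_.lv] at k1 k2 k3 k4
  refine (norm_le_abs_re_add_abs_im _).trans ?_
  rw [two_mul]
  refine add_le_add (abs_le.2 ⟨?_, ?_⟩) (abs_le.2 ⟨?_, ?_⟩) <;> simp <;> linarith

lemma Lift.inv_uc {F : ℂ → ℂ} (hF : Lift F) (R : ℝ) {δ : ℝ} (hδ : 0 < δ) :
    ∃ κ > 0, ∀ z, |z.im| ≤ R → ∀ v : ℂ, ‖v‖ ≤ κ → ∃ w, F w = F z + v ∧ ‖w - z‖ ≤ δ := by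
  set e := hF.hom.homeomorph F
  have he : ∀ z, F (e.symm z) = z := e.apply_symm_apply
  have hes : ∀ z, e.symm (F z) = z := e.symm_apply_apply
  have hs : ∀ z, e.symm (_root_.sg z) = _root_.sg (e.symm z) := fun z =>
    hF.hom.injective (by rw [he, hF.sg, he])
  obtain ⟨C, hC, hb⟩ := hF.bdd R
  obtain ⟨κ, hκ, h⟩ := per_uc (e.symm.continuous.sub continuous_id) (sg_per hs) (R + C + 1) (half_pos hδ)
  refine ⟨min κ (min 1 (δ / 2)), by positivity, fun z hz v hv => ⟨e.symm (F z + v), he _, ?_⟩⟩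
  have hv1 : ‖v‖ ≤ κ := hv.trans (min_le_left _ _)
  have hv2 : ‖v‖ ≤ 1 := hv.trans ((min_le_right _ _).trans (min_le_left _ _))
  have hv3 : ‖v‖ ≤ δ / 2 := hv.trans ((min_le_right _ _).trans (min_le_right _ _))
  have h0 : |(F z).im| ≤ R + C := by
    have h1 := (abs_im_le_norm _).trans (hb z hz)
    rw [sub_im] at h1
    have := abs_sub_abs_le_abs_sub (F z).im z.im
    linarith
  have h1 := h (F z + v) (F z) (by
    rw [add_im]
    have := abs_add_le (F z).im v.im
    linarith [abs_im_le_norm v]) (by linarith) (by simpa using hv1)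
  simp only [Pi.sub_apply, id_eq, hes] at h1
  calc ‖e.symm (F z + v) - z‖ = ‖(e.symm (F z + v) - (F z + v) - (z - F z)) + v‖ := by congr 1; ring
    _ ≤ _ := (norm_add_le _ _).trans (by linarith)

def hh (F : ℂ → ℂ) (τ : ℝ) : ℂ → ℂ := open Classical in if h : ∃ k, IsH F τ k then h.choose else F

lemma Lift.hh {F : ℂ → ℂ} (hF : Lift F) (τ : ℝ) : IsH F τ (hh F τ) := by
  obtain ⟨R, M, b⟩ := hF.bds τ
  have h : ∃ k, IsH F τ k := ⟨_, HF_isH hF b⟩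
  rw [_root_.hh, dif_pos h]
  exact h.choose_spec

lemma hh_np {F : ℂ → ℂ} (hF : Lift F) {τ : ℝ} (hτ : τ ≤ 0) : hh F τ = F := by
  funext z
  exact (hF.hh τ).out z (fun h => by
    have : |(F z).im| < τ := h
    linarith [abs_nonneg (F z).im])

lemma Lift.hhL {F : ℂ → ℂ} (hF : Lift F) (τ : ℝ) : Lift (_root_.hh F τ) := by
  rcases le_or_gt τ 0 with h | h
  · rw [hh_np hF h]; exact hF
  · exact (hF.hh τ).lift hF h

lemma Fam.up' {X : Type*} [TopologicalSpace X] {F : X → ℂ → ℂ} (hF : Fam F) (x : X) (T : ℝ) :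
    ∃ S : ℝ, 0 ≤ S ∧ ∀ᶠ y in nhds x, ∀ z, S ≤ |z.im| → T ≤ |(F y z).im| := by
  obtain ⟨S, hS⟩ := hF.up x T
  refine ⟨max S 0, le_max_right _ _, ?_⟩
  filter_upwards [hS] with y hS z hz
  rcases le_abs.1 ((le_max_left _ _).trans hz) with h1 | h1
  · exact (hS z h1).trans (le_abs_self _)
  · have := hS (sg z) (by rw [sg_im]; exact h1)
    rw [(hF.L y).sg, sg_im] at this
    exact this.trans (neg_le_abs _)

theorem Fam.hunif {X : Type*} [TopologicalSpace X] {F : X → ℂ → ℂ} (hF : Fam F) (x0 : X) (τ0 : ℝ) {ε : ℝ}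
    (hε : 0 < ε) : ∃ R, 0 ≤ R ∧ ∀ᶠ p : X × ℝ in nhds (x0, τ0), (∀ z ∈ AF (F p.1) p.2, |z.im| ≤ R) ∧
      ∀ z, |z.im| ≤ R → ‖hh (F p.1) p.2 z - hh (F x0) τ0 z‖ ≤ 30 * ε := by
  obtain ⟨R, hR0, hR⟩ := hF.up' x0 (τ0 + 1)
  have hF0 := hF.L x0
  obtain ⟨M0, hM0, hbd⟩ := hF0.bdd (R + 1)
  obtain ⟨r, hr, huc⟩ := gF_uc hF0 R hR0 (ε := ε / 3) (by positivity)
  obtain ⟨δ, hδ, hest⟩ := estH hε hr (M := M0 + 1) (by positivity)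
  obtain ⟨κ, hκ, hinv⟩ := hF0.inv_uc R (δ := min δ 1) (by positivity)
  set η := min (κ / 2) (min (ε / 3) 1) with hη
  have hη0 : 0 < η := by positivity
  have e1 : η ≤ κ / 2 := min_le_left _ _
  have e2 : η ≤ ε / 3 := (min_le_right _ _).trans (min_le_left _ _)
  have e3 : η ≤ 1 := (min_le_right _ _).trans (min_le_right _ _)
  refine ⟨R, hR0, ?_⟩
  have ev1 : ∀ᶠ τ : ℝ in nhds τ0, |τ - τ0| < η := by
    filter_upwards [Metric.ball_mem_nhds τ0 hη0] with t ht
    rwa [mem_ball, Real.dist_eq] at ht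
  have hbds : ∀ x τ, (∀ z, R ≤ |z.im| → τ0 + 1 ≤ |(F x z).im|) → (∀ z, |z.im| ≤ R + 1 → ‖F x z - F x0 z‖ ≤ η) →
      |τ - τ0| < η → Bds (F x) τ R (M0 + 1) ∧
      (∀ z w, ‖z - w‖ ≤ r → ‖gF (F x) R z - gF (F x) R w‖ ≤ ε) := by
    intro x τ h1 h2 h3
    refine ⟨⟨fun z hz => ?_, hR0, by positivity, fun z hz => ?_⟩, fun z w hzw => ?_⟩
    · by_contra! hc
      have := h1 z hc.le
      have hz : |(F x z).im| < τ := hz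
      linarith [le_abs_self (τ - τ0)]
    · calc ‖F x z - z‖ = ‖(F x0 z - z) + (F x z - F x0 z)‖ := by congr 1; ring
        _ ≤ _ := (norm_add_le _ _).trans (by linarith [hbd z hz, h2 z hz])
    · have a1 := huc z w hzw
      have a2 := h2 (clS (R + 1) z) (clS_im (by linarith) z)
      have a3 := h2 (clS (R + 1) w) (clS_im (by linarith) w)
      calc ‖gF (F x) R z - gF (F x) R w‖ = ‖(gF (F x0) R z - gF (F x0) R w)
            + (F x (clS (R + 1) z) - F x0 (clS (R + 1) z)) - (F x (clS (R + 1) w) - F x0 (clS (R + 1) w))‖ := by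
            congr 1; simp only [gF]; ring
        _ ≤ _ := (norm_sub_le _ _).trans (add_le_add (norm_add_le _ _) le_rfl)
        _ ≤ ε := by linarith
  have b0 := hbds x0 τ0 hR.self_of_nhds (fun z _ => by simpa using hη0.le) (by simpa using hη0)
  rw [nhds_prod_eq]
  filter_upwards [(hR.and (hF.unif x0 (R + 1) hη0)).prod_mk ev1]
  rintro ⟨x, τ⟩ ⟨⟨h1, h2⟩, h3⟩
  simp only at h1 h2 h3 ⊢
  have b := hbds x τ h1 h2 h3
  refine ⟨b.1.A, fun z hz => ?_⟩
  have h3' := abs_lt.1 h3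
  have h := cmpH (hF.L x) hF0 ((hF.L x).hh τ) (hF0.hh τ0) b.1.A (k := 15 * ε) (fun z hz hW => ?_) z hz
  · linarith
  have hFF : ‖F x z - F x0 z‖ ≤ ε := (h2 z (by linarith)).trans (by linarith)
  obtain ⟨w, hw1, hw2⟩ : ∃ w, |(F x0 w).im| = |(F x0 z).im| + 2 * η ∧ ‖w - z‖ ≤ min δ 1 := by
    have hn : ‖(2 * η : ℂ) * Complex.I‖ ≤ κ := by
      simp [abs_of_pos hη0]; linarith
    rcases le_total 0 (F x0 z).im with hs | hs
    · obtain ⟨w, hw, hw'⟩ := hinv z hz (2 * η * Complex.I) hn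
      refine ⟨w, ?_, hw'⟩
      rw [hw, abs_of_nonneg hs, abs_of_nonneg] <;> simp <;> positivity
    · obtain ⟨w, hw, hw'⟩ := hinv z hz (-(2 * η * Complex.I)) (by rwa [norm_neg])
      refine ⟨w, ?_, hw'⟩
      rw [hw, abs_of_nonpos hs, abs_of_nonpos] <;> simp <;> linarith
  have hwR : |w.im| ≤ R + 1 := by
    have := (abs_im_le_norm (w - z)).trans (hw2.trans (min_le_right _ _))
    rw [sub_im] at this
    linarith [abs_sub_abs_le_abs_sub w.im z.im]
  have him : ∀ y, |y.im| ≤ R + 1 → |(F x y).im| - |(F x0 y).im| ≤ η ∧ |(F x0 y).im| - |(F x y).im| ≤ η := by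
    intro y hy
    have := (abs_im_le_norm _).trans (h2 y hy)
    rw [sub_im] at this
    exact ⟨(abs_sub_abs_le_abs_sub _ _).trans this,
      (abs_sub_abs_le_abs_sub _ _).trans (by rwa [abs_sub_comm])⟩
  have iw := him w hwR
  have iz := him z (by linarith)
  have hd : ‖z - w‖ ≤ δ := by rw [norm_sub_rev]; exact hw2.trans (min_le_left _ _)
  have hzz : τ ≤ |(F x z).im| ∨ τ0 ≤ |(F x0 z).im| := by
    by_contra! hc
    exact hW ⟨hc.1, hc.2⟩
  have n1 : w ∉ AF (F x) τ := by
    refine not_lt.2 (show τ ≤ _ from ?_)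
    rcases hzz with hz | hz <;> linarith
  have n2 : w ∉ AF (F x0) τ0 := by
    refine not_lt.2 (show τ0 ≤ _ from ?_)
    rcases hzz with hz | hz <;> linarith
  have c1 := hest _ _ _ (hF.L x) b.1 b.2 _ ((hF.L x).hh τ) z w n1 hd
  have c2 := hest _ _ _ hF0 b0.1 b0.2 _ (hF0.hh τ0) z w n2 hd
  calc _ = ‖(hh (F x) τ z - F x z) + (F x z - F x0 z) - (hh (F x0) τ0 z - F x0 z)‖ := by congr 1; ring
    _ ≤ _ := (norm_sub_le _ _).trans (add_le_add (norm_add_le _ _) le_rfl)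
    _ ≤ _ := by linarith

theorem Fam.hh {X : Type*} [TopologicalSpace X] {F : X → ℂ → ℂ} (hF : Fam F) :
    Fam (fun p : X × ℝ => _root_.hh (F p.1) p.2) where
  L p := (hF.L p.1).hhL p.2
  c := by
    rw [continuous_iff_continuousAt]
    rintro ⟨⟨x0, τ0⟩, z0⟩
    rw [Metric.continuousAt_iff']
    intro ε hε
    obtain ⟨R, hR0, hR⟩ := hF.hunif x0 τ0 (ε := ε / 90) (by positivity)
    have ev1 : ∀ᶠ x in nhds x0, ∀ z, |z.im| ≤ |z0.im| + 1 → ‖F x z - F x0 z‖ ≤ ε / 3 := hF.unif x0 _ (by positivity)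
    have c0 : ∀ᶠ z in nhds z0, ‖_root_.hh (F x0) τ0 z - _root_.hh (F x0) τ0 z0‖ < ε / 2 := by
      have := Metric.continuousAt_iff'.1 (((hF.L x0).hh τ0).c.continuousAt (x := z0)) (ε / 2) (by positivity)
      simpa [dist_eq_norm] using this
    have c1 : ∀ᶠ z in nhds z0, |z.im| < |z0.im| + 1 :=
      (continuous_im.abs.continuousAt (x := z0)).eventually_lt continuousAt_const (by linarith)
    rw [nhds_prod_eq]
    have ev2 : ∀ᶠ p : X × ℝ in nhds (x0, τ0), ∀ z, |z.im| ≤ |z0.im| + 1 → ‖F p.1 z - F x0 z‖ ≤ ε / 3 :=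
      (continuous_fst.tendsto (x0, τ0)).eventually ev1
    filter_upwards [(hR.and ev2).prod_mk (c0.and c1)]
    rintro ⟨⟨x, τ⟩, z⟩ ⟨⟨⟨h1, h2⟩, h3⟩, h4, h5⟩
    simp only at h1 h2 h3 h4 h5 ⊢
    rw [dist_eq_norm]
    have key : ‖_root_.hh (F x) τ z - _root_.hh (F x0) τ0 z‖ ≤ ε / 3 := by
      by_cases hz : |z.im| ≤ R
      · linarith [h2 z hz]
      · rw [((hF.L x).hh τ).out z (fun h => hz (h1 z h)), ((hF.L x0).hh τ0).out z
          (fun h => hz (hR.self_of_nhds.1 z h))]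
        exact h3 z h5.le
    calc _ ≤ _ := norm_sub_le_norm_sub_add_norm_sub _ (_root_.hh (F x0) τ0 z) _
      _ < ε := by linarith
  up := by
    rintro ⟨x0, τ0⟩ T
    obtain ⟨R, hR0, hR⟩ := hF.hunif x0 τ0 (ε := 1) one_pos
    obtain ⟨S, hS⟩ := hF.up x0 T
    refine ⟨max S (R + 1), ?_⟩
    filter_upwards [hR, (continuous_fst.tendsto (x0, τ0)).eventually hS]
    rintro ⟨x, τ⟩ h1 h2 z hz
    simp only at h1 h2 ⊢
    rw [((hF.L x).hh τ).out z (fun h => by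
      have := h1.1 z h
      linarith [(le_max_right _ _).trans hz, le_abs_self z.im])]
    exact h2 z ((le_max_left _ _).trans hz)

def NP (F : ℂ → ℂ) : Prop := ∀ s : Set ℂ, volume s = 0 ↔ volume (F '' s) = 0

lemma np_hh {F : ℂ → ℂ} (hF : Lift F) (hN : NP F) (τ : ℝ) : NP (hh F τ) := by
  rcases le_or_gt τ 0 with h | hτ
  · rw [hh_np hF h]; exact hN
  set h := hh F τ
  have a : IsH F τ h := hF.hh τ
  set A := AF F τ
  set e := (hF.hhL τ).hom.homeomorph h
  have he : ∀ z, h (e.symm z) = z := e.apply_symm_apply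
  have hes : ∀ z, e.symm (h z) = z := e.symm_apply_apply
  intro s
  have e1 : h '' s = h '' (s ∩ A) ∪ F '' (s \ A) := by
    rw [← Set.inter_union_diff s A, Set.image_union]
    congr 1
    · simp
    · rw [Set.inter_union_diff]
      exact Set.image_congr fun z hz => a.out z hz.2
  have e2 : s = e.symm '' (h '' (s ∩ A)) ∪ (s \ A) := by
    rw [Set.image_image]
    simp only [hes, Set.image_id', Set.inter_union_diff]
  constructor
  · intro hs
    rw [e1, measure_union_null_iff]
    refine ⟨addHaar_image_eq_zero_of_differentiableOn_of_addHaar_eq_zero _ (fun z hz => ?_)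
      (measure_mono_null Set.inter_subset_left hs),
      (hN _).1 (measure_mono_null Set.sdiff_subset hs)⟩
    obtain ⟨L, hL⟩ := a.strict hF hτ hz.2
    exact hL.hasFDerivAt.differentiableAt.differentiableWithinAt
  · intro hs
    rw [e1, measure_union_null_iff] at hs
    rw [e2, measure_union_null_iff]
    refine ⟨addHaar_image_eq_zero_of_differentiableOn_of_addHaar_eq_zero _ ?_ hs.1, (hN _).2 hs.2⟩
    rintro _ ⟨z, hz, rfl⟩
    obtain ⟨L, hL⟩ := a.strict hF hτ hz.2
    have := HasFDerivAt.of_local_left_inverse (f := h) (g := e.symm) (f' := L) (a := h z)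
      e.symm.continuous.continuousAt (by rw [hes]; exact hL.hasFDerivAt) (Filter.Eventually.of_forall he)
    exact this.differentiableAt.differentiableWithinAt

structure Wide (F h : ℂ → ℂ) (τ y : ℝ) : Prop where
  hF : Lift F
  hτ : 0 < τ
  a : IsH F τ h
  A : ∀ z : ℂ, |z.im| ≤ 2 * y → z ∈ AF F τ
  pos : ∀ z : ℂ, 2 * y ≤ z.im → 0 ≤ (F z).im
  hy : 16 * pi ≤ y

lemma Wide.y0 {F h : ℂ → ℂ} {τ y : ℝ} (w : Wide F h τ y) : 0 < y := by
  linarith [w.hy, pi_pos]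

lemma Wide.mx {F h : ℂ → ℂ} {τ y : ℝ} (w : Wide F h τ y) {x0 c : ℝ} (hx : 0 ≤ x0) (hx' : x0 ≤ y) (hc : c ≤ τ)
    (hb : ∀ z : ℂ, z.im = x0 → c ≤ (h z).im) (z : ℂ) (hz : x0 ≤ z.im) : c ≤ (h z).im := by
  have hA := AF_reg w.hF τ
  have hy := w.y0
  by_cases hzA : z ∈ AF F τ
  swap
  · have h1 : 2 * y ≤ z.im := by
      by_contra! hcon
      exact hzA (w.A z (abs_le.2 ⟨by linarith, hcon.le⟩))
    have h2 := w.pos z h1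
    have h3 : τ ≤ |(F z).im| := not_lt.1 hzA
    rw [abs_of_nonneg h2] at h3
    rw [w.a.out z hzA]; linarith
  rcases hz.eq_or_lt with hz | hz
  · exact hb z hz.symm
  have oΩ : IsOpen ({z : ℂ | x0 < z.im} ∩ AF F τ) := (isOpen_lt continuous_const continuous_im).inter hA.o
  obtain ⟨R, hR0, hR⟩ := AF_strip w.hF τ
  obtain ⟨C, hC⟩ := w.a.growth w.hF 0 (-1) (-c) R
  have cl := lv_cont (α := 0) (β := -1) w.a.c
  have := maxP oΩ (fun z hz => hR z hz.2) (v := fun z => _root_.lv 0 (-1) h z + c) (cl.add continuous_const)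
    ((HarmonicOnNhd.subM oΩ ((w.a.lv 0 (-1)).mono Set.inter_subset_right)).add (SubM.const _ _) cl
      continuous_const) (fun v hv => by
        have h1 : x0 ≤ v.im := closure_minimal (s := {z : ℂ | x0 < z.im} ∩ AF F τ) (t := {z : ℂ | x0 ≤ z.im})
          (fun z hz => le_of_lt (show x0 < z.im from hz.1)) (isClosed_le continuous_const continuous_im) (frontier_subset_closure hv)
        rw [oΩ.frontier_eq] at hv
        simp only [_root_.lv]
        by_cases hvA : v ∈ AF F τ
        · have h2 : v.im = x0 := le_antisymm (not_lt.1 fun h => hv.2 ⟨h, hvA⟩) h1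
          linarith [hb v h2]
        · have h1 : 2 * y ≤ v.im := by
            by_contra! hcon
            exact hvA (w.A v (abs_le.2 ⟨by linarith, hcon.le⟩))
          have h2 := w.pos v h1
          have h3 : τ ≤ |(F v).im| := not_lt.1 hvA
          rw [abs_of_nonneg h2] at h3
          rw [w.a.out v hvA]; linarith) (C := C) (fun v hv => by linarith [hC v hv]) z ⟨hz, hzA⟩
  simp only [_root_.lv] at this
  linarith

lemma Wide.shift {F h : ℂ → ℂ} {τ y : ℝ} (w : Wide F h τ y) (z : ℂ) (n : ℤ) : h (z + n * tp) = h z + n * tp := by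
  have := (sg_per (w.a.sg w.hF)).int_mul n z
  linear_combination this

lemma Wide.T {F h : ℂ → ℂ} {τ y : ℝ} (w : Wide F h τ y) :
    ∃ k > 0, ∀ z : ℂ, |z.im| ≤ y → |(h z).im - k * z.im| ≤ 16 * pi * k := by
  have hy := w.y0
  have hpi := pi_pos
  have hsg : ∀ z, (h (sg z)).im = -(h z).im := fun z => by rw [w.a.sg w.hF, sg_im]
  have hsh : ∀ z (n : ℤ), (h (z + n * tp)).im = (h z).im := fun z n => by
    rw [w.shift]; simp [tp_im]
  obtain ⟨o, ho0, x0, hx0, ho, hox⟩ : ∃ o : ℝ, 0 ≤ o ∧ ∃ x0 : ℂ, x0.im = 0 ∧ (∀ z : ℂ, z.im = 0 → |(h z).im| ≤ o) ∧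
      |(h x0).im| = o := by
    obtain ⟨x0, hx0, hm⟩ := (strip_cpt 0 (2 * pi) 0).exists_isMaxOn ⟨0, by simp; positivity⟩
      (continuous_im.comp w.a.c).abs.continuousOn
    refine ⟨_, abs_nonneg _, x0, abs_nonpos_iff.1 hx0.2.2, fun z hz => ?_, rfl⟩
    obtain ⟨n, hn, hi⟩ := exists_shift z
    have := hm ⟨hn.1, hn.2.le, by rw [hi, hz]; simp⟩
    simp only [Set.mem_ofPred_eq, Function.comp, hsh] at this
    exact this
  have hpos : ∀ z : ℂ, 0 ≤ z.im → -o ≤ (h z).im := fun z hz =>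
    w.mx le_rfl hy.le (by linarith [w.hτ]) (fun z hz => (abs_le.1 (ho z hz)).1) z hz
  set c : ℂ := y * Complex.I with hc
  set k : ℝ := (h c).im / y with hk
  have hcy : (h c).im = k * y := by rw [hk]; field_simp
  have hcim : c.im = y := by simp [hc]
  have hcre : c.re = 0 := by simp [hc]
  have hP0 : 0 ≤ (h c).im + o := by linarith [hpos c (by rw [hcim]; exact hy.le)]
  set E : ℝ := 8 * pi * (k + o / y) with hE
  have hE' : E * y = 8 * pi * ((h c).im + o) := by rw [hE, hcy]; field_simp
  have top : ∀ z : ℂ, z.im = y → |(h z).im - k * z.im| ≤ E := by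
    intro z hz
    obtain ⟨n, hn, hi⟩ := exists_shift z
    rw [← hsh z n, hz]
    set z' := z + n * tp
    have hzc : z' - c = (z'.re : ℂ) := Complex.ext (by simp [hcre]) (by simp [hcim, hi, hz])
    have hd : ‖z' - c‖ ≤ 2 * pi := by
      rw [hzc, norm_real, norm_eq_abs, abs_of_nonneg hn.1]; exact hn.2.le
    have hyy := w.hy
    have hball : ∀ v ∈ closedBall c y, 0 ≤ v.im ∧ v.im ≤ 2 * y := by
      intro v hv
      rw [mem_closedBall, dist_eq_norm] at hv
      have := abs_le.1 ((abs_im_le_norm _).trans hv)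
      rw [sub_im, hcim] at this
      constructor <;> linarith
    have hH := harnack (c := c) (R := y) (z := z') (u := fun z => (h z).im + o)
      (by rw [mem_ball, dist_eq_norm]; linarith)
      (by
        have : HarmonicOnNhd (fun z => (h z).im) (closedBall c y) := w.a.hi.mono fun v hv => w.A v
          (abs_le.2 ⟨by linarith [(hball v hv).1], (hball v hv).2⟩)
        exact fun v hv => (this v hv).add (harmonicAt_const o))
      (fun v hv => by linarith [hpos v (hball v hv).1])
    set d := ‖z' - c‖
    set P := (h c).im + o
    have hd0 : 0 ≤ d := norm_nonneg _
    have hdy : 0 < y - d := by linarith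
    have r1 : (y + d) / (y - d) ≤ 1 + 8 * pi / y := by
      rw [div_le_iff₀ hdy]
      have : 8 * pi / y * (y - d) = 8 * pi - 8 * pi / y * d := by field_simp
      have h2 : 8 * pi / y ≤ 1 / 2 := by rw [div_le_iff₀ hy]; linarith
      nlinarith
    have r2 : 1 - 8 * pi / y ≤ (y - d) / (y + d) := by
      rw [le_div_iff₀ (by linarith)]
      have : 8 * pi / y * (y + d) = 8 * pi + 8 * pi / y * d := by field_simp
      have : 0 ≤ 8 * pi / y * d := by positivity
      nlinarith
    have eE : E = 8 * pi / y * P := by rw [eq_comm, div_mul_eq_mul_div, div_eq_iff hy.ne', hE']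
    have h1 := hH.1.trans (mul_le_mul_of_nonneg_right r1 hP0)
    have h2 := (mul_le_mul_of_nonneg_right r2 hP0).trans hH.2
    rw [abs_le, eE, ← hcy]
    constructor <;> nlinarith
  have all : ∀ z : ℂ, |z.im| ≤ y → |(h z).im - k * z.im| ≤ E := by
    have key : ∀ s : ℝ, |s| = 1 → ∀ z : ℂ, |z.im| < y → s * ((h z).im - k * z.im) ≤ E := by
      intro s hs z hz
      have oΩ : IsOpen {z : ℂ | |z.im| < y} := isOpen_lt continuous_im.abs continuous_const
      obtain ⟨C, hC⟩ := w.a.growth w.hF 0 s (E - |k| * y) y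
      have him : ∀ v, HarmonicAt (fun z : ℂ => z.im) v := fun v => (analyticAt_id (𝕜 := ℂ)).harmonicAt_im
      have cl : Continuous fun z => _root_.lv 0 s h z + (-(s * k)) * z.im :=
        (lv_cont w.a.c).add (continuous_const.mul continuous_im)
      have hHH : HarmonicOnNhd (fun z => _root_.lv 0 s h z + (-(s * k)) * z.im) {z : ℂ | |z.im| < y} := fun v hv =>
        (w.a.lv 0 s v (w.A v (by linarith [show |v.im| < y from hv]))).add ((him v).const_smul (c := -(s * k)))
      have := maxP oΩ (fun z hz => le_of_lt hz) (v := fun z => (_root_.lv 0 s h z + (-(s * k)) * z.im) + -E)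
        (cl.add continuous_const) ((HarmonicOnNhd.subM oΩ hHH).add (SubM.const _ _) cl continuous_const)
        (fun v hv => by
          have h1 : |v.im| = y := frontier_lt_subset_eq continuous_im.abs continuous_const hv
          have h2 : |(h v).im - k * v.im| ≤ E := by
            rcases abs_eq hy.le |>.1 h1 with h3 | h3
            · exact top v h3
            · have := top (sg v) (by rw [sg_im, h3, neg_neg])
              rw [hsg, sg_im] at this
              rw [← abs_neg]; convert this using 2; ring
          have h4 : |s * ((h v).im - k * v.im)| ≤ E := by rw [abs_mul, hs, one_mul]; exact h2
          simp only [_root_.lv]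
          linarith [(abs_le.1 h4).2]) (C := C) (fun v hv => by
            have h1 := hC v hv
            have h2 : |s * k * v.im| ≤ |k| * y := by
              rw [abs_mul, abs_mul, hs, one_mul]; gcongr
            linarith [(abs_le.1 h2).1]) z hz
      simp only [_root_.lv] at this
      linarith
    intro z hz
    rcases hz.eq_or_lt with hz | hz
    · rcases abs_eq hy.le |>.1 hz with h3 | h3
      · exact top z h3
      · have := top (sg z) (by rw [sg_im, h3, neg_neg])
        rw [hsg, sg_im] at this
        rw [← abs_neg]; convert this using 2; ring
    · rw [abs_le]
      constructor <;> linarith [key 1 (by simp) z hz, key (-1) (by simp) z hz]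
  have ho' : o ≤ 16 * pi * k := by
    have := all x0 (by rw [hx0]; simpa using hy.le)
    rw [hx0, mul_zero, sub_zero, hox, hE] at this
    have h2 : 8 * pi * (o / y) ≤ o / 2 := by
      rw [mul_div_assoc', div_le_div_iff₀ hy (by norm_num)]
      nlinarith [w.hy]
    nlinarith
  have hEk : E ≤ 16 * pi * k := by
    have h2 : 8 * pi * (o / y) ≤ o / 2 := by
      rw [mul_div_assoc', div_le_div_iff₀ hy (by norm_num)]
      nlinarith [w.hy]
    rw [hE]; nlinarith
  have hk0 : 0 ≤ k := by
    by_contra! hcon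
    nlinarith
  refine ⟨k, lt_of_le_of_ne hk0 fun hk0 => ?_, fun z hz => (all z hz).trans hEk⟩
  have h0 : ∀ z : ℂ, |z.im| ≤ y → (h z).im = 0 := fun z hz => by
    have := (all z hz).trans hEk
    rw [← hk0] at this
    simpa using this
  have hL := w.a.lift w.hF w.hτ
  have op := hL.hom.isOpenMap (ball 0 y) isOpen_ball
  obtain ⟨e, he, hs⟩ := Metric.isOpen_iff.1 op (h 0) ⟨0, by simpa using hy, rfl⟩
  obtain ⟨v, hv, hv2⟩ := hs (show h 0 + (e / 2 : ℝ) * Complex.I ∈ ball (h 0) e by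
    rw [mem_ball, dist_eq_norm]; simp [abs_of_pos he]; linarith)
  have h1 := h0 v ((abs_im_le_norm v).trans (by simpa using (mem_ball.1 hv).le))
  rw [hv2] at h1
  have h2 := h0 0 (by simpa using hy.le)
  simp [h2] at h1
  exact he.ne' h1

lemma bc' {m : ℂ → ℂ} {R M d : ℝ} (hM : 0 < M) (hR : 0 < R) (hm : DifferentiableOn ℂ m (ball 0 R))
    (hre : ∀ z ∈ ball 0 R, (m z).re ≤ (m 0).re + M) (hd : 2 * d ≤ R) {z : ℂ} (hz : ‖z‖ ≤ d) :
    ‖m z - m 0‖ ≤ 4 * M * d / R := by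
  have hz0 := norm_nonneg z
  have h := Complex.borelCaratheodory_zero (f := fun z => m z - m 0) (z := z) hM (hm.sub (differentiableOn_const _))
    (fun w hw => by simp only [Set.mem_ofPred_eq, sub_re]; linarith [hre w hw]) hR
    (by rw [mem_ball_zero_iff]; linarith) (by simp)
  refine h.trans ?_
  rw [div_le_div_iff₀ (by linarith) hR]
  nlinarith [mul_nonneg hM.le hz0, mul_nonneg hM.le (sub_nonneg.2 hz), mul_nonneg hM.le (sub_nonneg.2 hd)]

lemma real_lim {B : ℂ} {e : ℝ} (he : e ≤ 1 / 8) (h1 : |2 * pi - 2 * pi * B.re| ≤ e * ‖B‖)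
    (h2 : |pi - pi * B.re - 2 * B.im| ≤ 2 * e * ‖B‖) : ‖B‖ ≤ 2 ∧ ‖B - 1‖ ≤ 8 * e := by
  have hp := pi_gt_three
  have h3 : |pi - pi * B.re| ≤ e * ‖B‖ / 2 := by
    have : 2 * pi - 2 * pi * B.re = 2 * (pi - pi * B.re) := by ring
    rw [this, abs_mul] at h1; norm_num at h1; linarith
  have h4 : |1 - B.re| ≤ e * ‖B‖ := by
    have : pi - pi * B.re = pi * (1 - B.re) := by ring
    rw [this, abs_mul, abs_of_pos pi_pos] at h3
    nlinarith [abs_nonneg (1 - B.re)]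
  have h5 : |B.im| ≤ 3 * e * ‖B‖ := by
    rw [abs_le] at *
    constructor <;> linarith
  have h6 : ‖B - 1‖ ≤ 4 * e * ‖B‖ := by
    refine (norm_le_abs_re_add_abs_im _).trans ?_
    simp only [sub_re, Complex.one_re, sub_im, Complex.one_im, sub_zero]
    rw [abs_sub_comm]; linarith
  have h7 : ‖B‖ ≤ ‖B - 1‖ + 1 := by simpa using norm_add_le (B - 1) 1
  have h8 : ‖B‖ ≤ 2 := by nlinarith [norm_nonneg B]
  have he0 : 0 ≤ e * ‖B‖ := (abs_nonneg _).trans h4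
  refine ⟨h8, h6.trans ?_⟩
  rcases eq_or_ne B 0 with h | h
  · rw [h] at h4; norm_num at h4
  · have : 0 ≤ e := by by_contra! hc; nlinarith [norm_pos_iff.2 h]
    nlinarith

theorem Wide.lim (d : ℝ) (hd : 8 ≤ d) {η : ℝ} (hη : 0 < η) (hη1 : 3 * η * d ≤ 1 / 8) : ∃ y0, ∀ F h τ y, Wide F h τ y → y0 ≤ y →
    ∃ k > 0, (∀ z : ℂ, ‖z‖ ≤ d → |(h z).im - k * z.im| ≤ 2 * η * k) ∧
      ∀ z : ℂ, ‖z‖ ≤ d - 1 → |(h z).re - (h 0).re - z.re| ≤ 6 * η * d + 24 * η * d * d := by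
  have hpi := pi_pos
  refine ⟨max (2 * d) ((8 * (16 * pi) + 4) * d / η), fun F h τ y w hy => ?_⟩
  have hy1 : 2 * d ≤ y := (le_max_left _ _).trans hy
  have hy2 := (le_max_right _ _).trans hy
  rw [div_le_iff₀ hη] at hy2
  have hy0 := w.y0
  have q1 : 4 * (2 * (16 * pi)) * d / y ≤ η := by rw [div_le_iff₀ hy0]; nlinarith
  have q2 : 4 * d / y ≤ η := by rw [div_le_iff₀ hy0]; nlinarith
  have hη' : η ≤ 1 := by nlinarith
  obtain ⟨k, hk, hT⟩ := w.T
  have hball : ∀ z ∈ ball (0:ℂ) y, |z.im| ≤ y := fun z hz =>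
    (abs_im_le_norm z).trans (mem_ball_zero_iff.1 hz).le
  have hbA : ball (0:ℂ) y ⊆ AF F τ := fun z hz => w.A z (by linarith [hball z hz])
  obtain ⟨S, hS, hSr⟩ := HarmonicOnNhd.exists_analyticOnNhd_ball_re_eq (f := fun z => (h z).im) (z := 0) (R := y)
    (w.a.hi.mono hbA)
  obtain ⟨P, hP, hPr⟩ := HarmonicOnNhd.exists_analyticOnNhd_ball_re_eq (f := fun z => (h z).re) (z := 0) (R := y)
    (w.a.hr.mono hbA)
  have hkc : (k : ℂ) ≠ 0 := by exact_mod_cast hk.ne'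
  set G : ℂ → ℂ := fun z => S z / k + Complex.I * z with hG
  have hGd : DifferentiableOn ℂ G (ball 0 y) := fun z hz =>
    (((hS z hz).differentiableAt.div_const _).add (by fun_prop)).differentiableWithinAt
  have hGre : ∀ z ∈ ball (0:ℂ) y, (G z).re = (h z).im / k - z.im := fun z hz => by
    have := hSr hz
    simp only at this
    simp [hG, ← this]; ring
  have hGb : ∀ z ∈ ball (0:ℂ) y, |(G z).re| ≤ 16 * pi := fun z hz => by
    rw [hGre z hz]
    have := hT z (hball z hz)
    have e : (h z).im / k - z.im = ((h z).im - k * z.im) / k := by field_simp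
    rw [e, abs_div, abs_of_pos hk, div_le_iff₀ hk]; exact this
  have h00 : (0:ℂ) ∈ ball (0:ℂ) y := mem_ball_self hy0
  have g1 : ∀ z : ℂ, ‖z‖ ≤ d → ‖G z - G 0‖ ≤ η := fun z hz => by
    refine (bc' (M := 2 * (16 * pi)) (by positivity) hy0 hGd (fun z hz => ?_) hy1 hz).trans q1
    have := abs_le.1 (hGb z hz); have := abs_le.1 (hGb 0 h00)
    linarith
  have hin : ∀ z : ℂ, ‖z‖ ≤ d → z ∈ ball (0:ℂ) y := fun z hz => by rw [mem_ball_zero_iff]; linarith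
  have hsg : ∀ z, (h (sg z)).im = -(h z).im := fun z => by rw [w.a.sg w.hF, sg_im]
  have hpd : pi ≤ 4 := Real.pi_le_four
  refine ⟨k, hk, fun z hz => ?_, ?_⟩
  · have a1 := (abs_le.1 ((abs_re_le_norm _).trans (g1 z hz)))
    have s0 : ‖sg 0‖ ≤ d := by simp [sg, abs_of_pos hpi]; linarith
    have a2 := (abs_le.1 ((abs_re_le_norm _).trans (g1 (sg 0) s0)))
    rw [sub_re, hGre _ (hin _ s0), hGre 0 h00, hsg, sg_im, zero_im] at a2
    rw [sub_re, hGre _ (hin _ hz), hGre 0 h00, zero_im] at a1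
    have e : (h z).im - k * z.im = ((h z).im / k - z.im) * k := by field_simp
    rw [e, abs_mul, abs_of_pos hk]
    refine mul_le_mul_of_nonneg_right (abs_le.2 ?_) hk.le
    rw [neg_div] at a2
    constructor <;> linarith
  have g2 : ∀ z : ℂ, ‖z‖ ≤ d - 1 → ‖deriv G z‖ ≤ η := fun z hz => by
    have hsub : closedBall z 1 ⊆ ball 0 y := fun v hv => hin v (by
      rw [mem_closedBall, dist_eq_norm] at hv
      have := norm_le_norm_add_norm_sub z v
      rw [norm_sub_rev] at this; linarith)
    have := Complex.norm_deriv_le_of_forall_mem_sphere_norm_le (f := fun z => G z - G 0) (c := z) one_pos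
      (C := η) (((hGd.sub (differentiableOn_const _)).mono hsub).diffContOnCl_ball subset_rfl) (fun v hv => g1 v (by
        rw [mem_sphere, dist_eq_norm] at hv
        have := norm_le_norm_add_norm_sub z v
        rw [norm_sub_rev] at this; linarith))
    rw [deriv_sub_const, div_one] at this; exact this
  have dG : ∀ z ∈ ball (0:ℂ) y, deriv S z = k * (deriv G z - Complex.I) := fun z hz => by
    have h1 : HasDerivAt G (deriv S z / k + Complex.I * 1) z :=
      ((hS z hz).differentiableAt.hasDerivAt.div_const _).add ((hasDerivAt_id z).const_mul _)
    rw [h1.deriv]; field_simp; ring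
  have near : ∀ z ∈ ball (0:ℂ) y, ∀ᶠ v in nhds z, v ∈ ball (0:ℂ) y := fun z hz => isOpen_ball.mem_nhds hz
  have dS0 : ∀ z ∈ ball (0:ℂ) y, deriv S z ≠ 0 := fun z hz =>
    rkc w.hF w.hτ w.a (α := 0) (β := 1) (Or.inr one_ne_zero) (hbA hz) (hS z hz) (by
      filter_upwards [near z hz] with v hv
      have := hSr hv
      simp only at this
      simp [lv, this])
  set m : ℂ → ℂ := fun z => deriv P z / deriv S z with hm
  have hmd : DifferentiableOn ℂ m (ball 0 y) := fun z hz =>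
    ((hP z hz).deriv.differentiableAt.div (hS z hz).deriv.differentiableAt (dS0 z hz)).differentiableWithinAt
  have hmi : ∀ z ∈ ball (0:ℂ) y, (m z).im ≠ 0 := fun z hz h0 => by
    have e : m z = ((m z).re : ℂ) := Complex.ext (by simp) (by simp [h0])
    set l := (m z).re
    have e2 : deriv P z = l * deriv S z := by rw [← e, hm]; field_simp [dS0 z hz]
    refine rkc w.hF w.hτ w.a (α := 1) (β := -l) (Or.inl one_ne_zero) (hbA hz)
      (G := fun z => P z - l * S z) ((hP z hz).sub (analyticAt_const.mul (hS z hz))) (by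
      filter_upwards [near z hz] with v hv
      have h1 := hSr hv
      have h2 := hPr hv
      simp only at h1 h2
      simp [lv, h1, h2]; ring) ?_
    have := ((hP z hz).differentiableAt.hasDerivAt.sub ((hS z hz).differentiableAt.hasDerivAt.const_mul (l : ℂ))).deriv
    exact this.trans (by rw [e2, sub_self])
  obtain ⟨s, hs1, hs⟩ : ∃ s : ℝ, |s| = 1 ∧ ∀ z ∈ ball (0:ℂ) y, 0 < s * (m z).im := by
    have cI : ContinuousOn (fun z => (m z).im) (ball 0 y) := continuous_im.comp_continuousOn hmd.continuousOn
    have pc : IsPreconnected ((fun z => (m z).im) '' ball 0 y) := (convex_ball (0:ℂ) y).isPreconnected.image _ cI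
    have no : (0:ℝ) ∉ (fun z => (m z).im) '' ball 0 y := by rintro ⟨z, hz, h0⟩; exact hmi z hz h0
    rcases lt_or_gt_of_ne (hmi 0 h00) with h1 | h1
    · refine ⟨-1, by simp, fun z hz => ?_⟩
      by_contra! hc
      exact no (pc.Icc_subset ⟨0, h00, rfl⟩ ⟨z, hz, rfl⟩ ⟨h1.le, by linarith⟩)
    · refine ⟨1, by simp, fun z hz => ?_⟩
      by_contra! hc
      exact no (pc.Icc_subset ⟨z, hz, rfl⟩ ⟨0, h00, rfl⟩ ⟨by linarith, h1.le⟩)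
  have hm0 : 0 < ‖m 0‖ := norm_pos_iff.2 fun h0 => hmi 0 h00 (by simp [h0])
  have m1 : ∀ z : ℂ, ‖z‖ ≤ d → ‖m z - m 0‖ ≤ η * ‖m 0‖ := fun z hz => by
    have := bc' (m := fun z => (s * Complex.I) * m z) (M := ‖m 0‖) hm0 hy0 (hmd.const_mul _) (fun z hz => by
      have h1 := hs z hz
      have h2 : |s * (m 0).im| ≤ ‖m 0‖ := by rw [abs_mul, hs1, one_mul]; exact abs_im_le_norm _
      have := abs_le.1 h2
      simp; linarith) hy1 hz
    rw [← mul_sub, norm_mul, norm_mul, norm_I, norm_real, norm_eq_abs, hs1, one_mul, one_mul] at this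
    refine this.trans ?_
    calc _ = 4 * d / y * ‖m 0‖ := by ring
      _ ≤ _ := by gcongr
  set B : ℂ := -Complex.I * k * m 0 with hB
  have nB : ‖B‖ = k * ‖m 0‖ := by simp [hB, abs_of_pos hk]
  have p1 : ∀ z : ℂ, ‖z‖ ≤ d - 1 → ‖deriv P z - B‖ ≤ 3 * η * ‖B‖ := fun z hz => by
    have hzb := hin z (by linarith)
    have e : deriv P z = m z * deriv S z := by rw [hm]; field_simp [dS0 z hzb]
    have e2 : deriv P z - B = k * ((m z - m 0) * (deriv G z - Complex.I) + m 0 * deriv G z) := by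
      rw [e, dG z hzb, hB]; ring
    rw [e2, nB, norm_mul, norm_real, norm_eq_abs, abs_of_pos hk]
    have n1 : ‖deriv G z - Complex.I‖ ≤ 2 := (norm_sub_le _ _).trans (by rw [norm_I]; linarith [g2 z hz])
    have n2 : ‖(m z - m 0) * (deriv G z - Complex.I) + m 0 * deriv G z‖ ≤ η * ‖m 0‖ * 2 + ‖m 0‖ * η := by
      refine (norm_add_le _ _).trans ?_
      rw [norm_mul, norm_mul]
      gcongr
      · exact m1 z (by linarith)
      · exact g2 z hz
    nlinarith
  have p2 : ∀ z : ℂ, ‖z‖ ≤ d - 1 → |(h z).re - (h 0).re - (B * z).re| ≤ 3 * η * d * ‖B‖ := fun z hz => by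
    have hsub : closedBall (0:ℂ) (d - 1) ⊆ ball 0 y := fun v hv => hin v (by
      rw [mem_closedBall_zero_iff] at hv; linarith)
    have hP' : ∀ v ∈ closedBall (0:ℂ) (d - 1), HasDerivWithinAt (fun z => P z - B * z) (deriv P v - B * 1) (closedBall 0 (d - 1)) v :=
      fun v hv => ((hP v (hsub hv)).differentiableAt.hasDerivAt.sub ((hasDerivAt_id v).const_mul B)).hasDerivWithinAt
    have := (convex_closedBall (0:ℂ) (d - 1)).norm_image_sub_le_of_norm_hasDerivWithin_le hP'
      (fun v hv => by rw [mul_one]; exact p1 v (by simpa using hv)) (mem_closedBall_self (by linarith))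
      (show z ∈ _ by simpa using hz)
    have h2 := (abs_re_le_norm _).trans this
    have r1 := hPr (hin z (by linarith))
    have r0 := hPr h00
    simp only at r1 r0
    rw [← r1, ← r0]
    have e : ((P z - B * z) - (P 0 - B * 0)).re = (P z).re - (P 0).re - (B * z).re := by simp; ring
    rw [e] at h2
    refine h2.trans ?_
    have : ‖z - 0‖ ≤ d := by rw [sub_zero]; linarith
    calc _ ≤ 3 * η * ‖B‖ * d := by gcongr
      _ = _ := by ring
  have hBl := real_lim (B := B) hη1 (by
      have := p2 tp (by rw [tp]; simp [abs_of_pos hpi]; linarith [Real.pi_lt_d2])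
      have e := w.shift 0 1
      simp only [Int.cast_one, one_mul, zero_add] at e
      rw [e] at this
      simp only [add_re, mul_re, tp_re, tp_im] at this
      convert this using 2; ring) (by
      have n1 : ‖(Complex.I : ℂ)‖ ≤ d - 1 := by simp; linarith
      have n2 : ‖sg Complex.I‖ ≤ d - 1 := by
        refine (norm_add_le _ _).trans ?_
        simp [abs_of_pos hpi]; linarith
      have b1 := p2 _ n1
      have b2 := p2 _ n2
      rw [w.a.sg w.hF, sg_re, mul_re, sg_re, sg_im] at b2
      simp only [mul_re, I_re, I_im] at b1 b2
      rw [abs_le] at b1 b2 ⊢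
      constructor <;> linarith)
  intro z hz
  have h1 := p2 z hz
  have h2 : |((B - 1) * z).re| ≤ 8 * (3 * η * d) * d := by
    refine (abs_re_le_norm _).trans ?_
    rw [norm_mul]
    have := hBl.2
    gcongr
    linarith
  have h3 : ((B - 1) * z).re = (B * z).re - z.re := by simp [sub_mul]
  rw [h3] at h2
  have h4 : 3 * η * d * ‖B‖ ≤ 6 * η * d := by
    have := hBl.1
    have : 0 ≤ 3 * η * d := by positivity
    nlinarith
  rw [abs_le] at *
  constructor <;> linarith

def aa (h : ℂ → ℂ) : ℝ := sSup ((fun z => |(h z).im|) '' closedBall 0 1)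

def nrm (φ : ℝ) (h : ℂ → ℂ) (z : ℂ) : ℂ := ⟨(h z).re - φ * (h 0).re, (h z).im * aa h ^ (-φ)⟩

lemma aa_bdd {h : ℂ → ℂ} (hc : Continuous h) : BddAbove ((fun z => |(h z).im|) '' closedBall 0 1) :=
  ((isCompact_closedBall (0:ℂ) 1).image (continuous_im.comp hc).abs).bddAbove

lemma aa_pos {h : ℂ → ℂ} (hh : IsHomeomorph h) : 0 < aa h := by
  have hb := aa_bdd hh.continuous
  have h1 : ∀ z ∈ closedBall (0:ℂ) 1, |(h z).im| ≤ aa h := fun z hz => le_csSup hb ⟨z, hz, rfl⟩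
  refine lt_of_le_of_ne ((abs_nonneg _).trans (h1 0 (by simp))) fun h0 => ?_
  obtain ⟨e, he, hs⟩ := Metric.isOpen_iff.1 (hh.isOpenMap (ball 0 1) isOpen_ball) (h 0) ⟨0, by simp, rfl⟩
  obtain ⟨v, hv, hv2⟩ := hs (show h 0 + (e / 2 : ℝ) * Complex.I ∈ ball (h 0) e by
    rw [mem_ball, dist_eq_norm]; simp [abs_of_pos he]; linarith)
  have a1 := h1 v (ball_subset_closedBall hv)
  have a2 := h1 0 (by simp)
  rw [← h0, abs_nonpos_iff] at a1 a2
  rw [hv2] at a1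
  simp [a2] at a1
  exact he.ne' a1

lemma aa_id : aa id = 1 := by
  refine le_antisymm (csSup_le ⟨_, 0, by simp, rfl⟩ ?_) (le_csSup (aa_bdd continuous_id) ⟨Complex.I, by simp, by simp⟩)
  rintro _ ⟨z, hz, rfl⟩
  exact (abs_im_le_norm z).trans (by simpa using hz)

lemma nrm_id (φ : ℝ) : nrm φ id = id := by
  funext z; simp [nrm, aa_id]

lemma nrm_zero (h : ℂ → ℂ) : nrm 0 h = h := by
  funext z; simp [nrm]

def aff (b c : ℝ) (z : ℂ) : ℂ := ⟨z.re - b, z.im * c⟩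

lemma aff_cont : Continuous fun p : (ℝ × ℝ) × ℂ => aff p.1.1 p.1.2 p.2 := by
  have : (fun p : (ℝ × ℝ) × ℂ => aff p.1.1 p.1.2 p.2) =
    fun p => Complex.equivRealProdCLM.symm (p.2.re - p.1.1, p.2.im * p.1.2) := by funext z; rfl
  rw [this]
  have h1 := continuous_re
  have h2 := continuous_im
  fun_prop

def affH (b c : ℝ) (hc : c ≠ 0) : ℂ ≃ₜ ℂ where
  toFun := aff b c
  invFun z := ⟨z.re + b, z.im / c⟩
  left_inv z := by apply Complex.ext <;> simp [aff, hc]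
  right_inv z := by apply Complex.ext <;> simp [aff, hc]
  continuous_toFun := aff_cont.comp (f := fun z => ((b, c), z)) (by fun_prop)
  continuous_invFun := by
    have : (fun z : ℂ => (⟨z.re + b, z.im / c⟩ : ℂ)) = fun z => aff (-b) c⁻¹ z := by
      funext z; apply Complex.ext <;> simp [aff, div_eq_mul_inv]
    rw [this]
    exact aff_cont.comp (f := fun z => ((-b, c⁻¹), z)) (by fun_prop)

lemma nrm_eq (φ : ℝ) (h : ℂ → ℂ) : nrm φ h = aff (φ * (h 0).re) (aa h ^ (-φ)) ∘ h := rfl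

lemma Lift.nrm {h : ℂ → ℂ} (hL : Lift h) (φ : ℝ) : Lift (nrm φ h) where
  hom := by
    rw [nrm_eq]
    have := rpow_pos_of_pos (aa_pos hL.hom) (-φ)
    exact (affH (φ * (h 0).re) _ this.ne').isHomeomorph.comp hL.hom
  sg z := by
    apply Complex.ext <;> simp only [_root_.nrm, hL.sg, sg_re, sg_im] <;> ring
  up T := by
    have hp := rpow_pos_of_pos (aa_pos hL.hom) (-φ)
    obtain ⟨S, hS⟩ := hL.up (T / aa h ^ (-φ))
    exact ⟨S, fun z hz => (div_le_iff₀ hp).1 (hS z hz)⟩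

lemma np_nrm {h : ℂ → ℂ} (hL : Lift h) (hN : NP h) (φ : ℝ) : NP (nrm φ h) := by
  intro s
  have hp := rpow_pos_of_pos (aa_pos hL.hom) (-φ)
  set e := affH (φ * (h 0).re) _ hp.ne'
  have hd : ∀ b c, Differentiable ℝ (aff b c) := fun b c => by
    have : (aff b c) = fun z => Complex.equivRealProdCLM.symm (reCLM z - b, Complex.imCLM z * c) := by
      funext z; rfl
    rw [this]
    fun_prop
  have e1 : ∀ z, nrm φ h z = e (h z) := fun z => rfl
  have e2 : ⇑e.symm = aff (-(φ * (h 0).re)) ((aa h ^ (-φ))⁻¹) := by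
    funext z; apply Complex.ext <;> simp [aff, e, affH, div_eq_mul_inv, Homeomorph.symm]
  have e3 : nrm φ h '' s = e '' (h '' s) := by rw [Set.image_image]; exact Set.image_congr fun z _ => e1 z
  rw [hN s, e3]
  constructor
  · exact fun h0 => addHaar_image_eq_zero_of_differentiableOn_of_addHaar_eq_zero _ (hd _ _).differentiableOn h0
  · intro h0
    have : e.symm '' (e '' (h '' s)) = h '' s := by rw [Set.image_image]; simp
    rw [← this, e2]
    exact addHaar_image_eq_zero_of_differentiableOn_of_addHaar_eq_zero _ (hd _ _).differentiableOn h0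

lemma Fam.aa {X : Type*} [TopologicalSpace X] {F : X → ℂ → ℂ} (hF : Fam F) : Continuous fun x => aa (F x) := by
  have := (isCompact_closedBall (0:ℂ) 1).continuous_sSup (f := fun x z => |(F x z).im|)
    ((continuous_im.comp hF.c).abs)
  exact this

lemma Fam.nrm {X : Type*} [TopologicalSpace X] {F : X → ℂ → ℂ} (hF : Fam F) :
    Fam (fun p : X × ℝ => nrm p.2 (F p.1)) where
  L p := (hF.L p.1).nrm p.2
  c := by
    have ca : Continuous fun p : (X × ℝ) × ℂ => _root_.aa (F p.1.1) ^ (-p.1.2) := by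
      refine Continuous.rpow (hF.aa.comp (by fun_prop)) (by fun_prop) fun p => Or.inl (aa_pos (hF.L _).hom).ne'
    have c0 : Continuous fun p : (X × ℝ) × ℂ => p.1.2 * (F p.1.1 0).re :=
      Continuous.mul (by fun_prop) (continuous_re.comp (hF.c.comp (f := fun p : (X × ℝ) × ℂ => (p.1.1, (0:ℂ)))
        (by fun_prop)))
    have c1 : Continuous fun p : (X × ℝ) × ℂ => F p.1.1 p.2 := hF.c.comp (f := fun p : (X × ℝ) × ℂ => (p.1.1, p.2)) (by fun_prop)
    exact aff_cont.comp ((c0.prodMk ca).prodMk c1)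
  up := by
    rintro ⟨x, φ⟩ T
    have ca : Continuous fun p : X × ℝ => _root_.aa (F p.1) ^ (-p.2) := by
      refine Continuous.rpow (hF.aa.comp (by fun_prop)) (by fun_prop) fun p => Or.inl (aa_pos (hF.L _).hom).ne'
    set q := _root_.aa (F x) ^ (-φ)
    have hq : 0 < q := rpow_pos_of_pos (aa_pos (hF.L x).hom) _
    obtain ⟨S, hS⟩ := hF.up x (|T| / (q / 2))
    refine ⟨S, ?_⟩
    have ev : ∀ᶠ p : X × ℝ in nhds (x, φ), q / 2 < _root_.aa (F p.1) ^ (-p.2) :=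
      continuousAt_const.eventually_lt ca.continuousAt (by show q / 2 < q; linarith)
    filter_upwards [ev, (continuous_fst.tendsto (x, φ)).eventually hS]
    rintro ⟨y, ψ⟩ h1 h2 z hz
    have h3 := h2 z hz
    simp only at h1 h3
    have h4 : 0 ≤ |T| / (q / 2) := by positivity
    have h5 : |T| / (q / 2) * (q / 2) = |T| := by field_simp
    show T ≤ (F y z).im * _root_.aa (F y) ^ (-ψ)
    calc T ≤ |T| := le_abs_self T
      _ = |T| / (q / 2) * (q / 2) := h5.symm
      _ ≤ _ := by gcongr; exact h4.trans h3

lemma Fam.wide {X : Type*} [TopologicalSpace X] {F : X → ℂ → ℂ} (hF : Fam F) (x0 : X) (Y : ℝ) :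
    ∃ y ≥ Y, ∃ τ1 > 0, ∀ᶠ x in nhds x0, ∀ τ ≥ τ1, Wide (F x) (_root_.hh (F x) τ) τ y := by
  obtain ⟨S, hS⟩ := hF.up x0 0
  set y := max Y (max S (16 * pi))
  have hy1 : S ≤ y := (le_max_left _ _).trans (le_max_right _ _)
  have hy2 : 16 * pi ≤ y := (le_max_right _ _).trans (le_max_right _ _)
  have hy0 : 0 < y := by linarith [pi_pos]
  obtain ⟨C, hC, hb⟩ := (hF.L x0).bdd (2 * y)
  refine ⟨y, le_max_left _ _, 2 * y + C + 2, by positivity, ?_⟩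
  filter_upwards [hS, hF.unif x0 (2 * y) one_pos] with x h1 h2 τ hτ
  refine ⟨hF.L x, by linarith, (hF.L x).hh τ, fun z hz => ?_, fun z hz => h1 z (by linarith), hy2⟩
  show |(F x z).im| < τ
  have e1 := (abs_im_le_norm _).trans (hb z hz)
  have e2 := (abs_im_le_norm _).trans (h2 z hz)
  rw [sub_im] at e1 e2
  have := abs_sub_abs_le_abs_sub (F x0 z).im z.im
  have := abs_sub_abs_le_abs_sub (F x z).im (F x0 z).im
  linarith

lemma Fam.lim {X : Type*} [TopologicalSpace X] {F : X → ℂ → ℂ} (hF : Fam F) (x0 : X) {d : ℝ} (hd : 8 ≤ d) {ε : ℝ}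
    (hε : 0 < ε) : ∃ τ1 > 0, ∀ᶠ x in nhds x0, ∀ τ ≥ τ1,
      (∀ z : ℂ, ‖z‖ ≤ d - 1 → ‖_root_.nrm 1 (_root_.hh (F x) τ) z - z‖ ≤ ε) ∧
      ∀ z : ℂ, d - 7 ≤ z.im → d - 8 ≤ (_root_.nrm 1 (_root_.hh (F x) τ) z).im := by
  set η := min (1 / (24 * d)) (ε / (100 * d * d)) with hη
  have hη0 : 0 < η := by positivity
  have h1 : η * d ≤ 1 / 24 := by
    have : η ≤ 1 / (24 * d) := min_le_left _ _
    rw [le_div_iff₀ (by positivity)] at this; linarith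
  have h2 : 100 * η * d * d ≤ ε := by
    have : η ≤ ε / (100 * d * d) := min_le_right _ _
    rw [le_div_iff₀ (by positivity)] at this; linarith
  have h3 : η ≤ 1 / 4 := by nlinarith
  obtain ⟨y0, hl⟩ := Wide.lim d hd hη0 (by linarith)
  obtain ⟨y, hy, τ1, hτ1, hw⟩ := hF.wide x0 (max y0 d)
  refine ⟨τ1, hτ1, ?_⟩
  filter_upwards [hw] with x hw τ hτ
  have w := hw τ hτ
  set h := _root_.hh (F x) τ
  obtain ⟨k, hk, hT, hR⟩ := hl _ _ _ _ w ((le_max_left _ _).trans hy)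
  have hL := w.a.lift w.hF w.hτ
  have a1 : _root_.aa h ≤ k * (1 + 2 * η) := by
    refine csSup_le ⟨_, 0, by simp, rfl⟩ ?_
    rintro _ ⟨z, hz, rfl⟩
    have hz1 : ‖z‖ ≤ 1 := by simpa using hz
    have e1 := hT z (by linarith)
    have e2 := abs_sub_abs_le_abs_sub (h z).im (k * z.im)
    rw [abs_mul, abs_of_pos hk] at e2
    have e3 := (abs_im_le_norm z).trans hz1
    simp only
    nlinarith
  have a2 : k * (1 - 2 * η) ≤ _root_.aa h := by
    refine le_trans ?_ (le_csSup (aa_bdd hL.c) ⟨Complex.I, by simp, rfl⟩)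
    have e1 := hT Complex.I (by simp; linarith)
    have := (abs_le.1 e1).1
    simp only [I_im] at this
    exact le_trans (by linarith) (le_abs_self _)
  have ap := aa_pos hL.hom
  have a3 : k ≤ 2 * _root_.aa h := by nlinarith
  constructor
  · intro z hz
    have e1 := hT z (by linarith)
    have e2 := hR z hz
    have e3 : |(h z).im * _root_.aa h ^ (-1 : ℝ) - z.im| ≤ 4 * η * (1 + d) := by
      rw [Real.rpow_neg_one]
      have hz' : |z.im| ≤ d := (abs_im_le_norm z).trans (by linarith)
      have e : (h z).im * (_root_.aa h)⁻¹ - z.im = ((h z).im - k * z.im + (k - _root_.aa h) * z.im) / _root_.aa h := by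
        field_simp; ring
      rw [e, abs_div, abs_of_pos ap, div_le_iff₀ ap]
      have e4 : |(k - _root_.aa h) * z.im| ≤ (2 * η * k) * d := by
        rw [abs_mul]
        gcongr
        rw [abs_le]; constructor <;> linarith
      refine (abs_add_le _ _).trans ?_
      have := mul_le_mul_of_nonneg_left a3 (show 0 ≤ 2 * η * (1 + d) by positivity)
      linarith
    refine (norm_le_abs_re_add_abs_im _).trans ?_
    have e5 : (_root_.nrm 1 h z - z).re = (h z).re - (h 0).re - z.re := by simp [_root_.nrm]
    have e6 : (_root_.nrm 1 h z - z).im = (h z).im * _root_.aa h ^ (-1 : ℝ) - z.im := by simp [_root_.nrm]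
    rw [e5, e6]
    refine (add_le_add e2 e3).trans (le_trans ?_ h2)
    have : η * d * 8 ≤ η * d * d := by gcongr
    have : η * 8 ≤ η * d := by gcongr
    nlinarith
  · intro z hz
    have m := w.mx (x0 := d - 7) (c := k * (d - 7 - 2 * η)) (by linarith) (by linarith [(le_max_right _ _).trans hy]) ?_ ?_ z hz
    · show _ ≤ (h z).im * _root_.aa h ^ (-1 : ℝ)
      rw [Real.rpow_neg_one, ← div_eq_mul_inv, le_div_iff₀ ap]
      refine le_trans ?_ m
      calc (d - 8) * _root_.aa h ≤ (d - 8) * (k * (1 + 2 * η)) := by gcongr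
        _ = k * ((d - 8) * (1 + 2 * η)) := by ring
        _ ≤ _ := by gcongr; nlinarith
    · have e1 := hT (((d - 7 : ℝ) : ℂ) * Complex.I) (by
        rw [norm_mul, norm_I, norm_real, norm_eq_abs, abs_of_nonneg (by linarith)]; linarith)
      have e2 := w.a.im_le w.hF (β := 1) (by simp) (w.A (((d - 7 : ℝ) : ℂ) * Complex.I) (by
        simp [abs_of_nonneg (show 0 ≤ d - 7 by linarith)]; linarith [(le_max_right _ _).trans hy]))
      have e3 := (abs_le.1 e1).1
      simp only [mul_im, ofReal_re, I_im, ofReal_im, I_re, mul_one, mul_zero, add_zero] at e3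
      linarith
    · intro v hv
      obtain ⟨n, hn, hi⟩ := exists_shift v
      have e1 := hT (v + n * tp) (by
        refine (norm_le_abs_re_add_abs_im _).trans ?_
        rw [hi, hv, abs_of_nonneg hn.1, abs_of_nonneg (by linarith)]
        linarith [hn.2, Real.pi_lt_d2])
      rw [w.shift, hi, hv] at e1
      have e2 := (abs_le.1 e1).1
      simp only [add_im, mul_im, tp_im, Complex.intCast_im, Complex.intCast_re] at e2
      linarith

def CC {X : Type*} (F : X → ℂ → ℂ) (p : X × unitInterval) : ℂ → ℂ := open Classical in
  if (p.2 : ℝ) = 1 then id else nrm (min 1 (2 * p.2)) (hh (F p.1) (p.2 / (1 - p.2)))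

lemma CC_zero {X : Type*} [TopologicalSpace X] {F : X → ℂ → ℂ} (hF : Fam F) (x : X) : CC F (x, 0) = F x := by
  rw [CC, if_neg (by simp)]
  simp [nrm_zero, hh_np (hF.L x) le_rfl]

lemma CC_one {X : Type*} (F : X → ℂ → ℂ) (x : X) : CC F (x, 1) = id := by
  rw [CC, if_pos (by simp)]

lemma hh_id (τ : ℝ) (hL : Lift id) : hh id τ = id := by
  refine (hL.hh τ).uniq hL ⟨continuous_id, fun _ _ => rfl, fun z _ => ?_, fun z _ => ?_, 0, fun z => by simp⟩
  · exact (analyticAt_id (𝕜 := ℂ)).harmonicAt_re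
  · exact (analyticAt_id (𝕜 := ℂ)).harmonicAt_im

lemma CC_id {X : Type*} [TopologicalSpace X] {F : X → ℂ → ℂ} (hF : Fam F) {x : X} (hx : F x = id) (t : unitInterval) :
    CC F (x, t) = id := by
  by_cases h : (t : ℝ) = 1
  · rw [CC, if_pos h]
  · rw [CC, if_neg h]
    simp only [hx]
    rw [hh_id _ (hx ▸ hF.L x), nrm_id]

lemma CC_np {X : Type*} [TopologicalSpace X] {F : X → ℂ → ℂ} (hF : Fam F) {x : X} (hN : NP (F x)) (t : unitInterval) :
    NP (CC F (x, t)) := by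
  by_cases h : (t : ℝ) = 1
  · rw [CC, if_pos h]; intro s; simp
  · rw [CC, if_neg h]
    exact np_nrm ((hF.L x).hhL _) (np_hh (hF.L x) hN _) _

lemma Lift.one : Lift id := ⟨IsHomeomorph.id, fun _ => rfl, fun T => ⟨T, fun _ h => h⟩⟩

theorem Fam.CC {X : Type*} [TopologicalSpace X] {F : X → ℂ → ℂ} (hF : Fam F) : Fam (CC F) := by
  have K := hF.hh.nrm
  set k : X × unitInterval → (X × ℝ) × ℝ := fun p => ((p.1, (p.2 : ℝ) / (1 - p.2)), min 1 (2 * (p.2 : ℝ))) with hk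
  have kc : ∀ p : X × unitInterval, (p.2 : ℝ) ≠ 1 → ContinuousAt k p := by
    intro p hp
    have c2 : ContinuousAt (fun p : X × unitInterval => (p.2 : ℝ)) p := by fun_prop
    have : ContinuousAt (fun p : X × unitInterval => (p.2 : ℝ) / (1 - p.2)) p :=
      c2.div (continuousAt_const.sub c2) (sub_ne_zero.2 hp.symm)
    exact (continuousAt_fst.prodMk this).prodMk (continuousAt_const.min (continuousAt_const.mul c2))
  have ke : ∀ p : X × unitInterval, (p.2 : ℝ) ≠ 1 → _root_.CC F p = _root_.nrm (k p).2 (_root_.hh (F (k p).1.1) (k p).1.2) :=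
    fun p hp => by rw [_root_.CC, if_neg hp]
  have kn : ∀ p : X × unitInterval, (p.2 : ℝ) ≠ 1 → ∀ᶠ q in nhds p, (q.2 : ℝ) ≠ 1 := fun p hp =>
    (show ContinuousAt (fun q : X × unitInterval => (q.2 : ℝ)) p by fun_prop).eventually_ne hp
  have lim : ∀ (p : X × unitInterval), (p.2 : ℝ) = 1 → ∀ d : ℝ, 8 ≤ d → ∀ ε > 0, ∀ᶠ q in nhds p,
      (∀ z : ℂ, ‖z‖ ≤ d - 1 → ‖_root_.CC F q z - z‖ ≤ ε) ∧
      ∀ z : ℂ, d - 7 ≤ z.im → d - 8 ≤ (_root_.CC F q z).im := by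
    rintro ⟨x0, t0⟩ ht d hd ε hε
    simp only at ht
    obtain ⟨τ1, hτ1, hl⟩ := hF.lim x0 hd hε
    have ev : ∀ᶠ t : unitInterval in nhds t0, max (1 / 2) (τ1 / (1 + τ1)) < (t : ℝ) := by
      refine continuousAt_const.eventually_lt (by fun_prop) ?_
      rw [ht]
      refine max_lt (by norm_num) ?_
      rw [div_lt_one (by positivity)]; linarith
    rw [nhds_prod_eq]
    filter_upwards [hl.prod_mk ev]
    rintro ⟨x, t⟩ ⟨h1, h2⟩
    simp only at h1 h2
    by_cases h : (t : ℝ) = 1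
    · rw [_root_.CC, if_pos h]
      exact ⟨fun z _ => by simpa using hε.le, fun z hz => by simp; linarith⟩
    · rw [_root_.CC, if_neg h]
      have t1 : (t : ℝ) < 1 := lt_of_le_of_ne t.2.2 h
      have h3 := (le_max_left _ _).trans_lt h2
      have h4 := (le_max_right _ _).trans_lt h2
      rw [div_lt_iff₀ (by positivity)] at h4
      have e : min (1:ℝ) (2 * t) = 1 := min_eq_left (by linarith)
      simp only [e]
      exact h1 _ (by rw [ge_iff_le, le_div_iff₀ (by linarith)]; linarith)
  refine ⟨fun p => ?_, ?_, ?_⟩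
  · by_cases h : (p.2 : ℝ) = 1
    · rw [_root_.CC, if_pos h]; exact Lift.one
    · rw [ke p h]; exact K.L _
  · rw [continuous_iff_continuousAt]
    rintro ⟨p, z⟩
    by_cases h : (p.2 : ℝ) = 1
    · have e1 : _root_.CC F p = id := by rw [_root_.CC, if_pos h]
      rw [Metric.continuousAt_iff']
      intro ε hε
      have ev := lim p h (‖z‖ + 9) (by linarith [norm_nonneg z]) (ε / 2) (by positivity)
      rw [nhds_prod_eq]
      filter_upwards [ev.prod_mk (Metric.ball_mem_nhds z (lt_min (half_pos hε) one_pos))]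
      rintro ⟨q, v⟩ ⟨h1, h2⟩
      simp only at h1 h2 ⊢
      rw [dist_eq_norm] at h2 ⊢
      simp only [e1, id]
      have h3 : ‖v‖ ≤ ‖z‖ + 9 - 1 := by
        have := norm_le_norm_add_norm_sub z v
        rw [norm_sub_rev] at this
        linarith [h2.trans_le (min_le_right _ _)]
      calc _ ≤ _ := norm_sub_le_norm_sub_add_norm_sub _ v _
        _ < ε := by linarith [h1.1 v h3, h2.trans_le (min_le_left _ _)]
    · have c1 : ContinuousAt (fun r : (X × unitInterval) × ℂ => (k r.1, r.2)) (p, z) :=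
        (ContinuousAt.comp (g := k) (f := fun r : (X × unitInterval) × ℂ => r.1) (x := (p, z))
          (kc p h) continuousAt_fst).prodMk continuousAt_snd
      have c2 := ContinuousAt.comp (f := fun r : (X × unitInterval) × ℂ => (k r.1, r.2)) (x := (p, z)) K.c.continuousAt c1
      refine c2.congr ?_
      rw [nhds_prod_eq]
      filter_upwards [(kn p h).prod_inl (nhds z)]
      rintro ⟨q, v⟩ hq
      simp only [Function.comp]
      rw [ke q hq]
  · intro p T
    by_cases h : (p.2 : ℝ) = 1
    · refine ⟨|T| + 8 - 7, ?_⟩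
      filter_upwards [lim p h (|T| + 8) (by linarith [abs_nonneg T]) 1 one_pos] with q hq z hz
      linarith [hq.2 z hz, le_abs_self T]
    · obtain ⟨S, hS⟩ := K.up (k p) T
      refine ⟨S, ?_⟩
      filter_upwards [(kc p h).tendsto.eventually hS, kn p h] with q h1 h2 z hz
      rw [ke q h2]; exact h1 z hz

lemma pe (x y : Sph) : π x = π y ↔ (x : E3) = y ∨ (x : E3) = -y := Quotient.eq (r := antipodalSetoid)

lemma pq : IsOpenQuotientMap π := by
  refine ⟨Quotient.mk_surjective, continuous_quotient_mk', fun V hV => ?_⟩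
  change IsOpen (π ⁻¹' (π '' V))
  have e : π ⁻¹' (π '' V) = V ∪ (fun x : Sph => -x) ⁻¹' V := by
    ext x
    constructor
    · rintro ⟨y, hy, h⟩
      rcases (pe _ _).1 h with h | h
      · left; rwa [← Subtype.ext h]
      · right
        have : -x = y := Subtype.ext (by simp [h])
        simpa [this] using hy
    · rintro (h | h)
      · exact ⟨x, h, rfl⟩
      · exact ⟨-x, h, (pe _ _).2 (Or.inr (by simp))⟩
  rw [e]
  exact hV.union (hV.preimage continuous_neg)

def pc (i j : Fin 3) : P2 → ℝ := Quotient.lift (fun x : Sph => (x : E3) i * (x : E3) j) (by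
  rintro x y (h | h) <;> simp [h])

lemma pc_c (i j : Fin 3) : Continuous (pc i j) :=
  Continuous.quotient_lift (by fun_prop) _

lemma pc_pi (i j : Fin 3) (x : Sph) : pc i j (π x) = (x : E3) i * (x : E3) j := rfl

lemma sph_eq (x : Sph) : (x : E3) 0 ^ 2 + (x : E3) 1 ^ 2 + (x : E3) 2 ^ 2 = 1 := by
  have := x.2
  rw [mem_sphere_zero_iff_norm, EuclideanSpace.norm_eq, Real.sqrt_eq_one] at this
  simpa [Fin.sum_univ_three] using this

def mkS (v : E3) (h : v 0 ^ 2 + v 1 ^ 2 + v 2 ^ 2 = 1) : Sph := ⟨v, by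
  rw [mem_sphere_zero_iff_norm, EuclideanSpace.norm_eq, Real.sqrt_eq_one]
  simpa [Fin.sum_univ_three] using h⟩

lemma pinj {x y : Sph} (h : ∀ i j, pc i j (π x) = pc i j (π y)) : π x = π y := by
  simp only [pc_pi] at h
  obtain ⟨k, hk⟩ : ∃ k, (y : E3) k ≠ 0 := by
    by_contra! hn
    have := sph_eq y
    simp [hn] at this
  rw [pe]
  have h1 := h k k
  rcases mul_self_eq_mul_self_iff.1 h1 with h2 | h2
  · left; ext i
    have := h i k
    rw [h2] at this
    exact mul_right_cancel₀ hk this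
  · right; ext i
    have := h i k
    rw [h2] at this
    exact mul_right_cancel₀ hk (by simp; linarith)

instance : T2Space P2 := by
  refine T2Space.of_injective_continuous (f := fun p (k : Fin 3 × Fin 3) => pc k.1 k.2 p) ?_ (continuous_pi fun k => pc_c _ _)
  intro a b
  obtain ⟨x, rfl⟩ := pq.surjective a
  obtain ⟨y, rfl⟩ := pq.surjective b
  exact fun h => pinj fun i j => congrFun h (i, j)

instance : SecondCountableTopology P2 := pq.isQuotientMap.secondCountableTopology pq.isOpenMap
instance : CompactSpace P2 := inferInstance
instance : BorelSpace P2 := ⟨rfl⟩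

def QQ (z : ℂ) : Sph := mkS !₂[Real.cos z.re / Real.cosh z.im, Real.sin z.re / Real.cosh z.im, Real.sinh z.im / Real.cosh z.im] (by
  have := cosh_pos z.im
  simp
  field_simp
  nlinarith [cosh_sq z.im, sin_sq_add_cos_sq z.re])

lemma QQ0 (z : ℂ) : (QQ z : E3) 0 = Real.cos z.re / Real.cosh z.im := rfl
lemma QQ1 (z : ℂ) : (QQ z : E3) 1 = Real.sin z.re / Real.cosh z.im := rfl
lemma QQ2 (z : ℂ) : (QQ z : E3) 2 = Real.sinh z.im / Real.cosh z.im := rfl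

lemma QQ_d : ContDiff ℝ 1 (fun z : ℂ => (QQ z : E3)) := by
  have h1 : ContDiff ℝ 1 (fun z : ℂ => z.re) := reCLM.contDiff
  have h2 : ContDiff ℝ 1 (fun z : ℂ => z.im) := Complex.imCLM.contDiff
  have h3 : ∀ z : ℂ, Real.cosh z.im ≠ 0 := fun z => (cosh_pos _).ne'
  rw [contDiff_euclidean]
  intro i
  fin_cases i
  · exact (Real.contDiff_cos.comp h1).div (Real.contDiff_cosh.comp h2) h3
  · exact (Real.contDiff_sin.comp h1).div (Real.contDiff_cosh.comp h2) h3
  · exact (Real.contDiff_sinh.comp h2).div (Real.contDiff_cosh.comp h2) h3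

lemma QQ_c : Continuous QQ := QQ_d.continuous.subtype_mk _

def st (x : E3) : ℂ := ((x 0 : ℂ) + x 1 * Complex.I) / ((1 - x 2 : ℝ) : ℂ)

def EE (z : ℂ) : ℂ := Complex.exp (Complex.I * starRingEnd ℂ z)

lemma st_QQ (z : ℂ) : st (QQ z) = EE z := by
  have h := cosh_pos z.im
  have h1 : 1 - (QQ z : E3) 2 = Real.exp (-z.im) / Real.cosh z.im := by
    rw [QQ2, ← Real.cosh_sub_sinh]; field_simp
  have h2 : Complex.I * starRingEnd ℂ z = z.im + z.re * Complex.I := by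
    apply Complex.ext <;> simp
  rw [st, EE, h1, QQ0, QQ1, h2, exp_add, Complex.exp_mul_I, Real.exp_neg]
  have h3 : (Real.cosh z.im : ℂ) ≠ 0 := by exact_mod_cast h.ne'
  have h4 : (Real.exp z.im : ℂ) ≠ 0 := by exact_mod_cast (Real.exp_pos _).ne'
  push_cast at h3 h4 ⊢
  field_simp

lemma st_re (x : E3) : (st x).re = x 0 / (1 - x 2) := by
  rw [st, Complex.div_ofReal_re]; simp
lemma st_im (x : E3) : (st x).im = x 1 / (1 - x 2) := by
  rw [st, Complex.div_ofReal_im]; simp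

lemma st_inj {x y : Sph} (hx : (x : E3) 2 ≠ 1) (hy : (y : E3) 2 ≠ 1) (h : st x = st y) : x = y := by
  have key : ∀ x : Sph, (x : E3) 2 ≠ 1 → (x : E3) 0 = (st x).re * (1 - (x : E3) 2) ∧
      (x : E3) 1 = (st x).im * (1 - (x : E3) 2) ∧
      (x : E3) 2 = (((st x).re ^ 2 + (st x).im ^ 2) - 1) / (((st x).re ^ 2 + (st x).im ^ 2) + 1) := by
    intro x hx
    have a := sph_eq x
    have h0 : 1 - (x : E3) 2 ≠ 0 := sub_ne_zero.2 hx.symm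
    have e1 : (x : E3) 0 = (st x).re * (1 - (x : E3) 2) := by rw [st_re]; field_simp
    have e2 : (x : E3) 1 = (st x).im * (1 - (x : E3) 2) := by rw [st_im]; field_simp
    refine ⟨e1, e2, ?_⟩
    rw [e1, e2] at a
    rw [eq_div_iff (by positivity)]
    apply mul_right_cancel₀ h0
    linear_combination -a
  obtain ⟨a0, a1, a2⟩ := key x hx
  obtain ⟨b0, b1, b2⟩ := key y hy
  have c2 : (x : E3) 2 = (y : E3) 2 := by rw [a2, b2, h]
  ext i
  fin_cases i
  · exact a0.trans (by rw [c2, h]; exact b0.symm)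
  · exact a1.trans (by rw [c2, h]; exact b1.symm)
  · exact c2

lemma QQ2_ne (z : ℂ) : (QQ z : E3) 2 ^ 2 ≠ 1 := by
  rw [QQ2, div_pow]
  have := cosh_pos z.im
  rw [Ne, div_eq_one_iff_eq (by positivity), cosh_sq]
  linarith

lemma QQ_e {z : ℂ} {x : Sph} (hx : (x : E3) 2 ≠ 1) (h : EE z = st x) : QQ z = x :=
  st_inj (fun e => QQ2_ne z (by rw [e]; norm_num)) hx (by rw [st_QQ, h])

def LL (z0 : ℂ) (x : E3) : ℂ :=
  z0 + starRingEnd ℂ (-Complex.I * Complex.log (st x / EE z0))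

lemma EE_ne (z : ℂ) : EE z ≠ 0 := exp_ne_zero _

lemma LL_QQ {z0 z : ℂ} (h : |(z - z0).re| < pi) : LL z0 (QQ z) = z := by
  rw [abs_lt] at h
  have e : st (QQ z) / EE z0 = Complex.exp (Complex.I * starRingEnd ℂ (z - z0)) := by
    rw [st_QQ, EE, EE, ← exp_sub, map_sub, mul_sub]
  rw [LL, e, log_exp (by simpa using h.1) (by simpa using h.2.le), ← mul_assoc]
  simp

lemma QQ_LL (z0 : ℂ) {x : Sph} (h : (x : E3) 2 ^ 2 ≠ 1) : QQ (LL z0 x) = x := by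
  have h1 : (x : E3) 2 ≠ 1 := fun e => h (by rw [e]; norm_num)
  have h2 : st x ≠ 0 := by
    intro e
    have e1 := st_re x
    have e2 := st_im x
    have h0 : 1 - (x : E3) 2 ≠ 0 := sub_ne_zero.2 h1.symm
    rw [e, zero_re, eq_comm, div_eq_zero_iff, or_iff_left h0] at e1
    rw [e, zero_im, eq_comm, div_eq_zero_iff, or_iff_left h0] at e2
    have := sph_eq x
    exact h (by rw [e1, e2] at this; linarith)
  refine QQ_e h1 ?_
  rw [EE, LL]
  have : Complex.I * starRingEnd ℂ (z0 + starRingEnd ℂ (-Complex.I * Complex.log (st x / EE z0))) =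
      Complex.I * starRingEnd ℂ z0 + Complex.log (st x / EE z0) := by
    simp [mul_add, ← mul_assoc]
  rw [this, exp_add, exp_log (div_ne_zero h2 (EE_ne _))]
  exact mul_div_cancel₀ _ (EE_ne z0)

lemma LL_d (z0 : ℂ) : ContDiffAt ℝ 1 (LL z0) (QQ z0) := by
  have hc : ∀ i : Fin 3, ContDiff ℝ 1 (fun x : E3 => x i) := fun i => (contDiff_euclidean.1 contDiff_id) i
  have ho : ∀ i : Fin 3, ContDiff ℝ 1 (fun x : E3 => (x i : ℂ)) := fun i => Complex.ofRealCLM.contDiff.comp (hc i)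
  have h0 : ((1 - (QQ z0 : E3) 2 : ℝ) : ℂ) ≠ 0 := by
    rw [Complex.ofReal_ne_zero, sub_ne_zero]
    intro e; exact QQ2_ne z0 (by rw [← e]; norm_num)
  have h1 : ContDiffAt ℝ 1 st (QQ z0) := by
    have e : st = fun x : E3 => ((x 0 : ℂ) + x 1 * Complex.I) * ((1 - x 2 : ℝ) : ℂ)⁻¹ := by
      funext x; rw [st, div_eq_mul_inv]
    rw [e]
    refine (((ho 0).add ((ho 1).mul contDiff_const)).contDiffAt).mul (ContDiffAt.inv ?_ h0)
    exact (Complex.ofRealCLM.contDiff.comp (contDiff_const.sub (hc 2))).contDiffAt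
  have h2 : ContDiffAt ℝ 1 (fun x => st x / EE z0) (QQ z0) := h1.div_const _
  have h3 : ContDiffAt ℝ 1 Complex.log (st (QQ z0) / EE z0) := by
    rw [st_QQ, div_self (EE_ne _)]
    exact (Complex.contDiffAt_log (by simp)).restrict_scalars ℝ
  have h4 := ContDiffAt.comp (x := (QQ z0 : E3)) (f := fun x => st x / EE z0) (g := Complex.log) h3 h2
  exact contDiffAt_const.add (Complex.conjCLE.contDiff.contDiffAt.comp _ (contDiffAt_const.mul h4))

lemma QQ_open : IsOpenMap QQ := by
  rw [isOpenMap_iff_nhds_le]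
  intro z
  have c : ContinuousAt (fun x : Sph => LL z x) (QQ z) :=
    ContinuousAt.comp (g := LL z) (f := Subtype.val) (LL_d z).continuousAt continuousAt_subtype_val
  rw [ContinuousAt, LL_QQ (by simp [pi_pos])] at c
  have e : ∀ᶠ x : Sph in nhds (QQ z), QQ (LL z x) = x := by
    have c2 : Continuous fun x : Sph => (x : E3) 2 ^ 2 := by fun_prop
    filter_upwards [c2.continuousAt.eventually_ne (QQ2_ne z)] with x hx using QQ_LL z hx
  have : Filter.map QQ (Filter.map (fun x : Sph => LL z x) (nhds (QQ z))) = nhds (QQ z) := by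
    rw [Filter.map_map]
    exact (Filter.map_congr e).trans Filter.map_id
  rw [← this]
  exact Filter.map_mono c

def qq (z : ℂ) : P2 := π (QQ z)
def p0 : P2 := π (mkS !₂[0, 0, 1] (by simp))

lemma qq_c : Continuous qq := pq.continuous.comp QQ_c
lemma qq_open : IsOpenMap qq := pq.isOpenMap.comp QQ_open

lemma p0_iff (p : P2) : p = p0 ↔ pc 2 2 p = 1 := by
  constructor
  · rintro rfl; simp [p0, pc_pi, mkS]
  · obtain ⟨x, rfl⟩ := pq.surjective p
    intro h
    rw [pc_pi] at h
    have a := sph_eq x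
    have h0 : (x : E3) 0 = 0 := by nlinarith [sq_nonneg ((x : E3) 1)]
    have h1 : (x : E3) 1 = 0 := by nlinarith [sq_nonneg ((x : E3) 0)]
    refine pinj fun i j => ?_
    simp only [pc_pi, p0, mkS]
    fin_cases i <;> fin_cases j <;> simp [h0, h1, h]

lemma qq_ne (z : ℂ) : qq z ≠ p0 := by
  rw [Ne, p0_iff, qq, pc_pi, ← sq]; exact QQ2_ne z

lemma qq_sur {p : P2} (h : p ≠ p0) : ∃ z, qq z = p := by
  obtain ⟨x, rfl⟩ := pq.surjective p
  rw [Ne, p0_iff, pc_pi, ← sq] at h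
  exact ⟨_, congrArg π (QQ_LL 0 h)⟩

lemma QQ_sg (z : ℂ) : (QQ (sg z) : E3) = -(QQ z : E3) := by
  have : sg z = ⟨z.re + pi, -z.im⟩ := by apply Complex.ext <;> simp [sg]
  ext i
  fin_cases i
  · change (QQ (sg z) : E3) 0 = -(QQ z : E3) 0; rw [QQ0, QQ0, this]; simp [neg_div]
  · change (QQ (sg z) : E3) 1 = -(QQ z : E3) 1; rw [QQ1, QQ1, this]; simp [neg_div]
  · change (QQ (sg z) : E3) 2 = -(QQ z : E3) 2; rw [QQ2, QQ2, this]; simp [neg_div]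

lemma qq_sg (z : ℂ) : qq (sg z) = qq z := (pe _ _).2 (Or.inr (QQ_sg z))

def sE : ℂ ≃ₜ ℂ where
  toFun := sg
  invFun z := sg z - tp
  left_inv z := by simp [sg_sg]
  right_inv z := by apply Complex.ext <;> simp [sg, tp] <;> ring
  continuous_toFun := sg_cont
  continuous_invFun := sg_cont.sub continuous_const

lemma sE_re (n : ℤ) : ∀ z, ((sE ^ n) z).re = z.re + n * pi := by
  have h1 : ∀ z, (sE z).re = z.re + pi := sg_re
  have h2 : ∀ z, (sE⁻¹ z).re = z.re - pi := fun z => by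
    have := h1 (sE⁻¹ z)
    rw [show sE (sE⁻¹ z) = z from sE.apply_symm_apply z] at this
    linarith
  induction n using Int.induction_on with
  | zero => intro z; simp
  | succ n ih => intro z; rw [zpow_add_one, Homeomorph.mul_apply, ih, h1]; push_cast; ring
  | pred n ih => intro z; rw [zpow_sub_one, Homeomorph.mul_apply, ih, h2]; push_cast; ring

lemma qq_sE (n : ℤ) : ∀ z, qq ((sE ^ n) z) = qq z := by
  have h1 : ∀ z, qq (sE z) = qq z := qq_sg
  have h2 : ∀ z, qq (sE⁻¹ z) = qq z := fun z => by
    rw [← h1 (sE⁻¹ z), show sE (sE⁻¹ z) = z from sE.apply_symm_apply z]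
  induction n using Int.induction_on with
  | zero => intro z; simp
  | succ n ih => intro z; rw [zpow_add_one, Homeomorph.mul_apply, ih, h1]
  | pred n ih => intro z; rw [zpow_sub_one, Homeomorph.mul_apply, ih, h2]

lemma sE_two (n : ℤ) (z : ℂ) : (sE ^ (2 * n)) z = z + n * tp := by
  have h : ∀ z, (sE ^ (2:ℤ)) z = z + tp := fun z => by
    rw [zpow_two, Homeomorph.mul_apply]; exact sg_sg z
  have h2 : ∀ z, ((sE ^ (2:ℤ))⁻¹) z = z - tp := fun z => by
    have := h ((sE ^ (2:ℤ))⁻¹ z)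
    rw [show (sE ^ (2:ℤ)) ((sE ^ (2:ℤ))⁻¹ z) = z from (sE ^ (2:ℤ)).apply_symm_apply z] at this
    exact eq_sub_of_add_eq this.symm
  rw [zpow_mul]
  induction n using Int.induction_on generalizing z with
  | zero => simp
  | succ n ih => rw [zpow_add_one, Homeomorph.mul_apply, ih, h]; push_cast; ring
  | pred n ih => rw [zpow_sub_one, Homeomorph.mul_apply, ih, h2]; push_cast; ring

lemma qq_fib {z w : ℂ} (h : qq z = qq w) : ∃ n : ℤ, w = (sE ^ n) z := by
  have key : ∀ z w, QQ z = QQ w → ∃ n : ℤ, w = (sE ^ n) z := by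
    intro z w h
    have e : EE w = EE z := by rw [← st_QQ, ← st_QQ, h]
    obtain ⟨n, hn⟩ := Complex.exp_eq_exp_iff_exists_int.1 e
    refine ⟨2 * n, ?_⟩
    rw [sE_two]
    have e2 : starRingEnd ℂ w = starRingEnd ℂ z + n * tp := by
      apply mul_left_cancel₀ Complex.I_ne_zero
      rw [hn, tp]; push_cast; ring
    simpa [tp, Complex.conj_ofNat] using congrArg (starRingEnd ℂ) e2
  rcases (pe _ _).1 h with h | h
  · exact key z w (Subtype.ext h)
  · obtain ⟨n, hn⟩ := key z (sE w) (Subtype.ext (h.trans (QQ_sg w).symm))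
    refine ⟨-1 + n, ?_⟩
    rw [zpow_add, Homeomorph.mul_apply, ← hn, zpow_neg_one]
    exact (sE.symm_apply_apply w).symm

def U0 : Type := {p : P2 // p ≠ p0}
instance : TopologicalSpace U0 := inferInstanceAs (TopologicalSpace {p : P2 // p ≠ p0})
def q' (z : ℂ) : U0 := ⟨qq z, qq_ne z⟩

lemma q'_cov : IsCoveringMap q' := by
  let G := Subgroup.zpowers (sE.toEquiv : Equiv.Perm ℂ)
  have pw : ∀ (n : ℤ) (z : ℂ), ((sE.toEquiv : Equiv.Perm ℂ) ^ n) z = (sE ^ n) z := by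
    have h : ∀ n : ℤ, (sE.toEquiv : Equiv.Perm ℂ) ^ n = (sE ^ n).toEquiv := by
      intro n
      induction n using Int.induction_on with
      | zero => rfl
      | succ n ih => rw [zpow_add_one, ih, zpow_add_one]; rfl
      | pred n ih => rw [zpow_sub_one, ih, zpow_sub_one]; rfl
    intro n z; rw [h]; rfl
  have qo : IsOpenMap q' := fun V hV => by
    have : q' '' V = Subtype.val ⁻¹' (qq '' V) := by
      ext p
      constructor
      · rintro ⟨z, hz, rfl⟩; exact ⟨z, hz, rfl⟩
      · rintro ⟨z, hz, h⟩; exact ⟨z, hz, Subtype.ext h⟩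
    rw [this]
    exact (qq_open V hV).preimage continuous_subtype_val
  have qc : IsOpenQuotientMap q' := ⟨fun p => by
    obtain ⟨z, hz⟩ := qq_sur p.2
    exact ⟨z, Subtype.ext hz⟩, qq_c.subtype_mk _, qo⟩
  have : IsQuotientCoveringMap q' G := by
    refine { qc.isQuotientMap with continuous_const_smul := ?_, apply_eq_iff_mem_orbit := ?_, disjoint := ?_ }
    · rintro ⟨_, n, rfl⟩
      exact (sE ^ n).continuous.congr fun z => (pw n z).symm
    · intro a b
      constructor
      · intro h
        obtain ⟨n, hn⟩ := qq_fib (congrArg Subtype.val h).symm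
        exact ⟨⟨_, n, rfl⟩, (pw n b).trans hn.symm⟩
      · rintro ⟨⟨_, n, rfl⟩, h⟩
        have : (sE ^ n) b = a := (pw n b).symm.trans h
        exact Subtype.ext (by rw [← this]; exact qq_sE n b)
    · intro e
      refine ⟨ball e 1, ball_mem_nhds e one_pos, ?_⟩
      rintro ⟨_, n, rfl⟩ ⟨_, ⟨z, hz, rfl⟩, hw⟩
      have hw' : (sE ^ n) z ∈ ball e 1 := by rw [← pw]; exact hw
      have h1 : |((sE ^ n) z).re - z.re| < 2 := by
        rw [← sub_re]
        refine (abs_re_le_norm _).trans_lt ?_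
        rw [← dist_eq_norm]
        linarith [dist_triangle_right ((sE ^ n) z) z e, mem_ball.1 hz, mem_ball.1 hw']
      rw [sE_re, add_sub_cancel_left, abs_mul, abs_of_pos pi_pos] at h1
      have : n = 0 := by
        by_contra h0
        have : (1:ℝ) ≤ |(n:ℝ)| := by exact_mod_cast Int.one_le_abs h0
        nlinarith [pi_gt_three]
      subst this
      exact Subtype.ext (zpow_zero _)
  exact this.isCoveringMap

lemma null_img {X Y : Type*} [MetricSpace X] [MetricSpace Y] [SecondCountableTopology X] [MeasurableSpace X] [BorelSpace X]
    [MeasurableSpace Y] [BorelSpace Y] {f : X → Y} {s : Set X} (h : ∀ x ∈ s, ∃ K, ∃ t ∈ nhds x, LipschitzOnWith K f (t ∩ s))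
    (h0 : μH[2] s = 0) : μH[2] (f '' s) = 0 := by
  refine measure_null_of_locally_null (μ := OuterMeasure.comap f (μH[2] : Measure Y).toOuterMeasure) s fun x hx => ?_
  obtain ⟨K, t, ht, hK⟩ := h x hx
  refine ⟨t ∩ s, by rw [Set.inter_comm]; exact inter_mem_nhdsWithin _ ht, ?_⟩
  have h1 := hK.hausdorffMeasure_image_le (d := 2) (by norm_num)
  rw [measure_mono_null Set.inter_subset_right h0, mul_zero] at h1
  simpa using h1

lemma vol_null (s : Set ℂ) : volume s = 0 ↔ μH[2] s = 0 := by
  have h := isAddHaarMeasure_hausdorffMeasure (E := ℂ)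
  rw [Complex.finrank_real_complex] at h
  push_cast at h
  exact ⟨fun a => Measure.absolutelyContinuous_isAddHaarMeasure _ _ a, fun a => Measure.absolutelyContinuous_isAddHaarMeasure _ _ a⟩

lemma sph_null (s : Set Sph) : μSph s = 0 ↔ μH[2] ((↑) '' s : Set E3) = 0 := by
  rw [isometry_subtype_coe.hausdorffMeasure_image (Or.inl (by norm_num)), μSph]

lemma neg_null {s : Set Sph} (h : μSph s = 0) : μSph ((fun x => -x) ⁻¹' s) = 0 := by
  have e : (fun x : Sph => -x) ⁻¹' s = (fun x : Sph => -x) '' s := by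
    ext x; exact ⟨fun h => ⟨-x, h, neg_neg x⟩, by rintro ⟨y, hy, rfl⟩; simpa using hy⟩
  rw [e]
  have i : Isometry (fun x : Sph => -x) := fun x y => edist_neg_neg (x : E3) y
  rw [μSph, i.hausdorffMeasure_image (Or.inl (by norm_num))]; exact h

lemma P_null (A : Set P2) : μP2 A = 0 ↔ μSph (π ⁻¹' A) = 0 := by
  have mp : Measurable π := pq.continuous.measurable
  refine ⟨fun h => Measure.preimage_null_of_map_null mp.aemeasurable h, fun h => ?_⟩
  obtain ⟨B, hB, mB, B0⟩ := exists_measurable_superset_of_null h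
  let C : Set P2 := {p | π ⁻¹' {p} ⊆ B}
  have e : π ⁻¹' C = B ∩ (fun x => -x) ⁻¹' B := by
    ext x
    constructor
    · intro hx; exact ⟨hx rfl, hx ((pe _ _).2 (Or.inr (by simp)))⟩
    · rintro ⟨h1, h2⟩ y hy
      rcases (pe _ _).1 hy with h | h
      · rwa [Subtype.ext h]
      · rwa [show y = -x from Subtype.ext h]
  have mC : MeasurableSet C := by
    rw [← mp.measurableSet_preimage_iff_of_surjective pq.surjective, e]
    exact mB.inter (mB.preimage continuous_neg.measurable)
  refine measure_mono_null (t := C) ?_ ?_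
  · intro a ha y hy
    exact hB (by rw [Set.mem_preimage, show π y = a from hy]; exact ha)
  · rw [μP2, Measure.map_apply mp mC, e]
    exact measure_mono_null Set.inter_subset_left B0

lemma null_a {s : Set ℂ} (h : volume s = 0) : μP2 (qq '' s) = 0 := by
  have h1 : μSph (QQ '' s) = 0 := by
    rw [sph_null, Set.image_image]
    refine null_img (fun x _ => ?_) ((vol_null s).1 h)
    obtain ⟨K, t, ht, hK⟩ := (QQ_d.contDiffAt (x := x)).exists_lipschitzOnWith
    exact ⟨K, t, ht, hK.mono Set.inter_subset_left⟩
  rw [P_null]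
  refine measure_mono_null (t := QQ '' s ∪ (fun x => -x) ⁻¹' (QQ '' s)) ?_ (measure_union_null h1 (neg_null h1))
  rintro x ⟨z, hz, e⟩
  rcases (pe _ _).1 e with h | h
  · left; exact ⟨z, hz, Subtype.ext h⟩
  · right; exact ⟨z, hz, Subtype.ext h⟩

lemma null_b {A : Set P2} (h : μP2 A = 0) : volume (qq ⁻¹' A) = 0 := by
  rw [P_null, sph_null] at h
  refine measure_null_of_locally_null _ fun z hz => ?_
  obtain ⟨K, t, ht, hK⟩ := (LL_d z).exists_lipschitzOnWith
  refine ⟨_, inter_mem_nhdsWithin _ (Filter.inter_mem (ball_mem_nhds z one_pos) (QQ_d.continuous.continuousAt ht)), ?_⟩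
  have h2 : μH[2] (LL z '' (t ∩ ((↑) '' (π ⁻¹' A)))) = 0 := by
    have h3 := (hK.mono (Set.inter_subset_left (t := ((↑) '' (π ⁻¹' A))))).hausdorffMeasure_image_le (d := 2) (by norm_num)
    rw [measure_mono_null Set.inter_subset_right h, mul_zero] at h3
    simpa using h3
  rw [vol_null]
  refine measure_mono_null ?_ h2
  rintro w ⟨h4, h5, h6⟩
  refine ⟨QQ w, ⟨h6, QQ w, h4, rfl⟩, LL_QQ ?_⟩
  refine (abs_re_le_norm _).trans_lt ?_
  rw [← dist_eq_norm]
  linarith [mem_ball.1 h5, pi_gt_three]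

lemma null_c (A : Set P2) : μP2 A = 0 ↔ volume (qq ⁻¹' A) = 0 := by
  refine ⟨null_b, fun h => ?_⟩
  have h0 : μP2 {p0} = 0 := by
    rw [P_null]
    have : π ⁻¹' {p0} ⊆ {mkS !₂[0, 0, 1] (by simp), -mkS !₂[0, 0, 1] (by simp)} := by
      intro x hx
      rcases (pe _ _).1 hx with h | h
      · left; exact Subtype.ext h
      · right; exact Subtype.ext h
    have : NullSingletonClass μSph := Measure.nullSingletonClass_hausdorff Sph (d := 2) (by norm_num)
    refine measure_mono_null ‹_› (Set.Countable.measure_zero (Set.toFinite _).countable μSph)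
  refine measure_mono_null ?_ (measure_union_null (null_a h) h0)
  intro p hp
  by_cases h : p = p0
  · right; exact h
  · obtain ⟨z, rfl⟩ := qq_sur h
    left; exact ⟨z, hp, rfl⟩

lemma null_d (s : Set ℂ) : volume s = 0 ↔ μP2 (qq '' s) = 0 :=
  ⟨null_a, fun h => measure_mono_null (Set.subset_preimage_image qq s) (null_b h)⟩

lemma lift_uniq {F G : ℂ → ℂ} (cF : Continuous F) (cG : Continuous G) (h : ∀ z, qq (F z) = qq (G z)) {a : ℂ}
    (ha : F a = G a) : F = G :=
  q'_cov.eq_of_comp_eq cF cG (funext fun z => Subtype.ext (h z)) a ha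

lemma lift_fam {Y : Type*} [TopologicalSpace Y] {g : Y → P2 → P2} (hg : Continuous fun p : Y × P2 => g p.1 p.2)
    (h0 : ∀ y p, p ≠ p0 → g y p ≠ p0) {b : Y → ℂ} (cb : Continuous b) (hb : ∀ y, g y (qq 0) = qq (b y)) :
    ∃ F : Y → ℂ → ℂ, (Continuous fun p : Y × ℂ => F p.1 p.2) ∧ (∀ y z, qq (F y z) = g y (qq z)) ∧ ∀ y, F y 0 = b y := by
  let H : C(unitInterval × (Y × ℂ), U0) := ⟨fun r => ⟨g r.2.1 (qq (((r.1 : ℝ) : ℂ) * r.2.2)), h0 _ _ (qq_ne _)⟩,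
    Continuous.subtype_mk (hg.comp ((by fun_prop : Continuous fun r : unitInterval × (Y × ℂ) => r.2.1).prodMk
      (qq_c.comp (by fun_prop)))) _⟩
  let f : C(Y × ℂ, ℂ) := ⟨fun a => b a.1, cb.comp continuous_fst⟩
  have H0 : ∀ a, H (0, a) = q' (f a) := fun a => Subtype.ext (by
    change g a.1 (qq (((0:ℝ):ℂ) * a.2)) = qq (b a.1)
    rw [Complex.ofReal_zero, zero_mul, hb])
  let K := q'_cov.liftHomotopy H f H0
  have hl : ∀ r, q' (K r) = H r := fun r => congrFun (q'_cov.liftHomotopy_lifts H f H0) r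
  refine ⟨fun y z => K (1, (y, z)), K.continuous.comp (by fun_prop), fun y z => ?_, fun y => ?_⟩
  · have : qq (K (1, (y, z))) = g y (qq ((((1 : unitInterval) : ℝ) : ℂ) * z)) := congrArg Subtype.val (hl (1, (y, z)))
    simpa using this
  · rw [show b y = K (0, (y, 0)) from (q'_cov.liftHomotopy_zero H f H0 (y, 0)).symm]
    refine q'_cov.const_of_comp (g := fun s : unitInterval => K (s, (y, 0))) (K.continuous.comp (by fun_prop)) (fun s s' => ?_) 1 0
    rw [hl, hl]
    refine Subtype.ext ?_
    change g y (qq (((s:ℝ):ℂ)*0)) = g y (qq (((s':ℝ):ℂ)*0))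
    rw [mul_zero, mul_zero]

lemma lift_hom {h : P2 ≃ₜ P2} (h0 : h p0 = p0) {F : ℂ → ℂ} (cF : Continuous F) (hF : ∀ z, qq (F z) = h (qq z)) :
    IsHomeomorph F ∧ ∃ d : ℤ, (d = 1 ∨ d = -1) ∧ ∀ z, F (sE z) = (sE ^ d) (F z) := by
  have h0' : ∀ p, p ≠ p0 → h.symm p ≠ p0 := fun p hp e => hp (by rw [← h.apply_symm_apply p, e, h0])
  obtain ⟨b, hb⟩ := qq_sur (h0' _ (qq_ne 0))
  obtain ⟨G', cG', hG', -⟩ := lift_fam (Y := Unit) (g := fun _ => h.symm) (h.symm.continuous.comp continuous_snd)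
    (fun _ => h0') (b := fun _ => b) continuous_const (fun _ => hb.symm)
  obtain ⟨n, hn⟩ := qq_fib (z := G' () (F 0)) (w := 0) (by rw [hG', hF, h.symm_apply_apply])
  let G : ℂ → ℂ := fun z => (sE ^ n) (G' () z)
  have cG : Continuous G := (sE ^ n).continuous.comp (cG'.comp (by fun_prop : Continuous fun z : ℂ => ((), z)))
  have hG : ∀ z, qq (G z) = h.symm (qq z) := fun z => by rw [qq_sE, hG']
  have GF : ∀ z, G (F z) = z := congrFun (lift_uniq (cG.comp cF) continuous_id (fun z => by simp [hG, hF]) (a := 0) hn.symm)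
  have FG : ∀ z, F (G z) = z := congrFun (lift_uniq (cF.comp cG) continuous_id (fun z => by simp [hG, hF]) (a := F 0)
    (by simp [GF]))
  let Φ : ℂ ≃ₜ ℂ := ⟨⟨F, G, GF, FG⟩, cF, cG⟩
  have dk : ∀ {A : ℂ → ℂ} {k : P2 → P2}, Continuous A → (∀ z, qq (A z) = k (qq z)) → ∃ d : ℤ, ∀ z, A (sE z) = (sE ^ d) (A z) := by
    intro A k cA hA
    obtain ⟨d, hd⟩ := qq_fib (z := A 0) (w := A (sE 0)) (by rw [hA, hA]; exact congrArg k (qq_sg 0).symm)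
    refine ⟨d, congrFun (lift_uniq (cA.comp sE.continuous) ((sE ^ d).continuous.comp cA) (fun z => ?_) hd)⟩
    change qq (A (sE z)) = qq ((sE ^ d) (A z))
    rw [hA, qq_sE, hA]; exact congrArg k (qq_sg z)
  obtain ⟨d, hd⟩ := dk cF hF
  obtain ⟨e, he⟩ := dk cG hG
  refine ⟨Φ.isHomeomorph, d, ?_, hd⟩
  have e1 : Φ * sE * Φ⁻¹ = sE ^ d := by
    rw [mul_inv_eq_iff_eq_mul]; ext1 z; exact hd z
  have e2 : Φ⁻¹ * sE = sE ^ e * Φ⁻¹ := by ext1 z; exact he z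
  have e3 : sE = sE ^ (d * e) := by
    rw [zpow_mul, ← e1, conj_zpow, mul_assoc, ← e2, mul_inv_cancel_left]
  have e4 := congrArg Complex.re (DFunLike.congr_fun e3 0)
  rw [sE_re, show (sE 0).re = _ from sg_re 0] at e4
  have e5 : ((d * e : ℤ) : ℝ) = 1 := by
    have := pi_pos
    simp only [zero_re, zero_add] at e4
    field_simp at e4
    linarith
  exact Int.eq_one_or_neg_one_of_mul_eq_one (by exact_mod_cast e5)

lemma qq_ht (z : ℂ) : pc 2 2 (qq z) = 1 - 1 / Real.cosh z.im ^ 2 := by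
  have := cosh_pos z.im
  rw [qq, pc_pi, QQ2]
  field_simp
  linarith [cosh_sq z.im]

lemma end_nb {W : Set P2} (hW : W ∈ nhds p0) : ∃ S : ℝ, ∀ z, S ≤ |z.im| → qq z ∈ W := by
  obtain ⟨m, hm, h⟩ : ∃ m < 1, ∀ p, m < pc 2 2 p → p ∈ W := by
    rcases (interior W)ᶜ.eq_empty_or_nonempty with h | h
    · exact ⟨0, one_pos, fun p _ => interior_subset (by rw [Set.compl_empty_iff.1 h]; trivial)⟩
    · obtain ⟨p, hp, hx⟩ := (isOpen_interior.isClosed_compl.isCompact).exists_isMaxOn h (pc_c 2 2).continuousOn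
      refine ⟨pc 2 2 p, lt_of_le_of_ne ?_ ?_, fun p' h' => ?_⟩
      · obtain ⟨x, rfl⟩ := pq.surjective p
        rw [pc_pi]
        nlinarith [sph_eq x, sq_nonneg ((x : E3) 0), sq_nonneg ((x : E3) 1)]
      · intro e
        rw [← p0_iff] at e
        exact hp (e ▸ mem_interior_iff_mem_nhds.2 hW)
      · by_contra hn
        exact absurd (hx (fun h => hn (interior_subset h))) (not_le.2 h')
  refine ⟨2 / (1 - m), fun z hz => h _ ?_⟩
  have hm' : 0 < 1 - m := by linarith
  have h1 : (1 + |z.im|) / 2 ≤ Real.cosh z.im := by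
    rw [← Real.cosh_abs, Real.cosh_eq]
    linarith [Real.add_one_le_exp |z.im|, Real.exp_pos (-|z.im|)]
  rw [div_le_iff₀ hm'] at hz
  have h3 := Real.one_le_cosh z.im
  have h2 : 1 < (1 - m) * Real.cosh z.im ^ 2 := by
    have h4 : 1 < (1 - m) * Real.cosh z.im := by nlinarith [mul_le_mul_of_nonneg_left h1 hm'.le]
    nlinarith
  rw [qq_ht, lt_sub_comm, div_lt_iff₀ (by positivity)]
  exact h2

lemma nb_end (T : ℝ) : ∃ W ∈ nhds p0, ∀ z, qq z ∈ W → T ≤ |z.im| := by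
  refine ⟨{p | 1 - 1 / Real.cosh T ^ 2 < pc 2 2 p}, (isOpen_lt continuous_const (pc_c 2 2)).mem_nhds ?_, fun z hz => ?_⟩
  · have := cosh_pos T
    rw [Set.mem_ofPred_eq, (p0_iff _).1 rfl]
    have : 0 < 1 / Real.cosh T ^ 2 := by positivity
    linarith
  · rw [Set.mem_ofPred_eq, qq_ht] at hz
    have h1 := cosh_pos T
    have h2 := cosh_pos z.im
    have h3 : 1 / Real.cosh z.im ^ 2 < 1 / Real.cosh T ^ 2 := by linarith
    rw [one_div_lt_one_div (by positivity) (by positivity)] at h3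
    exact (le_abs_self T).trans (Real.cosh_lt_cosh.1 (lt_of_pow_lt_pow_left₀ 2 h2.le h3)).le

lemma fam_end {Y : Type*} [TopologicalSpace Y] {g : Y → P2 → P2} (hg : Continuous fun p : Y × P2 => g p.1 p.2)
    (h0 : ∀ y, g y p0 = p0) {F : Y → ℂ → ℂ} (hF : ∀ y z, qq (F y z) = g y (qq z)) (y : Y) (T : ℝ) :
    ∃ S, ∀ᶠ y' in nhds y, ∀ z, S ≤ z.im → T ≤ |(F y' z).im| := by
  obtain ⟨W, hW, h⟩ := nb_end T
  have := hg.continuousAt (x := (y, p0)) (by simpa [h0] using hW)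
  rw [nhds_prod_eq, Filter.mem_map, Filter.mem_prod_iff] at this
  obtain ⟨V, hV, W', hW', hs⟩ := this
  obtain ⟨S, hS⟩ := end_nb hW'
  refine ⟨S, ?_⟩
  filter_upwards [hV] with y' hy' z hz
  refine h _ ?_
  rw [hF]
  exact hs (Set.mk_mem_prod hy' (hS z (hz.trans (le_abs_self _))))

lemma sgn_const {F : ℂ → ℂ} (cF : Continuous F) {S : ℝ} (h : ∀ z, S ≤ z.im → 1 ≤ |(F z).im|) {w : ℂ} (hw : S ≤ w.im)
    (hp : 0 < (F w).im) {z : ℂ} (hz : S ≤ z.im) : 0 < (F z).im := by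
  by_contra! hn
  have c : IsPreconnected {z : ℂ | S ≤ z.im} := (convex_halfSpace_im_ge S).isPreconnected
  obtain ⟨v, hv, e⟩ := c.intermediate_value hz hw (f := fun z => (F z).im) (by fun_prop) ⟨hn, hp.le⟩
  have := h v hv
  simp only at e
  rw [e, abs_zero] at this
  linarith

def YY : Set HomNP2 := {g | g.1 p0 = p0 ∧ pc 1 1 (g.1 (qq 0)) = 0}

def bb (p : P2) : ℂ := (Real.arsinh (pc 2 0 p / pc 0 0 p) : ℝ) * Complex.I

lemma bb_qq {p : P2} (h : p ≠ p0) (h1 : pc 1 1 p = 0) : qq (bb p) = p ∧ pc 0 0 p ≠ 0 := by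
  obtain ⟨x, rfl⟩ := pq.surjective p
  have h2 : (x : E3) 1 = 0 := mul_self_eq_zero.1 h1
  have hs := sph_eq x
  rw [h2] at hs
  have h3 : (x : E3) 0 ≠ 0 := fun h3 => h (by rw [p0_iff, pc_pi]; rw [h3] at hs; linarith)
  refine ⟨?_, mul_self_ne_zero.2 h3⟩
  set t := Real.arsinh (pc 2 0 (π x) / pc 0 0 (π x)) with ht
  have e1 : Real.sinh t = (x : E3) 2 / (x : E3) 0 := by
    rw [ht, Real.sinh_arsinh, pc_pi, pc_pi]; field_simp
  have e2 : Real.cosh t ^ 2 * (x : E3) 0 ^ 2 = 1 := by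
    rw [cosh_sq, e1]; field_simp; linarith
  have hc := (cosh_pos t).ne'
  have e0 : bb (π x) = (t : ℂ) * Complex.I := rfl
  have r : (bb (π x)).re = 0 := by simp [e0]
  have m : (bb (π x)).im = t := by simp [e0]
  refine pinj fun i j => ?_
  rw [pc_pi, pc_pi]
  have q0 : (QQ (bb (π x)) : E3) 0 = 1 / Real.cosh t := by rw [QQ0, r, m, Real.cos_zero]
  have q1 : (QQ (bb (π x)) : E3) 1 = 0 := by rw [QQ1, r, Real.sin_zero, zero_div]
  have q2 : (QQ (bb (π x)) : E3) 2 = (x : E3) 2 / (x : E3) 0 / Real.cosh t := by rw [QQ2, m, e1]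
  fin_cases i <;> fin_cases j <;> simp only [Fin.zero_eta, Fin.mk_one, Fin.reduceFinMk, q0, q1, q2, h2, mul_zero, zero_mul] <;>
    (field_simp; try first | linear_combination (-(x : E3) 2) * e2 | linear_combination -e2 | linear_combination (-(x : E3) 2 ^ 2) * e2)

lemma YY_ne (g : YY) (p : P2) (h : p ≠ p0) : g.1.1 p ≠ p0 := fun e => h (g.1.2.1.injective (e.trans g.2.1.symm))

lemma FF_ex : ∃ F : YY → ℂ → ℂ, (Continuous fun p : YY × ℂ => F p.1 p.2) ∧ (∀ y z, qq (F y z) = y.1.1 (qq z)) ∧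
    ∀ y, F y 0 = bb (y.1.1 (qq 0)) := by
  have c : Continuous fun p : YY × P2 => p.1.1.1 p.2 := by fun_prop
  refine lift_fam (g := fun y p => y.1.1 p) c YY_ne ?_ fun y => (bb_qq (YY_ne y _ (qq_ne 0)) y.2.2).1.symm
  have c1 : Continuous fun y : YY => y.1.1 (qq 0) := by fun_prop
  refine (Complex.continuous_ofReal.comp (Real.continuous_arsinh.comp ?_)).mul continuous_const
  exact ((pc_c 2 0).comp c1).div ((pc_c 0 0).comp c1) fun y => (bb_qq (YY_ne y _ (qq_ne 0)) y.2.2).2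

def FF : YY → ℂ → ℂ := FF_ex.choose
lemma FF_c : Continuous fun p : YY × ℂ => FF p.1 p.2 := FF_ex.choose_spec.1
lemma FF_q (y : YY) (z : ℂ) : qq (FF y z) = y.1.1 (qq z) := FF_ex.choose_spec.2.1 y z
lemma FF_0 (y : YY) : FF y 0 = bb (y.1.1 (qq 0)) := FF_ex.choose_spec.2.2 y
lemma FF_cc (y : YY) : Continuous (FF y) := FF_c.comp (by fun_prop : Continuous fun z : ℂ => (y, z))
lemma FF_cy (z : ℂ) : Continuous fun y => FF y z := FF_c.comp (by fun_prop : Continuous fun y : YY => (y, z))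

lemma FF_h (y : YY) : IsHomeomorph (FF y) ∧ ∃ d : ℤ, (d = 1 ∨ d = -1) ∧ ∀ z, FF y (sE z) = (sE ^ d) (FF y z) :=
  lift_hom (h := y.1.2.1.homeomorph y.1.1) y.2.1 (FF_cc y) (FF_q y)

lemma FF_np (y : YY) : NP (FF y) := fun s => by
  rw [null_d, null_d, y.1.2.2, ← Set.image_comp, ← Set.image_comp,
    show (y.1.1 : P2 → P2) ∘ qq = qq ∘ FF y from funext fun z => (FF_q y z).symm]

def Up (F : ℂ → ℂ) : Prop := ∃ S : ℝ, ∀ z, S ≤ z.im → 0 < (F z).im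

lemma FF_end (y : YY) (T : ℝ) : ∃ S, ∀ᶠ y' in nhds y, ∀ z, S ≤ z.im → T ≤ |(FF y' z).im| :=
  fam_end (g := fun (y : YY) p => y.1.1 p) (by fun_prop) (fun y => y.2.1) FF_q y T

lemma up_iff {F : ℂ → ℂ} (cF : Continuous F) {S : ℝ} (h : ∀ z, S ≤ z.im → 1 ≤ |(F z).im|) :
    Up F ↔ 1 ≤ (F (S * Complex.I)).im := by
  have hS : S ≤ ((S : ℂ) * Complex.I).im := by simp
  constructor
  · rintro ⟨S', h'⟩
    have := sgn_const cF h (w := (max S S' : ℝ) * Complex.I) (by simp) (h' _ (by simp)) hS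
    simpa [abs_of_pos this] using h _ hS
  · exact fun h1 => ⟨S, fun z hz => sgn_const cF h hS (by linarith) hz⟩

lemma up_closed : IsClosed {y : YY | Up (FF y)} := by
  refine isClosed_of_closure_subset fun y hy => ?_
  obtain ⟨S, hS⟩ := FF_end y 1
  rw [mem_closure_iff_frequently] at hy
  refine (up_iff (FF_cc y) hS.self_of_nhds).2 ?_
  have c : IsClosed {y : YY | 1 ≤ (FF y (S * Complex.I)).im} :=
    isClosed_le continuous_const (continuous_im.comp (FF_cy _))
  exact c.closure_subset (mem_closure_iff_frequently.2 ((hy.and_eventually hS).mono fun y' h => (up_iff (FF_cc y') h.2).1 h.1))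

lemma up_nb {y : YY} (hy : Up (FF y)) (T : ℝ) : ∃ S, ∀ᶠ y' in nhds y, ∀ z, S ≤ z.im → T ≤ (FF y' z).im := by
  obtain ⟨S, hS⟩ := FF_end y (max T 1)
  have hS1 := hS.mono fun y' h z hz => (le_max_right T 1).trans (h z hz)
  have h1 := (up_iff (FF_cc y) hS1.self_of_nhds).1 hy
  have h2 : ∀ᶠ y' in nhds y, 0 < (FF y' (S * Complex.I)).im :=
    (continuous_im.comp (FF_cy _)).continuousAt.eventually (lt_mem_nhds (by simpa using lt_of_lt_of_le one_pos h1))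
  refine ⟨S, ?_⟩
  filter_upwards [hS, hS1, h2] with y' a b c z hz
  have := sgn_const (FF_cc y') b (w := S * Complex.I) (by simp) c hz
  have d := a z hz
  rw [abs_of_pos this] at d
  exact (le_max_left _ _).trans d

lemma up_or (y : YY) : Up (FF y) ∨ Up (fun z => -FF y z) := by
  obtain ⟨S, hS⟩ := FF_end y 1
  have h := hS.self_of_nhds
  rw [up_iff (FF_cc y) h, up_iff (F := fun z => -FF y z) (FF_cc y).neg (S := S) (by simpa using h)]
  simpa using le_abs.1 (h (S * Complex.I) (by simp))

def XX : Set YY := {y | Up (FF y) ∧ ∀ z, FF y (sg z) = sg (FF y z)}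

lemma YY_closed : IsClosed YY := by
  refine (isClosed_eq (by fun_prop) continuous_const).inter (isClosed_eq ((pc_c 1 1).comp (by fun_prop)) continuous_const)

def XH : Set HomNP2 := Subtype.val '' XX

lemma XH_closed : IsClosed XH := by
  refine YY_closed.isClosedEmbedding_subtypeVal.isClosedMap _ (up_closed.inter ?_)
  change IsClosed {y : YY | ∀ z, FF y (sg z) = sg (FF y z)}
  rw [Set.ofPred_forall]
  exact isClosed_iInter fun z => isClosed_eq (FF_cy _) (sg_cont.comp (FF_cy _))

def FX (x : XX) : ℂ → ℂ := FF x.1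

lemma FX_fam : Fam FX where
  L x := ⟨(FF_h x.1).1, x.2.2, fun T => by
    obtain ⟨S, hS⟩ := up_nb x.2.1 T
    exact ⟨S, hS.self_of_nhds⟩⟩
  c := FF_c.comp (by fun_prop : Continuous fun p : XX × ℂ => (p.1.1, p.2))
  up x T := by
    obtain ⟨S, hS⟩ := up_nb x.2.1 T
    exact ⟨S, continuous_subtype_val.continuousAt.eventually hS⟩

lemma sg_zp {G : ℂ → ℂ} (h : IsHomeomorph G) (hs : ∀ z, G (sg z) = sg (G z)) (n : ℤ) (z : ℂ) :
    G ((sE ^ n) z) = (sE ^ n) (G z) := by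
  have : Commute (h.homeomorph G) sE := by ext1 z; exact hs z
  exact DFunLike.congr_fun (this.zpow_right n) z

def dsc (G : ℂ → ℂ) (p : P2) : P2 := open Classical in if h : p = p0 then p0 else qq (G (qq_sur h).choose)

lemma dsc_0 (G : ℂ → ℂ) : dsc G p0 = p0 := by simp [dsc]

lemma Lift.dsc {G : ℂ → ℂ} (hG : Lift G) (z : ℂ) : dsc G (qq z) = qq (G z) := by
  rw [_root_.dsc, dif_neg (qq_ne z)]
  obtain ⟨n, hn⟩ := qq_fib (qq_sur (qq_ne z)).choose_spec
  conv_rhs => rw [hn, sg_zp hG.hom hG.sg, qq_sE]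

lemma Fam.dsc_c {X : Type*} [TopologicalSpace X] {G : X → ℂ → ℂ} (hG : Fam G) :
    Continuous fun r : X × P2 => dsc (G r.1) r.2 := by
  rw [continuous_iff_continuousAt]
  rintro ⟨x, p⟩
  by_cases hp : p = p0
  · subst hp
    intro W hW
    simp only [dsc_0] at hW
    obtain ⟨T, hT⟩ := end_nb hW
    obtain ⟨S, hS⟩ := hG.up x T
    obtain ⟨W', hW', h'⟩ := nb_end S
    rw [nhds_prod_eq, Filter.mem_map, Filter.mem_prod_iff]
    refine ⟨_, hS, W', hW', ?_⟩
    rintro ⟨y, p⟩ ⟨hy, hp⟩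
    change dsc (G y) p ∈ W
    by_cases e : p = p0
    · rw [e, dsc_0]; exact mem_of_mem_nhds hW
    obtain ⟨z, rfl⟩ := qq_sur e
    rw [(hG.L y).dsc]
    refine hT _ (le_abs.2 ((le_abs.1 (h' z hp)).imp (hy z) fun h => ?_))
    have := hy (sg z) (by rwa [sg_im])
    rwa [(hG.L y).sg, sg_im] at this
  · obtain ⟨z, rfl⟩ := qq_sur hp
    have o : IsOpenMap (Prod.map id qq : X × ℂ → X × P2) := IsOpenMap.id.prodMap qq_open
    refine Filter.Tendsto.mono_left (Filter.tendsto_map'_iff.2 ?_) (o.nhds_le (x, z))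
    have : (fun r : X × P2 => dsc (G r.1) r.2) ∘ (Prod.map id qq : X × ℂ → X × P2) = fun r => qq (G r.1 r.2) :=
      funext fun r => (hG.L r.1).dsc r.2
    rw [this, show (fun r : X × P2 => dsc (G r.1) r.2) (x, qq z) = _ from (hG.L x).dsc z]
    exact (qq_c.comp hG.c).continuousAt (x := (x, z))

lemma Lift.dsc_h {G : ℂ → ℂ} (hG : Lift G) : IsHomeomorph (_root_.dsc G) := by
  have f : Fam (fun _ : Unit => G) := ⟨fun _ => hG, hG.hom.continuous.comp continuous_snd, fun _ T => by
    obtain ⟨S, hS⟩ := hG.up T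
    exact ⟨S, Filter.Eventually.of_forall fun _ => hS⟩⟩
  rw [isHomeomorph_iff_continuous_bijective]
  refine ⟨f.dsc_c.comp (by fun_prop : Continuous fun p : P2 => ((), p)), fun p p' h => ?_, fun p => ?_⟩
  · by_cases e : p = p0 <;> by_cases e' : p' = p0
    · rw [e, e']
    · obtain ⟨z, rfl⟩ := qq_sur e'
      rw [e, dsc_0, hG.dsc] at h
      exact absurd h.symm (qq_ne _)
    · obtain ⟨z, rfl⟩ := qq_sur e
      rw [e', dsc_0, hG.dsc] at h
      exact absurd h (qq_ne _)
    · obtain ⟨z, rfl⟩ := qq_sur e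
      obtain ⟨z', rfl⟩ := qq_sur e'
      rw [hG.dsc, hG.dsc] at h
      obtain ⟨n, hn⟩ := qq_fib h
      rw [← sg_zp hG.hom hG.sg] at hn
      rw [hG.hom.injective hn, qq_sE]
  · by_cases e : p = p0
    · exact ⟨p0, by rw [e, dsc_0]⟩
    · obtain ⟨z, rfl⟩ := qq_sur e
      obtain ⟨w, rfl⟩ := hG.hom.surjective z
      exact ⟨qq w, hG.dsc w⟩

lemma Lift.dsc_n {G : ℂ → ℂ} (hG : Lift G) (hN : NP G) (A : Set P2) : μP2 A = 0 ↔ μP2 (_root_.dsc G '' A) = 0 := by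
  rw [null_c, null_c, hN]
  suffices G '' (qq ⁻¹' A) = qq ⁻¹' (_root_.dsc G '' A) by rw [this]
  ext w
  constructor
  · rintro ⟨z, hz, rfl⟩
    exact ⟨qq z, hz, hG.dsc z⟩
  · rintro ⟨a, ha, h⟩
    by_cases e : a = p0
    · rw [e, dsc_0] at h
      exact absurd h.symm (qq_ne _)
    obtain ⟨z, rfl⟩ := qq_sur e
    rw [hG.dsc] at h
    obtain ⟨n, hn⟩ := qq_fib h
    refine ⟨(sE ^ n) z, ?_, by rw [hn, sg_zp hG.hom hG.sg]⟩
    rwa [Set.mem_preimage, qq_sE]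

def DD (r : XX × unitInterval) : HomNP2 :=
  ⟨⟨dsc (CC FX r), (FX_fam.CC.L r).dsc_h.continuous⟩, (FX_fam.CC.L r).dsc_h,
    (FX_fam.CC.L r).dsc_n (CC_np FX_fam (FF_np r.1.1) r.2)⟩

lemma DD_c : Continuous DD := by
  refine Continuous.subtype_mk (ContinuousMap.continuous_of_continuous_uncurry _ ?_) _
  exact FX_fam.CC.dsc_c

lemma hom_ext {f g : HomNP2} (h0 : f.1 p0 = g.1 p0) (h : ∀ z, f.1 (qq z) = g.1 (qq z)) : f = g := by
  refine Subtype.ext (ContinuousMap.ext fun p => ?_)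
  by_cases e : p = p0
  · rw [e, h0]
  · obtain ⟨z, rfl⟩ := qq_sur e
    exact h z

lemma DD_q (r : XX × unitInterval) (z : ℂ) : (DD r).1 (qq z) = qq (CC FX r z) := (FX_fam.CC.L r).dsc z
lemma DD_p (r : XX × unitInterval) : (DD r).1 p0 = p0 := dsc_0 _

def oneH : HomNP2 := ⟨ContinuousMap.id _, IsHomeomorph.id, fun A => by simp⟩

lemma DD_0 (x : XX) : DD (x, 0) = x.1.1 :=
  hom_ext (by rw [DD_p, x.1.2.1]) fun z => by rw [DD_q, CC_zero FX_fam, FX, FF_q]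

lemma DD_1 (x : XX) : DD (x, 1) = oneH := hom_ext (DD_p _) fun z => by rw [DD_q, CC_one]; rfl

lemma DD_id (x : XX) (h : x.1.1 = oneH) (t : unitInterval) : DD (x, t) = oneH := by
  refine hom_ext (DD_p _) fun z => ?_
  have : FX x = id := by
    refine lift_uniq (FF_cc _) continuous_id (fun z => ?_) (a := 0) ?_
    · rw [FX, FF_q, h]; rfl
    · change FF x.1 0 = 0
      rw [FF_0, h]
      change bb (π (QQ 0)) = 0
      rw [bb, pc_pi, QQ2]
      simp
  rw [DD_q, CC_id FX_fam this]; rfl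

lemma one_XX : oneH ∈ XH := by
  have hy : oneH ∈ YY := ⟨rfl, by change (QQ 0 : E3) 1 * (QQ 0 : E3) 1 = 0; simp [QQ1]⟩
  have : FF ⟨oneH, hy⟩ = id := by
    refine lift_uniq (FF_cc _) continuous_id (fun z => ?_) (a := 0) ?_
    · rw [FF_q]; rfl
    · rw [FF_0]
      change bb (π (QQ 0)) = 0
      rw [bb, pc_pi, QQ2]
      simp
  refine ⟨⟨oneH, hy⟩, ⟨?_, ?_⟩, rfl⟩
  · rw [this]; exact ⟨1, fun z h => lt_of_lt_of_le one_pos h⟩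
  · rw [this]; exact fun _ => rfl

abbrev SO : Type := Matrix.specialOrthogonalGroup (Fin 3) ℝ

lemma so_iff (M : Matrix (Fin 3) (Fin 3) ℝ) : M ∈ Matrix.specialOrthogonalGroup (Fin 3) ℝ ↔ M.transpose * M = 1 ∧ M.det = 1 := by
  rw [Matrix.mem_specialOrthogonalGroup_iff, Matrix.mem_orthogonalGroup_iff']

instance : CompactSpace SO := by
  refine (isCompact_iff_compactSpace (s := ((Matrix.specialOrthogonalGroup (Fin 3) ℝ : Submonoid _) : Set (Matrix (Fin 3) (Fin 3) ℝ)))).1 ?_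
  refine IsCompact.of_isClosed_subset (s := Set.pi Set.univ fun _ : Fin 3 => Set.pi Set.univ fun _ : Fin 3 => Set.Icc (-1 : ℝ) 1)
    (isCompact_univ_pi fun _ => isCompact_univ_pi fun _ => isCompact_Icc) ?_ fun M hM i _ j _ => ?_
  · have : ((Matrix.specialOrthogonalGroup (Fin 3) ℝ : Submonoid _) : Set (Matrix (Fin 3) (Fin 3) ℝ)) =
      {M | M.transpose * M = 1} ∩ {M | M.det = 1} := by ext M; exact so_iff M
    rw [this]
    exact (isClosed_eq (by fun_prop) continuous_const).inter (isClosed_eq (by fun_prop) continuous_const)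
  · have := entry_norm_bound_of_unitary (Matrix.mem_specialOrthogonalGroup_iff.1 hM).1 i j
    exact abs_le.1 this

def aV (Q : SO) (v : E3) : E3 := WithLp.toLp 2 (Q.1.mulVec v.ofLp)

lemma aV_n (Q : SO) (v : E3) : ‖aV Q v‖ = ‖v‖ := by
  have h : dotProduct (Q.1.mulVec v.ofLp) (Q.1.mulVec v.ofLp) = dotProduct v.ofLp v.ofLp := by
    rw [Matrix.dotProduct_mulVec, Matrix.vecMul_mulVec, ((so_iff _).1 Q.2).1, Matrix.vecMul_one]
  rw [EuclideanSpace.norm_eq, EuclideanSpace.norm_eq]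
  congr 1
  simpa [dotProduct, aV, sq] using h

lemma aV_mul (Q R : SO) (v : E3) : aV (Q * R) v = aV Q (aV R v) := by simp [aV, Matrix.mulVec_mulVec]
lemma aV_one (v : E3) : aV 1 v = v := by simp [aV]
lemma aV_neg (Q : SO) (v : E3) : aV Q (-v) = -aV Q v := by simp [aV, Matrix.mulVec_neg]

def aS (Q : SO) (x : Sph) : Sph := ⟨aV Q x, by rw [mem_sphere_zero_iff_norm, aV_n]; exact mem_sphere_zero_iff_norm.1 x.2⟩

lemma aS_mul (Q R : SO) (x : Sph) : aS (Q * R) x = aS Q (aS R x) := Subtype.ext (aV_mul Q R x)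
lemma aS_one (x : Sph) : aS 1 x = x := Subtype.ext (aV_one x)

lemma aS_c : Continuous fun r : SO × Sph => aS r.1 r.2 := by
  refine Continuous.subtype_mk ?_ _
  unfold aV
  fun_prop

lemma aS_i (Q : SO) : Isometry (aS Q) := Isometry.of_dist_eq fun x y => by
  rw [Subtype.dist_eq, Subtype.dist_eq, dist_eq_norm, dist_eq_norm, ← aV_n Q (x - y)]
  simp [aS, aV, Matrix.mulVec_sub]

def aP (Q : SO) : P2 → P2 := Quotient.lift (fun x => π (aS Q x)) (by
  rintro x y h
  refine (pe _ _).2 (Or.imp (fun h => ?_) (fun h => ?_) h)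
  · exact congrArg (aV Q) h
  · exact (congrArg (aV Q) h).trans (aV_neg Q y))

lemma aP_pi (Q : SO) (x : Sph) : aP Q (π x) = π (aS Q x) := rfl

lemma aP_c : Continuous fun r : SO × P2 => aP r.1 r.2 :=
  (IsOpenQuotientMap.id.prodMap pq).isQuotientMap.continuous_iff.2 (pq.continuous.comp aS_c)

lemma aP_mul (Q R : SO) (p : P2) : aP (Q * R) p = aP Q (aP R p) := by
  obtain ⟨x, rfl⟩ := pq.surjective p
  simp only [aP_pi, aS_mul]

lemma aP_one (p : P2) : aP 1 p = p := by
  obtain ⟨x, rfl⟩ := pq.surjective p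
  rw [aP_pi, aS_one]

lemma aP_cc (Q : SO) : Continuous (aP Q) := aP_c.comp (by fun_prop : Continuous fun p : P2 => (Q, p))

def aE (Q : SO) : P2 ≃ₜ P2 where
  toFun := aP Q
  invFun := aP Q⁻¹
  left_inv p := by rw [← aP_mul, inv_mul_cancel, aP_one]
  right_inv p := by rw [← aP_mul, mul_inv_cancel, aP_one]
  continuous_toFun := aP_cc Q
  continuous_invFun := aP_cc _

def actH (Q : SO) : HomNP2 := ⟨⟨aP Q, aP_cc Q⟩, (aE Q).isHomeomorph, fun A => by
  have e : π ⁻¹' (aP Q '' A) = aS Q '' (π ⁻¹' A) := by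
    ext x
    constructor
    · rintro ⟨p, hp, h⟩
      refine ⟨aS Q⁻¹ x, ?_, by rw [← aS_mul, mul_inv_cancel, aS_one]⟩
      rw [Set.mem_preimage, ← aP_pi, ← h, ← aP_mul, inv_mul_cancel, aP_one]; exact hp
    · rintro ⟨y, hy, rfl⟩
      exact ⟨π y, hy, rfl⟩
  rw [P_null, P_null, ContinuousMap.coe_mk, e, μSph, (aS_i Q).hausdorffMeasure_image (Or.inl (by norm_num))]⟩

lemma actH_c : Continuous actH := Continuous.subtype_mk (ContinuousMap.continuous_of_continuous_uncurry _ aP_c) _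

lemma compH_c : Continuous fun r : HomNP2 × HomNP2 => compH r.1 r.2 := by
  refine Continuous.subtype_mk ?_ _
  exact (continuous_subtype_val.comp continuous_fst).compCM (continuous_subtype_val.comp continuous_snd)

lemma actH_mul (Q R : SO) : compH (actH Q) (actH R) = actH (Q * R) :=
  Subtype.ext (ContinuousMap.ext fun p => (aP_mul Q R p).symm)
lemma actH_mul' (Q R : SO) (f : HomNP2) : compH (actH Q) (compH (actH R) f) = compH (actH (Q * R)) f :=
  Subtype.ext (ContinuousMap.ext fun p => (aP_mul Q R _).symm)
lemma actH_one : actH 1 = oneH := Subtype.ext (ContinuousMap.ext aP_one)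
lemma one_comp (f : HomNP2) : compH oneH f = f := rfl
lemma comp_one (f : HomNP2) : compH f oneH = f := rfl

lemma ind_iff (g : HomNP2) (Q : SO) : InducedBy g Q.1 ↔ g = actH Q := by
  constructor
  · intro h
    refine Subtype.ext (ContinuousMap.ext fun p => ?_)
    obtain ⟨x, rfl⟩ := pq.surjective p
    exact h x (aS Q x) rfl
  · rintro rfl x y h
    have : y = aS Q x := Subtype.ext (WithLp.ofLp_injective _ h)
    rw [this]; rfl

lemma mkSO (M : Matrix (Fin 3) (Fin 3) ℝ) (h : M.transpose * M = 1) (h' : M.det = 1) :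
    M ∈ Matrix.specialOrthogonalGroup (Fin 3) ℝ := (so_iff M).2 ⟨h, h'⟩

def Rz (t : ℝ) : SO := ⟨!![Real.cos t, -Real.sin t, 0; Real.sin t, Real.cos t, 0; 0, 0, 1], mkSO _ (by
  have := sin_sq_add_cos_sq t
  ext i j; fin_cases i <;> fin_cases j <;> simp [Matrix.mul_apply, Fin.sum_univ_three] <;> linarith)
  (by simp [Matrix.det_fin_three]; linarith [sin_sq_add_cos_sq t])⟩

def Rx : SO := ⟨!![1, 0, 0; 0, -1, 0; 0, 0, -1], mkSO _ (by
  ext i j; fin_cases i <;> fin_cases j <;> simp [Matrix.mul_apply, Fin.sum_univ_three])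
  (by simp [Matrix.det_fin_three])⟩

def Rt (s c : ℝ) (h : s ^ 2 + c ^ 2 = 1) : SO := ⟨!![s, 0, -c; 0, 1, 0; c, 0, s], mkSO _ (by
  ext i j; fin_cases i <;> fin_cases j <;> simp [Matrix.mul_apply, Fin.sum_univ_three] <;> linarith)
  (by simp [Matrix.det_fin_three]; linarith)⟩

lemma Rz_x (t : ℝ) (x : Sph) : (aS (Rz t) x : E3) = !₂[Real.cos t * (x : E3) 0 - Real.sin t * (x : E3) 1,
    Real.sin t * (x : E3) 0 + Real.cos t * (x : E3) 1, (x : E3) 2] := by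
  ext i; fin_cases i <;> simp [aS, aV, Rz, Matrix.mulVec, dotProduct, Fin.sum_univ_three]; ring

lemma Rx_x (x : Sph) : (aS Rx x : E3) = !₂[(x : E3) 0, -(x : E3) 1, -(x : E3) 2] := by
  ext i; fin_cases i <;> simp [aS, aV, Rx, Matrix.mulVec, dotProduct, Fin.sum_univ_three]

lemma Rz_q (t : ℝ) (z : ℂ) : aP (Rz t) (qq z) = qq (z + t) := by
  rw [qq, aP_pi, qq]
  congr 1
  refine Subtype.ext ?_
  rw [Rz_x]
  ext i; fin_cases i <;> simp [QQ0, QQ1, QQ2, Real.cos_add, Real.sin_add] <;> ring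

lemma Rx_q (z : ℂ) : aP Rx (qq z) = qq (-z) := by
  rw [qq, aP_pi, qq]
  congr 1
  refine Subtype.ext ?_
  rw [Rx_x]
  ext i; fin_cases i <;> simp [QQ0, QQ1, QQ2] <;> ring

lemma Rz_p (t : ℝ) : aP (Rz t) p0 = p0 := by
  rw [p0_iff, p0, aP_pi, pc_pi, Rz_x]; simp [mkS]

lemma Rx_p : aP Rx p0 = p0 := by
  rw [p0_iff, p0, aP_pi, pc_pi, Rx_x]; simp [mkS]

lemma so_rz {R : SO} (h : R.1 2 2 = 1) : ∃ t, R = Rz t := by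
  obtain ⟨h1, h2⟩ := (so_iff R.1).1 R.2
  have h3 := mul_eq_one_comm.1 h1
  have e (i j) := congrFun (congrFun h1 i) j
  have e' := congrFun (congrFun h3 2) 2
  have e22 := e 2 2
  have e00 := e 0 0
  have e01 := e 0 1
  have e11 := e 1 1
  simp [Matrix.mul_apply, Fin.sum_univ_three, h] at e' e22 e00 e01 e11
  have a : R.1 2 0 = 0 := by nlinarith [sq_nonneg (R.1 2 0), sq_nonneg (R.1 2 1)]
  have b : R.1 2 1 = 0 := by nlinarith [sq_nonneg (R.1 2 0), sq_nonneg (R.1 2 1)]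
  have c : R.1 0 2 = 0 := by nlinarith [sq_nonneg (R.1 0 2), sq_nonneg (R.1 1 2)]
  have d : R.1 1 2 = 0 := by nlinarith [sq_nonneg (R.1 0 2), sq_nonneg (R.1 1 2)]
  simp [Matrix.det_fin_three, h, a, b, c, d] at h2 e00 e01 e11
  have f1 : R.1 1 1 = R.1 0 0 := by linear_combination R.1 0 0 * h2 - R.1 1 1 * e00 + R.1 1 0 * e01
  have f2 : R.1 0 1 = -R.1 1 0 := by linear_combination -R.1 1 0 * h2 - R.1 0 1 * e00 + R.1 0 0 * e01
  set u : ℂ := ⟨R.1 0 0, R.1 1 0⟩ with hu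
  have n : ‖u‖ = 1 := by
    rw [← sq_eq_sq₀ (norm_nonneg _) one_pos.le, Complex.sq_norm, normSq_apply]; simp [hu]; linarith
  have c1 := Complex.norm_mul_cos_arg u
  have s1 := Complex.norm_mul_sin_arg u
  rw [n, one_mul] at c1 s1
  rw [show u.re = R.1 0 0 from rfl] at c1
  rw [show u.im = R.1 1 0 from rfl] at s1
  refine ⟨u.arg, Subtype.ext ?_⟩
  ext i j
  fin_cases i <;> fin_cases j <;> simp [Rz, h, a, b, c, d, c1, s1, f1, f2]

lemma so_st {R : SO} (h : aP R p0 = p0) : ∃ t, R = Rz t ∨ R = Rz t * Rx := by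
  rw [p0_iff, p0, aP_pi, pc_pi] at h
  simp [aS, aV, mkS, Matrix.mulVec, dotProduct, Fin.sum_univ_three] at h
  rcases mul_self_eq_one_iff.1 h with h | h
  · exact (so_rz h).imp fun _ => Or.inl
  · obtain ⟨t, ht⟩ := so_rz (R := R * Rx) (by simp [Rx, Matrix.mul_apply, Fin.sum_univ_three, h])
    refine ⟨t, Or.inr ?_⟩
    rw [← ht, mul_assoc, show Rx * Rx = 1 from ?_, mul_one]
    refine Subtype.ext ?_
    ext i j; fin_cases i <;> fin_cases j <;> simp [Rx, Matrix.mul_apply, Fin.sum_univ_three]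

lemma sE_odd (k : ℤ) (z : ℂ) : ((sE ^ (2 * k + 1)) z).im = -z.im := by
  rw [zpow_add, zpow_one]
  change ((sE ^ (2 * k)) (sE z)).im = _
  rw [sE_two]
  change (sg z + _).im = _
  simp [sg_im, tp]

lemma FF_rel (y w : YY) {M : ℂ → ℂ} (cM : Continuous M) (h : ∀ z, w.1.1 (qq z) = qq (M (FF y z))) :
    ∃ n : ℤ, ∀ z, FF w z = (sE ^ n) (M (FF y z)) := by
  obtain ⟨n, hn⟩ := qq_fib (z := M (FF y 0)) (w := FF w 0) (by rw [FF_q, h])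
  refine ⟨n, congrFun (lift_uniq (FF_cc w) ((sE ^ n).continuous.comp (cM.comp (FF_cc y))) (fun z => ?_) hn)⟩
  change _ = qq ((sE ^ n) (M (FF y z)))
  rw [qq_sE, FF_q, h]

lemma FF_re (y : YY) : (FF y 0).re = 0 := by rw [FF_0, bb]; simp

lemma up_not {F G : ℂ → ℂ} (h : Up F) (h' : Up G) (e : ∀ z, (F z).im = -(G z).im) : False := by
  obtain ⟨S, hS⟩ := h
  obtain ⟨T, hT⟩ := h'
  have a := hS ((max S T : ℝ) * Complex.I) (by simp)
  have b := hT ((max S T : ℝ) * Complex.I) (by simp)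
  rw [e] at a
  linarith

lemma uniq {y w : YY} (hy : y ∈ XX) (hw : w ∈ XX) {R : SO} (h : w.1 = compH (actH R) y.1) : R = 1 := by
  have h' : ∀ p, w.1.1 p = aP R (y.1.1 p) := fun p => by rw [h]; rfl
  have hp := h' p0
  rw [y.2.1, w.2.1] at hp
  obtain ⟨t, rfl | rfl⟩ := so_st hp.symm
  · obtain ⟨n, hn⟩ := FF_rel y w (M := fun z => z + t) (by fun_prop) fun z => by rw [h', ← FF_q, Rz_q]
    obtain ⟨k, rfl | rfl⟩ := Int.even_or_odd' n
    · have e := congrArg Complex.re (hn 0)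
      rw [sE_re] at e
      simp only [add_re, FF_re, ofReal_re] at e
      have ht : t = ((-k : ℤ) : ℝ) * (2 * pi) := by push_cast at e ⊢; linarith
      refine Subtype.ext ?_
      have c1 : Real.cos t = 1 := by rw [ht, Real.cos_int_mul_two_pi]
      have s1 : Real.sin t = 0 := by
        rw [ht, show ((-k : ℤ) : ℝ) * (2 * pi) = ((-k * 2 : ℤ) : ℝ) * pi by push_cast; ring, Real.sin_int_mul_pi]
      ext i j
      fin_cases i <;> fin_cases j <;> simp [Rz, c1, s1]
    · refine (up_not hw.1 hy.1 fun z => ?_).elim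
      rw [hn, sE_odd]; simp
  · obtain ⟨n, hn⟩ := FF_rel y w (M := fun z => -z + t) (by fun_prop) fun z => by rw [h', ← FF_q, aP_mul, Rx_q, Rz_q]
    have e := congrArg Complex.re (hw.2 0)
    rw [hn, hy.2, sg_re, hn, sE_re, sE_re] at e
    simp only [add_re, Complex.neg_re, sg_re] at e
    linarith [pi_pos]

lemma ex1 (p : P2) : ∃ Q : SO, aP Q p = p0 := by
  by_cases h : p = p0
  · exact ⟨1, by rw [aP_one, h]⟩
  obtain ⟨z, rfl⟩ := qq_sur h
  have hc := (cosh_pos z.im).ne'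
  refine ⟨Rt (Real.sinh z.im / Real.cosh z.im) (1 / Real.cosh z.im) ?_ * Rz (-z.re), ?_⟩
  · field_simp; linarith [cosh_sq z.im]
  rw [aP_mul, Rz_q, p0_iff, qq, aP_pi, pc_pi]
  simp [aS, aV, Rt, Matrix.mulVec, dotProduct, Fin.sum_univ_three, QQ0, QQ1, QQ2]
  field_simp
  rw [show Real.cosh z.im ^ 4 = (Real.cosh z.im ^ 2) ^ 2 by ring, cosh_sq]; ring

lemma ex2 (f : HomNP2) : ∃ Q : SO, compH (actH Q) f ∈ YY := by
  obtain ⟨Q, hQ⟩ := ex1 (f.1 p0)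
  have hn : aP Q (f.1 (qq 0)) ≠ p0 := fun e => qq_ne 0 (f.2.1.injective ((aE Q).injective (e.trans hQ.symm)))
  obtain ⟨z, hz⟩ := qq_sur hn
  refine ⟨Rz (-z.re) * Q, ?_, ?_⟩
  · change aP _ (f.1 p0) = p0
    rw [aP_mul, hQ, Rz_p]
  · change pc 1 1 (aP _ (f.1 (qq 0))) = 0
    rw [aP_mul, ← hz, Rz_q, qq, pc_pi, QQ1]
    simp

lemma sE_com (n : ℤ) (z : ℂ) : (sE ^ n) (sg z) = sg ((sE ^ n) z) :=
  DFunLike.congr_fun ((Commute.refl sE).zpow_left n) z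

lemma ex3 (y : YY) : ∃ Q : SO, ∃ h : compH (actH Q) y.1 ∈ YY, ∀ z, FF ⟨_, h⟩ (sg z) = sg (FF ⟨_, h⟩ z) := by
  obtain ⟨-, d, rfl | rfl, hd⟩ := FF_h y
  · refine ⟨1, ?_⟩
    rw [actH_one]
    exact ⟨y.2, fun z => by simp only [zpow_one] at hd; exact hd z⟩
  · have hy : compH (actH Rx) y.1 ∈ YY := by
      refine ⟨?_, ?_⟩
      · change aP _ (y.1.1 p0) = p0
        rw [y.2.1, Rx_p]
      · change pc 1 1 (aP _ (y.1.1 (qq 0))) = 0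
        have := y.2.2
        rw [← FF_q, qq, pc_pi] at this
        rw [← FF_q, qq, aP_pi, pc_pi, Rx_x]
        simpa using this
    refine ⟨Rx, hy, fun z => ?_⟩
    obtain ⟨n, hn⟩ := FF_rel y ⟨_, hy⟩ (M := fun z => -z) (by fun_prop) fun z => by
      change aP Rx (y.1.1 (qq z)) = _
      rw [← FF_q, Rx_q]
    rw [hn, hn, ← sE_com]
    congr 1
    have e : sg (FF y (sg z)) = FF y z := by
      rw [show FF y (sg z) = _ from hd z, zpow_neg_one]
      exact sE.apply_symm_apply _
    rw [← e]
    apply Complex.ext <;> simp [sg_re, sg_im]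

lemma ex4 (y : YY) (hs : ∀ z, FF y (sg z) = sg (FF y z)) : ∃ Q : SO, compH (actH Q) y.1 ∈ XH := by
  rcases up_or y with h | h
  · exact ⟨1, y, ⟨h, hs⟩, by rw [actH_one]; rfl⟩
  have hy : compH (actH (Rz pi)) y.1 ∈ YY := by
    refine ⟨?_, ?_⟩
    · change aP _ (y.1.1 p0) = p0
      rw [y.2.1, Rz_p]
    · change pc 1 1 (aP _ (y.1.1 (qq 0))) = 0
      have := y.2.2
      rw [← FF_q, qq, pc_pi] at this
      rw [← FF_q, qq, aP_pi, pc_pi, Rz_x]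
      simpa using this
  obtain ⟨n, hn⟩ := FF_rel y ⟨_, hy⟩ (M := fun z => z + pi) (by fun_prop) fun z => by
    change aP _ (y.1.1 (qq z)) = _
    rw [← FF_q, Rz_q]
  have e := congrArg Complex.re (hn 0)
  rw [sE_re] at e
  simp only [add_re, FF_re, ofReal_re] at e
  have hn1 : n = 2 * (-1) + 1 := by
    have : (n : ℝ) = -1 := by
      have := pi_pos
      have : (n + 1 : ℝ) * pi = 0 := by linarith
      rcases mul_eq_zero.1 this with h | h <;> linarith
    have : n = -1 := by exact_mod_cast this
    omega
  refine ⟨Rz pi, ⟨_, hy⟩, ⟨?_, fun z => ?_⟩, rfl⟩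
  · obtain ⟨S, hS⟩ := h
    refine ⟨S, fun z hz => ?_⟩
    rw [hn, hn1, sE_odd]
    simpa using hS z hz
  · rw [hn, hn, hs, ← sE_com]
    congr 1
    apply Complex.ext <;> simp [sg_re, sg_im]

lemma exq (f : HomNP2) : ∃ Q : SO, compH (actH Q) f ∈ XH := by
  obtain ⟨Q, hQ⟩ := ex2 f
  obtain ⟨R, h, hR⟩ := ex3 ⟨_, hQ⟩
  obtain ⟨T, hT⟩ := ex4 ⟨_, h⟩ hR
  refine ⟨T * (R * Q), ?_⟩
  simpa only [actH_mul'] using hT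

lemma unq {f : HomNP2} {Q R : SO} (hQ : compH (actH Q) f ∈ XH) (hR : compH (actH R) f ∈ XH) : Q = R := by
  obtain ⟨y, hy, ey⟩ := hQ
  obtain ⟨w, hw, ew⟩ := hR
  have := uniq hy hw (R := R * Q⁻¹) (by rw [ew, ey, actH_mul', inv_mul_cancel_right])
  exact (mul_inv_eq_one.1 this).symm

def qf (f : HomNP2) : SO := (exq f).choose
lemma qf_s (f : HomNP2) : compH (actH (qf f)) f ∈ XH := (exq f).choose_spec

lemma qf_c : Continuous qf := by
  rw [continuous_iff_isClosed]
  intro K hK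
  have hC : IsClosed ({r : HomNP2 × SO | compH (actH r.2) r.1 ∈ XH} ∩ Prod.snd ⁻¹' K) :=
    (XH_closed.preimage (compH_c.comp ((actH_c.comp continuous_snd).prodMk continuous_fst))).inter (hK.preimage continuous_snd)
  convert isClosedMap_fst_of_compactSpace _ hC using 1
  ext f
  constructor
  · exact fun h => ⟨(f, qf f), ⟨qf_s f, h⟩, rfl⟩
  · rintro ⟨⟨f', Q⟩, ⟨h1, h2⟩, rfl⟩
    rw [Set.mem_preimage, unq (qf_s f') h1]; exact h2

def toX (g : HomNP2) (h : g ∈ XH) : XX := ⟨⟨g, by obtain ⟨y, -, rfl⟩ := h; exact y.2⟩, by obtain ⟨y, hy, rfl⟩ := h; exact hy⟩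

def rho (r : HomNP2 × unitInterval) : HomNP2 := compH (actH (qf r.1)⁻¹) (DD (toX _ (qf_s r.1), r.2))

lemma rho_c : Continuous rho := by
  have cq : Continuous fun r : HomNP2 × unitInterval => qf r.1 := qf_c.comp continuous_fst
  have ci : Continuous fun Q : SO => Q⁻¹ :=
    Continuous.subtype_mk (f := fun Q : SO => Q.1.transpose) continuous_subtype_val.matrix_transpose fun Q => (Q⁻¹).2
  refine compH_c.comp ((actH_c.comp (ci.comp cq)).prodMk (DD_c.comp (Continuous.prodMk ?_ continuous_snd)))
  exact Continuous.subtype_mk (Continuous.subtype_mk (compH_c.comp ((actH_c.comp cq).prodMk continuous_fst)) _) _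

lemma toX_congr {g g' : HomNP2} (e : g = g') (h : g ∈ XH) (h' : g' ∈ XH) : toX g h = toX g' h' := by subst e; rfl

lemma qf_mul (Q : SO) (f : HomNP2) : qf (compH (actH Q) f) = qf f * Q⁻¹ :=
  unq (qf_s _) (by rw [actH_mul', inv_mul_cancel_right]; exact qf_s f)

lemma qf_act (Q : SO) : qf (actH Q) = Q⁻¹ :=
  unq (qf_s _) (by rw [actH_mul, inv_mul_cancel, actH_one]; exact one_XX)

/-- There is a strong `SO₃`-equivariant deformation retraction from `Hom_N(P²)` to `SO₃`. -/
theorem deformation_retraction_homNP2_to_SO3 :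
    ∃ ρ : HomNP2 × unitInterval → HomNP2,
      Continuous ρ ∧
      (∀ f : HomNP2, ρ (f, 0) = f) ∧
      (∀ f : HomNP2, ∃ Q ∈ Matrix.specialOrthogonalGroup (Fin 3) ℝ, InducedBy (ρ (f, 1)) Q) ∧
      (∀ Q ∈ Matrix.specialOrthogonalGroup (Fin 3) ℝ, ∀ qbar : HomNP2, InducedBy qbar Q →
        ∀ t : unitInterval, ρ (qbar, t) = qbar) ∧
      (∀ Q ∈ Matrix.specialOrthogonalGroup (Fin 3) ℝ, ∀ qbar : HomNP2, InducedBy qbar Q →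
        ∀ f : HomNP2, ∀ t : unitInterval,
          ρ (compH qbar f, t) = compH qbar (ρ (f, t))) := by
  refine ⟨rho, rho_c, fun f => ?_, fun f => ⟨_, (qf f)⁻¹.2, (ind_iff _ _).2 ?_⟩, fun Q hQ g hg t => ?_, fun Q hQ g hg f t => ?_⟩
  · rw [rho, DD_0]
    change compH _ (compH (actH (qf f)) f) = f
    rw [actH_mul', inv_mul_cancel, actH_one, one_comp]
  · rw [rho, DD_1, comp_one]
  · obtain rfl := (ind_iff g ⟨Q, hQ⟩).1 hg
    rw [rho, DD_id, comp_one]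
    · simp only [qf_act, inv_inv]
    · change compH _ _ = _
      rw [qf_act, actH_mul, inv_mul_cancel, actH_one]
  · obtain rfl := (ind_iff g ⟨Q, hQ⟩).1 hg
    rw [rho, rho, toX_congr (g' := compH (actH (qf f)) f) (by simp only [qf_mul, actH_mul', inv_mul_cancel_right]) _ (qf_s f)]
    simp only [qf_mul, mul_inv_rev, inv_inv, actH_mul']
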